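/- arXiv:2009.01173 — 2 statements merged into one kernel-verified Lean document; each statement's English description precedes it below -/
import Mathlib

section
/- (Raufi's matrix-valued Prekopa theorem) Let g̃(t,x): ℝⁿ_t × ℝᵐ_x → GL(r,ℂ) be a C² Hermitian metric (positive definite Hermitian matrix valued) on the trivial bundle ℝⁿ⁺ᵐ × ℂʳ which is Nakano semi-positive in the real sense, and suppose g(t) = ∫_{ℝᵐ} g̃(t,x) dV_x (entrywise integration) is finite for every t and defines a C² map g: ℝⁿ → GL(r,ℂ). Then g is a Nakano semi-positive (in the real sense) Hermitian metric on the trivial bundle ℝⁿ × ℂʳ. -/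
open MeasureTheory
open scoped ENNReal ComplexOrder

noncomputable section

/-- Partial derivative `∂f/∂x_j` of a complex-matrix-entry function of real variables. -/
def realPD {N : ℕ} (j : Fin N) (f : (Fin N → ℝ) → ℂ) (p : Fin N → ℝ) : ℂ :=
  fderiv ℝ f p (Pi.single j 1)

/-- Entrywise partial derivative `∂G/∂x_j` of a matrix-valued function. -/
def matRealPD {N r : ℕ} (j : Fin N) (G : (Fin N → ℝ) → Matrix (Fin r) (Fin r) ℂ)
    (p : Fin N → ℝ) : Matrix (Fin r) (Fin r) ℂ :=
  Matrix.of fun a b => realPD j (fun q => G q a b) p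

/-- Curvature coefficient in the real sense: `Θ^G_{jk} = -∂/∂x_k (G⁻¹ ∂G/∂x_j)`. -/
def realChernCurv {N r : ℕ} (G : (Fin N → ℝ) → Matrix (Fin r) (Fin r) ℂ) (j k : Fin N)
    (p : Fin N → ℝ) : Matrix (Fin r) (Fin r) ℂ :=
  Matrix.of fun a b => - realPD k (fun q => ((G q)⁻¹ * matRealPD j G q) a b) p

/-- A `C²` Hermitian metric on the trivial bundle `Ω × ℂʳ` over `Ω ⊆ ℝᴺ`: positive
definite Hermitian matrix valued and `C²` entrywise. -/
def IsHermitianMetricReal {N r : ℕ} (Ω : Set (Fin N → ℝ))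
    (G : (Fin N → ℝ) → Matrix (Fin r) (Fin r) ℂ) : Prop :=
  (∀ p ∈ Ω, (G p).PosDef) ∧ ∀ a b : Fin r, ContDiffOn ℝ 2 (fun q => G q a b) Ω

/-- Nakano semi-positivity in the real sense: `∑_{j,k} (Θ^G_{jk} u_j, u_k)_G ≥ 0` at every
point of `Ω`, where `(v, w)_G = w* G v`. -/
def NakanoSemiPositiveReal {N r : ℕ} (Ω : Set (Fin N → ℝ))
    (G : (Fin N → ℝ) → Matrix (Fin r) (Fin r) ℂ) : Prop :=
  ∀ p ∈ Ω, ∀ u : Fin N → Fin r → ℂ,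
    0 ≤ (∑ j : Fin N, ∑ k : Fin N, ∑ a : Fin r, ∑ b : Fin r,
      star (u k b) * G p b a * Matrix.mulVec (realChernCurv G j k p) (u j) a).re

section Calculus

open Matrix

variable {N r : ℕ}

/-- The vector-valued partial derivative, taken componentwise. -/
def vecPD (j : Fin N) (v : (Fin N → ℝ) → Fin r → ℂ) (p : Fin N → ℝ) : Fin r → ℂ :=
  fun a => realPD j (fun q => v q a) p

/-- The sesquilinear form `u* A v`. -/
def sesq (A : Matrix (Fin r) (Fin r) ℂ) (u v : Fin r → ℂ) : ℂ := star u ⬝ᵥ (A *ᵥ v)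

/-- The covariant derivative `H⁻¹ ∂_j (H v)` of the metric `H`. -/
def covD (H : (Fin N → ℝ) → Matrix (Fin r) (Fin r) ℂ) (j : Fin N)
    (v : (Fin N → ℝ) → Fin r → ℂ) (p : Fin N → ℝ) : Fin r → ℂ :=
  (H p)⁻¹ *ᵥ vecPD j (fun q => H q *ᵥ v q) p

/-- The weighted Laplacian `∑_j H⁻¹ ∂_j (H ∂_j v)` of the metric `H`. -/
def metricLap (H : (Fin N → ℝ) → Matrix (Fin r) (Fin r) ℂ)
    (v : (Fin N → ℝ) → Fin r → ℂ) (p : Fin N → ℝ) : Fin r → ℂ :=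
  ∑ j, covD H j (vecPD j v) p

lemma contDiff_realPD {n m : WithTop ℕ∞} (hmn : m + 1 ≤ n) (j : Fin N) {f : (Fin N → ℝ) → ℂ}
    (hf : ContDiff ℝ n f) : ContDiff ℝ m (realPD j f) :=
  (hf.fderiv_right hmn).clm_apply contDiff_const

lemma contDiff_vecPD {n m : WithTop ℕ∞} (hmn : m + 1 ≤ n) (j : Fin N)
    {v : (Fin N → ℝ) → Fin r → ℂ} (hv : ContDiff ℝ n v) : ContDiff ℝ m (vecPD j v) :=
  contDiff_pi.2 fun a => contDiff_realPD hmn j (contDiff_pi.1 hv a)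

lemma realPD_const (j : Fin N) (c : ℂ) (p : Fin N → ℝ) : realPD j (fun _ => c) p = 0 := by
  simp [realPD]

lemma realPD_add (j : Fin N) {f g : (Fin N → ℝ) → ℂ} {p : Fin N → ℝ}
    (hf : DifferentiableAt ℝ f p) (hg : DifferentiableAt ℝ g p) :
    realPD j (fun q => f q + g q) p = realPD j f p + realPD j g p := by
  simp [realPD, fderiv_fun_add hf hg]

lemma realPD_sub (j : Fin N) {f g : (Fin N → ℝ) → ℂ} {p : Fin N → ℝ}
    (hf : DifferentiableAt ℝ f p) (hg : DifferentiableAt ℝ g p) :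
    realPD j (fun q => f q - g q) p = realPD j f p - realPD j g p := by
  simp [realPD, fderiv_fun_sub hf hg]

lemma realPD_mul (j : Fin N) {f g : (Fin N → ℝ) → ℂ} {p : Fin N → ℝ}
    (hf : DifferentiableAt ℝ f p) (hg : DifferentiableAt ℝ g p) :
    realPD j (fun q => f q * g q) p = realPD j f p * g p + f p * realPD j g p := by
  simp [realPD, fderiv_fun_mul hf hg]
  ring

lemma realPD_sum {ι : Type*} (s : Finset ι) (j : Fin N) {f : ι → (Fin N → ℝ) → ℂ}
    {p : Fin N → ℝ} (hf : ∀ i ∈ s, DifferentiableAt ℝ (f i) p) :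
    realPD j (fun q => ∑ i ∈ s, f i q) p = ∑ i ∈ s, realPD j (f i) p := by
  simp [realPD, fderiv_fun_sum hf]

lemma realPD_star (j : Fin N) (f : (Fin N → ℝ) → ℂ) (p : Fin N → ℝ) :
    realPD j (fun q => star (f q)) p = star (realPD j f p) := by
  simp only [realPD]
  rw [fderiv_star]
  rfl

lemma realPD_comm {f : (Fin N → ℝ) → ℂ} (hf : ContDiff ℝ 2 f) (j k : Fin N) (p : Fin N → ℝ) :
    realPD k (realPD j f) p = realPD j (realPD k f) p := by
  have hd : DifferentiableAt ℝ (fderiv ℝ f) p :=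
    ((hf.fderiv_right (m := 1) (by norm_num)).differentiable (by norm_num)) p
  have h : ∀ i l : Fin N, realPD l (realPD i f) p
      = fderiv ℝ (fderiv ℝ f) p (Pi.single l 1) (Pi.single i 1) := by
    intro i l
    have : realPD i f = fun q => fderiv ℝ f q (Pi.single i 1) := rfl
    rw [this]
    simp only [realPD]
    rw [fderiv_clm_apply hd (differentiableAt_const _)]
    simp
  rw [h, h]
  exact (hf.contDiffAt.isSymmSndFDerivAt (by simp)) _ _

lemma vecPD_comm {v : (Fin N → ℝ) → Fin r → ℂ} (hv : ContDiff ℝ 2 v) (j k : Fin N)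
    (p : Fin N → ℝ) : vecPD k (vecPD j v) p = vecPD j (vecPD k v) p :=
  funext fun a => realPD_comm (contDiff_pi.1 hv a) j k p

lemma hasCompactSupport_realPD (j : Fin N) {f : (Fin N → ℝ) → ℂ} (hf : HasCompactSupport f) :
    HasCompactSupport (realPD j f) := by
  refine (hf.fderiv ℝ).comp_left (g := fun L : (Fin N → ℝ) →L[ℝ] ℂ => L (Pi.single j 1)) ?_
  simp

lemma realPD_of_eventuallyEq (j : Fin N) {f g : (Fin N → ℝ) → ℂ} {p : Fin N → ℝ}
    (h : f =ᶠ[nhds p] g) : realPD j f p = realPD j g p := by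
  simp [realPD, h.fderiv_eq]

lemma hasCompactSupport_vecPD (j : Fin N) {v : (Fin N → ℝ) → Fin r → ℂ}
    (hv : HasCompactSupport v) : HasCompactSupport (vecPD j v) := by
  refine hv.mono' ?_
  intro p hp
  by_contra h
  apply hp
  funext a
  have h0 : (fun q => v q a) =ᶠ[nhds p] fun _ => (0 : ℂ) := by
    filter_upwards [notMem_tsupport_iff_eventuallyEq.1 h] with q hq
    simp [hq]
  show realPD j (fun q => v q a) p = 0
  rw [realPD_of_eventuallyEq j h0, realPD_const]

lemma integral_realPD_eq_zero (j : Fin N) {f : (Fin N → ℝ) → ℂ} (hf : ContDiff ℝ 1 f)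
    (hc : HasCompactSupport f) : ∫ p, realPD j f p = 0 := by
  have hcont : Continuous (realPD j f) := (contDiff_realPD (m := 0) (by norm_num) j hf).continuous
  have hi : Integrable (realPD j f) :=
    hcont.integrable_of_hasCompactSupport (hasCompactSupport_realPD j hc)
  have hi' : Integrable f := hf.continuous.integrable_of_hasCompactSupport hc
  have := integral_mul_fderiv_eq_neg_fderiv_mul_of_integrable (𝕜 := ℂ) (μ := volume)
    (f := f) (g := fun _ => (1 : ℂ)) (v := (Pi.single j 1 : Fin N → ℝ))
    (by simpa [realPD, Function.comp_def] using (show Integrable (fun p => realPD j f p) from hi))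
    (by simp) (by simpa using hi')
    (fun x _ => hf.differentiable (by norm_num) x) (fun x _ => differentiableAt_const _)
  simpa [realPD] using this

lemma vecPD_mulVec (j : Fin N) {A : (Fin N → ℝ) → Matrix (Fin r) (Fin r) ℂ}
    {v : (Fin N → ℝ) → Fin r → ℂ} {p : Fin N → ℝ}
    (hA : ∀ a b, DifferentiableAt ℝ (fun q => A q a b) p)
    (hv : ∀ a, DifferentiableAt ℝ (fun q => v q a) p) :
    vecPD j (fun q => A q *ᵥ v q) p = matRealPD j A p *ᵥ v p + A p *ᵥ vecPD j v p := by
  funext a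
  simp only [vecPD, mulVec, dotProduct, Pi.add_apply, matRealPD, of_apply]
  rw [realPD_sum _ _ fun b _ => (hA a b).fun_mul (hv b), ← Finset.sum_add_distrib]
  exact Finset.sum_congr rfl fun b _ => realPD_mul j (hA a b) (hv b)

lemma vecPD_add (j : Fin N) {u v : (Fin N → ℝ) → Fin r → ℂ} {p : Fin N → ℝ}
    (hu : ∀ a, DifferentiableAt ℝ (fun q => u q a) p)
    (hv : ∀ a, DifferentiableAt ℝ (fun q => v q a) p) :
    vecPD j (fun q => u q + v q) p = vecPD j u p + vecPD j v p := by
  funext a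
  exact realPD_add j (hu a) (hv a)

lemma realPD_dotProduct (j : Fin N) {u v : (Fin N → ℝ) → Fin r → ℂ} {p : Fin N → ℝ}
    (hu : ∀ a, DifferentiableAt ℝ (fun q => u q a) p)
    (hv : ∀ a, DifferentiableAt ℝ (fun q => v q a) p) :
    realPD j (fun q => star (u q) ⬝ᵥ v q) p
      = star (vecPD j u p) ⬝ᵥ v p + star (u p) ⬝ᵥ vecPD j v p := by
  simp only [dotProduct, Pi.star_apply, vecPD]
  rw [realPD_sum _ _ fun b _ => (hu b).star.fun_mul (hv b), ← Finset.sum_add_distrib]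
  refine Finset.sum_congr rfl fun b _ => ?_
  rw [realPD_mul j (hu b).star (hv b), realPD_star]

lemma contDiff_mulVec {n : WithTop ℕ∞} {A : (Fin N → ℝ) → Matrix (Fin r) (Fin r) ℂ}
    {v : (Fin N → ℝ) → Fin r → ℂ} (hA : ∀ a b, ContDiff ℝ n (fun q => A q a b))
    (hv : ContDiff ℝ n v) : ContDiff ℝ n (fun q => A q *ᵥ v q) :=
  contDiff_pi.2 fun a => by
    simp only [mulVec, dotProduct]
    exact ContDiff.sum fun b _ => (hA a b).mul (contDiff_pi.1 hv b)

lemma contDiff_star {n : WithTop ℕ∞} {f : (Fin N → ℝ) → ℂ} (hf : ContDiff ℝ n f) :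
    ContDiff ℝ n (fun q => star (f q)) :=
  Complex.conjCLE.contDiff.comp hf

lemma contDiff_sesq {n : WithTop ℕ∞} {A : (Fin N → ℝ) → Matrix (Fin r) (Fin r) ℂ}
    {u v : (Fin N → ℝ) → Fin r → ℂ} (hA : ∀ a b, ContDiff ℝ n (fun q => A q a b))
    (hu : ContDiff ℝ n u) (hv : ContDiff ℝ n v) :
    ContDiff ℝ n (fun q => sesq (A q) (u q) (v q)) :=
  show ContDiff ℝ n (fun q => ∑ b, star (u q b) * (A q *ᵥ v q) b) from
    ContDiff.sum fun b _ => (contDiff_star (contDiff_pi.1 hu b)).mul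
      (contDiff_pi.1 (contDiff_mulVec hA hv) b)

lemma contDiff_det {n : WithTop ℕ∞} {A : (Fin N → ℝ) → Matrix (Fin r) (Fin r) ℂ}
    (hA : ∀ a b, ContDiff ℝ n (fun q => A q a b)) : ContDiff ℝ n (fun q => (A q).det) := by
  simp only [det_apply]
  refine ContDiff.sum fun σ _ => ?_
  refine ContDiff.const_smul _ ?_
  exact contDiff_prod fun i _ => hA _ _

lemma contDiff_inv {n : WithTop ℕ∞} {A : (Fin N → ℝ) → Matrix (Fin r) (Fin r) ℂ}
    (hA : ∀ a b, ContDiff ℝ n (fun q => A q a b)) (h0 : ∀ q, (A q).det ≠ 0) (a b : Fin r) :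
    ContDiff ℝ n (fun q => (A q)⁻¹ a b) := by
  simp only [inv_def, Ring.inverse_eq_inv', Matrix.smul_apply, smul_eq_mul, adjugate_apply]
  refine ((contDiff_det hA).inv h0).mul (contDiff_det fun i l => ?_)
  simp only [updateRow_apply]
  split_ifs
  · exact contDiff_const
  · exact hA _ _

lemma sesq_add_right (A : Matrix (Fin r) (Fin r) ℂ) (u v w : Fin r → ℂ) :
    sesq A u (v + w) = sesq A u v + sesq A u w := by
  simp [sesq, mulVec_add, dotProduct_add]

lemma sesq_add_left (A : Matrix (Fin r) (Fin r) ℂ) (u v w : Fin r → ℂ) :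
    sesq A (u + v) w = sesq A u w + sesq A v w := by
  simp [sesq, add_dotProduct]

lemma sesq_sub_right (A : Matrix (Fin r) (Fin r) ℂ) (u v w : Fin r → ℂ) :
    sesq A u (v - w) = sesq A u v - sesq A u w := by
  simp [sesq, mulVec_sub, dotProduct_sub]

lemma sesq_smul_right (A : Matrix (Fin r) (Fin r) ℂ) (c : ℂ) (u v : Fin r → ℂ) :
    sesq A u (c • v) = c * sesq A u v := by
  simp [sesq, mulVec_smul]

lemma sesq_smul_left (A : Matrix (Fin r) (Fin r) ℂ) (c : ℂ) (u v : Fin r → ℂ) :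
    sesq A (c • u) v = star c * sesq A u v := by
  simp [sesq]

lemma sesq_sum_right {ι : Type*} (s : Finset ι) (A : Matrix (Fin r) (Fin r) ℂ) (u : Fin r → ℂ)
    (v : ι → Fin r → ℂ) : sesq A u (∑ i ∈ s, v i) = ∑ i ∈ s, sesq A u (v i) := by
  simp [sesq, mulVec_sum, dotProduct_sum]

lemma sesq_sum_left {ι : Type*} (s : Finset ι) (A : Matrix (Fin r) (Fin r) ℂ) (u : ι → Fin r → ℂ)
    (v : Fin r → ℂ) : sesq A (∑ i ∈ s, u i) v = ∑ i ∈ s, sesq A (u i) v := by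
  simp [sesq, star_sum, sum_dotProduct]

lemma star_sesq {A : Matrix (Fin r) (Fin r) ℂ} (hA : A.IsHermitian) (u v : Fin r → ℂ) :
    star (sesq A u v) = sesq A v u := by
  simp only [sesq]
  rw [← star_dotProduct, star_mulVec, hA.eq, ← dotProduct_mulVec]

lemma sesq_self_re_nonneg {A : Matrix (Fin r) (Fin r) ℂ} (hA : A.PosDef) (u : Fin r → ℂ) :
    0 ≤ (sesq A u u).re := hA.posSemidef.re_dotProduct_nonneg u

end Calculus

section Metric

open Matrix

variable {N r : ℕ} {H : (Fin N → ℝ) → Matrix (Fin r) (Fin r) ℂ}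

lemma IsHermitianMetricReal.posDef (hH : IsHermitianMetricReal Set.univ H) (p : Fin N → ℝ) :
    (H p).PosDef := hH.1 p trivial

lemma IsHermitianMetricReal.contDiff (hH : IsHermitianMetricReal Set.univ H) (a b : Fin r) :
    ContDiff ℝ 2 (fun q => H q a b) := contDiffOn_univ.1 (hH.2 a b)

lemma IsHermitianMetricReal.contDiff_one (hH : IsHermitianMetricReal Set.univ H) (a b : Fin r) :
    ContDiff ℝ 1 (fun q => H q a b) := (hH.contDiff a b).of_le (by norm_num)

lemma IsHermitianMetricReal.contDiff_zero (hH : IsHermitianMetricReal Set.univ H) (a b : Fin r) :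
    ContDiff ℝ 0 (fun q => H q a b) := (hH.contDiff a b).of_le (by norm_num)

lemma IsHermitianMetricReal.det_ne_zero (hH : IsHermitianMetricReal Set.univ H)
    (p : Fin N → ℝ) : (H p).det ≠ 0 := (hH.posDef p).det_pos.ne'

lemma IsHermitianMetricReal.contDiff_inv (hH : IsHermitianMetricReal Set.univ H) (a b : Fin r) :
    ContDiff ℝ 2 (fun q => (H q)⁻¹ a b) :=
  _root_.contDiff_inv hH.contDiff hH.det_ne_zero a b

lemma IsHermitianMetricReal.mul_inv (hH : IsHermitianMetricReal Set.univ H) (p : Fin N → ℝ) :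
    H p * (H p)⁻¹ = 1 := mul_nonsing_inv _ (isUnit_iff_ne_zero.2 (hH.det_ne_zero p))

lemma IsHermitianMetricReal.inv_mul (hH : IsHermitianMetricReal Set.univ H) (p : Fin N → ℝ) :
    (H p)⁻¹ * H p = 1 := nonsing_inv_mul _ (isUnit_iff_ne_zero.2 (hH.det_ne_zero p))

lemma IsHermitianMetricReal.contDiff_matRealPD (hH : IsHermitianMetricReal Set.univ H) (j : Fin N)
    (a b : Fin r) : ContDiff ℝ 1 (fun q => matRealPD j H q a b) :=
  contDiff_realPD (by norm_num) j (hH.contDiff a b)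

lemma mulVec_covD (hH : IsHermitianMetricReal Set.univ H) (j : Fin N)
    (v : (Fin N → ℝ) → Fin r → ℂ) (p : Fin N → ℝ) :
    H p *ᵥ covD H j v p = vecPD j (fun q => H q *ᵥ v q) p := by
  simp [covD, hH.mul_inv]

lemma differentiableAt_pi_apply {v : (Fin N → ℝ) → Fin r → ℂ} (hv : ContDiff ℝ 1 v)
    (p : Fin N → ℝ) (a : Fin r) : DifferentiableAt ℝ (fun q => v q a) p :=
  (contDiff_pi.1 hv a).differentiable (by norm_num) p

lemma covD_eq (hH : IsHermitianMetricReal Set.univ H) (j : Fin N)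
    {v : (Fin N → ℝ) → Fin r → ℂ} (hv : ContDiff ℝ 1 v) (p : Fin N → ℝ) :
    covD H j v p = vecPD j v p + ((H p)⁻¹ * matRealPD j H p) *ᵥ v p := by
  rw [covD, vecPD_mulVec j (fun a b => (hH.contDiff_one a b).differentiable (by norm_num) p)
    (differentiableAt_pi_apply hv p), mulVec_add, mulVec_mulVec, mulVec_mulVec, hH.inv_mul,
    one_mulVec, add_comm]

lemma contDiff_covD (hH : IsHermitianMetricReal Set.univ H) {m n : WithTop ℕ∞} (hmn : m + 1 ≤ n)
    (hn : n ≤ 2) (j : Fin N) {v : (Fin N → ℝ) → Fin r → ℂ} (hv : ContDiff ℝ n v) :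
    ContDiff ℝ m (covD H j v) :=
  contDiff_mulVec (fun a b => (hH.contDiff_inv a b).of_le (le_self_add.trans (hmn.trans hn)))
    (contDiff_vecPD hmn j (contDiff_mulVec (fun a b => (hH.contDiff a b).of_le hn) hv))

lemma hasCompactSupport_mulVec (A : (Fin N → ℝ) → Matrix (Fin r) (Fin r) ℂ)
    {v : (Fin N → ℝ) → Fin r → ℂ} (hv : HasCompactSupport v) :
    HasCompactSupport (fun q => A q *ᵥ v q) := by
  refine hv.mono fun p hp => ?_
  contrapose! hp
  simp only [Function.mem_support, not_not] at hp ⊢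
  simp [hp]

lemma hasCompactSupport_covD (j : Fin N) {v : (Fin N → ℝ) → Fin r → ℂ}
    (hv : HasCompactSupport v) : HasCompactSupport (covD H j v) :=
  hasCompactSupport_mulVec _ (hasCompactSupport_vecPD j (hasCompactSupport_mulVec _ hv))

lemma contDiff_metricLap (hH : IsHermitianMetricReal Set.univ H)
    {v : (Fin N → ℝ) → Fin r → ℂ} (hv : ContDiff ℝ 2 v) : ContDiff ℝ 0 (metricLap H v) := by
  unfold metricLap
  exact ContDiff.sum fun j _ => contDiff_covD (n := 1) hH (by norm_num) (by norm_num) j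
    (contDiff_vecPD (by norm_num) j hv)

lemma hasCompactSupport_metricLap {v : (Fin N → ℝ) → Fin r → ℂ}
    (hv : HasCompactSupport v) : HasCompactSupport (metricLap H v) := by
  refine hv.mono' fun p hp => ?_
  by_contra h
  refine hp (Finset.sum_eq_zero fun j _ => ?_)
  have h0 : v =ᶠ[nhds p] fun _ => 0 := notMem_tsupport_iff_eventuallyEq.1 h
  have h1 : (fun q => H q *ᵥ vecPD j v q) =ᶠ[nhds p] fun _ => 0 := by
    filter_upwards [h0.eventually_nhds] with q hq
    have : vecPD j v q = 0 := by
      funext a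
      refine (realPD_of_eventuallyEq j (g := fun _ => (0 : ℂ)) ?_).trans (realPD_const _ _ _)
      filter_upwards [hq] with x hx
      simp [hx]
    simp [this]
  have h2 : vecPD j (fun q => H q *ᵥ vecPD j v q) p = 0 := by
    funext a
    refine (realPD_of_eventuallyEq j (g := fun _ => (0 : ℂ)) ?_).trans (realPD_const _ _ _)
    filter_upwards [h1] with x hx
    simp [hx]
  simp [covD, h2]

lemma hasCompactSupport_sesq (A : (Fin N → ℝ) → Matrix (Fin r) (Fin r) ℂ)
    {u v : (Fin N → ℝ) → Fin r → ℂ} (hc : HasCompactSupport u ∨ HasCompactSupport v) :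
    HasCompactSupport (fun q => sesq (A q) (u q) (v q)) := by
  rcases hc with hc | hc
  all_goals
    refine hc.mono fun p hp => ?_
    contrapose! hp
    simp only [Function.mem_support, not_not] at hp ⊢
    simp [sesq, hp]

lemma integrable_sesq (hH : IsHermitianMetricReal Set.univ H)
    {u v : (Fin N → ℝ) → Fin r → ℂ} (hu : Continuous u) (hv : Continuous v)
    (hc : HasCompactSupport u ∨ HasCompactSupport v) :
    Integrable (fun q => sesq (H q) (u q) (v q)) :=
  (contDiff_sesq hH.contDiff_zero (contDiff_zero.2 hu)
    (contDiff_zero.2 hv)).continuous.integrable_of_hasCompactSupport (hasCompactSupport_sesq H hc)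

lemma realPD_sesq (hH : IsHermitianMetricReal Set.univ H) (j : Fin N)
    {u v : (Fin N → ℝ) → Fin r → ℂ} (hu : ContDiff ℝ 1 u) (hv : ContDiff ℝ 1 v)
    (p : Fin N → ℝ) :
    realPD j (fun q => sesq (H q) (u q) (v q)) p
      = sesq (H p) (vecPD j u p) (v p) + sesq (H p) (u p) (covD H j v p) := by
  simp only [sesq]
  rw [realPD_dotProduct j (differentiableAt_pi_apply hu p)
    (differentiableAt_pi_apply (contDiff_mulVec hH.contDiff_one hv) p), mulVec_covD hH]

lemma realPD_sesq' (hH : IsHermitianMetricReal Set.univ H) (j : Fin N)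
    {u v : (Fin N → ℝ) → Fin r → ℂ} (hu : ContDiff ℝ 1 u) (hv : ContDiff ℝ 1 v)
    (p : Fin N → ℝ) :
    realPD j (fun q => sesq (H q) (u q) (v q)) p
      = sesq (H p) (covD H j u p) (v p) + sesq (H p) (u p) (vecPD j v p) := by
  have h : (fun q => sesq (H q) (u q) (v q)) = fun q => star (sesq (H q) (v q) (u q)) :=
    funext fun q => (star_sesq (hH.posDef q).isHermitian _ _).symm
  rw [h, realPD_star, realPD_sesq hH j hv hu, star_add, star_sesq (hH.posDef p).isHermitian,
    star_sesq (hH.posDef p).isHermitian, add_comm]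

/-- Integration by parts: the formal adjoint of `∂_j` is `-covD H j`. -/
lemma integral_sesq_vecPD_left (hH : IsHermitianMetricReal Set.univ H) (j : Fin N)
    {u v : (Fin N → ℝ) → Fin r → ℂ} (hu : ContDiff ℝ 1 u) (hv : ContDiff ℝ 1 v)
    (hc : HasCompactSupport u ∨ HasCompactSupport v) :
    ∫ p, sesq (H p) (vecPD j u p) (v p) = - ∫ p, sesq (H p) (u p) (covD H j v p) := by
  have h := integral_realPD_eq_zero j (contDiff_sesq hH.contDiff_one hu hv)
    (hasCompactSupport_sesq H hc)
  rw [integral_congr_ae (Filter.Eventually.of_forall fun p => realPD_sesq hH j hu hv p),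
    integral_add] at h
  · exact eq_neg_of_add_eq_zero_left h
  · exact integrable_sesq hH (contDiff_vecPD (m := 0) (by norm_num) j hu).continuous hv.continuous
      (hc.imp (hasCompactSupport_vecPD j) id)
  · exact integrable_sesq hH hu.continuous
      (contDiff_covD (m := 0) hH (by norm_num) (by norm_num) j hv).continuous
      (hc.imp id (hasCompactSupport_covD j))

lemma integral_sesq_covD_left (hH : IsHermitianMetricReal Set.univ H) (j : Fin N)
    {u v : (Fin N → ℝ) → Fin r → ℂ} (hu : ContDiff ℝ 1 u) (hv : ContDiff ℝ 1 v)
    (hc : HasCompactSupport u ∨ HasCompactSupport v) :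
    ∫ p, sesq (H p) (covD H j u p) (v p) = - ∫ p, sesq (H p) (u p) (vecPD j v p) := by
  have h := integral_realPD_eq_zero j (contDiff_sesq hH.contDiff_one hu hv)
    (hasCompactSupport_sesq H hc)
  rw [integral_congr_ae (Filter.Eventually.of_forall fun p => realPD_sesq' hH j hu hv p),
    integral_add] at h
  · exact eq_neg_of_add_eq_zero_left h
  · exact integrable_sesq hH
      (contDiff_covD (m := 0) hH (by norm_num) (by norm_num) j hu).continuous hv.continuous
      (hc.imp (hasCompactSupport_covD j) id)
  · exact integrable_sesq hH hu.continuous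
      (contDiff_vecPD (m := 0) (by norm_num) j hv).continuous
      (hc.imp id (hasCompactSupport_vecPD j))

/-- Summed integration by parts for the weighted Laplacian. -/
lemma integral_sesq_metricLap (hH : IsHermitianMetricReal Set.univ H)
    {u v : (Fin N → ℝ) → Fin r → ℂ} (hu : ContDiff ℝ 1 u) (hv : ContDiff ℝ 2 v)
    (hc : HasCompactSupport u ∨ HasCompactSupport v) :
    ∫ p, sesq (H p) (u p) (metricLap H v p)
      = - ∑ j, ∫ p, sesq (H p) (vecPD j u p) (vecPD j v p) := by
  have hv' : ∀ j, ContDiff ℝ 1 (vecPD j v) := fun j => contDiff_vecPD (by norm_num) j hv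
  simp only [metricLap, sesq_sum_right]
  rw [integral_finsetSum, ← Finset.sum_neg_distrib]
  · refine Finset.sum_congr rfl fun j _ => ?_
    rw [integral_sesq_vecPD_left hH j hu (hv' j) (hc.imp id (hasCompactSupport_vecPD j)), neg_neg]
  · intro j _
    exact integrable_sesq hH hu.continuous
      (contDiff_covD (m := 0) hH (by norm_num) (by norm_num) j (hv' j)).continuous
      (hc.imp id fun h => hasCompactSupport_covD j (hasCompactSupport_vecPD j h))

lemma vecPD_covD (hH : IsHermitianMetricReal Set.univ H) (j k : Fin N)
    {v : (Fin N → ℝ) → Fin r → ℂ} (hv : ContDiff ℝ 2 v) (p : Fin N → ℝ) :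
    vecPD k (covD H j v) p = covD H j (vecPD k v) p - realChernCurv H j k p *ᵥ v p := by
  have hv1 : ContDiff ℝ 1 v := hv.of_le (by norm_num)
  have hB : ∀ a b, ContDiff ℝ 1 (fun q => ((H q)⁻¹ * matRealPD j H q) a b) := by
    intro a b
    simp only [mul_apply]
    exact ContDiff.sum fun c _ => ((hH.contDiff_inv a c).of_le (by norm_num)).mul
      (hH.contDiff_matRealPD j c b)
  have hB' : ∀ a b, DifferentiableAt ℝ (fun q => ((H q)⁻¹ * matRealPD j H q) a b) p :=
    fun a b => (hB a b).differentiable (by norm_num) p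
  have h1 : covD H j v = fun q => vecPD j v q + ((H q)⁻¹ * matRealPD j H q) *ᵥ v q :=
    funext fun q => covD_eq hH j hv1 q
  have h2 : matRealPD k (fun q => (H q)⁻¹ * matRealPD j H q) p = - realChernCurv H j k p := by
    ext a b
    simp [matRealPD, realChernCurv]
  rw [h1, vecPD_add k (differentiableAt_pi_apply (contDiff_vecPD (by norm_num) j hv) p)
    (differentiableAt_pi_apply (contDiff_mulVec hB hv1) p),
    vecPD_mulVec k hB' (differentiableAt_pi_apply hv1 p), h2,
    covD_eq hH j (contDiff_vecPD (by norm_num) k hv), vecPD_comm hv, neg_mulVec]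
  abel

/-- The Bochner identity for the weighted Laplacian. -/
lemma integral_sesq_metricLap_self (hH : IsHermitianMetricReal Set.univ H)
    {v : (Fin N → ℝ) → Fin r → ℂ} (hv : ContDiff ℝ 3 v) (hc : HasCompactSupport v) :
    ∫ p, sesq (H p) (metricLap H v p) (metricLap H v p)
      = (∫ p, ∑ j, ∑ k, sesq (H p) (vecPD j (vecPD k v) p) (vecPD j (vecPD k v) p))
        + ∫ p, ∑ j, ∑ k, sesq (H p) (vecPD k v p) (realChernCurv H j k p *ᵥ vecPD j v p) := by
  have hv1 : ∀ j, ContDiff ℝ 2 (vecPD j v) := fun j => contDiff_vecPD (by norm_num) j hv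
  have hv1' : ∀ j, ContDiff ℝ 1 (vecPD j v) := fun j => (hv1 j).of_le (by norm_num)
  have hv2 : ∀ j k, ContDiff ℝ 1 (vecPD k (vecPD j v)) :=
    fun j k => contDiff_vecPD (by norm_num) k (hv1 j)
  have hD : ∀ j, ContDiff ℝ 1 (covD H j (vecPD j v)) :=
    fun j => contDiff_covD hH (by norm_num) le_rfl j (hv1 j)
  have hc1 : ∀ j, HasCompactSupport (vecPD j v) := fun j => hasCompactSupport_vecPD j hc
  have hi0 : ∀ j k, Integrable fun p =>
      sesq (H p) (covD H k (vecPD k v) p) (covD H j (vecPD j v) p) := fun j k =>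
    integrable_sesq hH (hD k).continuous (hD j).continuous (.inl (hasCompactSupport_covD k (hc1 k)))
  have hi1 : ∀ j k, Integrable fun p =>
      sesq (H p) (vecPD j (vecPD k v) p) (vecPD j (vecPD k v) p) := fun j k =>
    integrable_sesq hH (hv2 k j).continuous (hv2 k j).continuous
      (.inl (hasCompactSupport_vecPD j (hc1 k)))
  have hi2 : ∀ j k, Integrable fun p =>
      sesq (H p) (vecPD k v p) (covD H j (vecPD k (vecPD j v)) p) := fun j k =>
    integrable_sesq hH (hv1' k).continuous
      (contDiff_covD (m := 0) hH (by norm_num) (by norm_num) j (hv2 j k)).continuous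
      (.inl (hc1 k))
  have hi3 : ∀ j k, Integrable fun p =>
      sesq (H p) (vecPD k v p) (vecPD k (covD H j (vecPD j v)) p) := fun j k =>
    integrable_sesq hH (hv1' k).continuous
      (contDiff_vecPD (m := 0) (by norm_num) k (hD j)).continuous
      (.inl (hc1 k))
  have hpt : ∀ j k p, sesq (H p) (vecPD k v p) (realChernCurv H j k p *ᵥ vecPD j v p)
      = sesq (H p) (vecPD k v p) (covD H j (vecPD k (vecPD j v)) p)
        - sesq (H p) (vecPD k v p) (vecPD k (covD H j (vecPD j v)) p) := by
    intro j k p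
    rw [vecPD_covD hH j k (hv1 j), sesq_sub_right]
    ring
  have hi4 : ∀ j k, Integrable fun p =>
      sesq (H p) (vecPD k v p) (realChernCurv H j k p *ᵥ vecPD j v p) := by
    intro j k
    simp only [hpt]
    exact (hi2 j k).sub (hi3 j k)
  simp only [metricLap, sesq_sum_right, sesq_sum_left]
  rw [integral_finsetSum _ fun j _ => integrable_finsetSum _ fun k _ => hi0 j k,
    integral_finsetSum _ fun j _ => integrable_finsetSum _ fun k _ => hi1 j k,
    integral_finsetSum _ fun j _ => integrable_finsetSum _ fun k _ => hi4 j k,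
    ← Finset.sum_add_distrib]
  refine Finset.sum_congr rfl fun j _ => ?_
  rw [integral_finsetSum _ fun k _ => hi0 j k, integral_finsetSum _ fun k _ => hi1 j k,
    integral_finsetSum _ fun k _ => hi4 j k, ← Finset.sum_add_distrib]
  refine Finset.sum_congr rfl fun k _ => ?_
  rw [integral_sesq_covD_left hH k (hv1' k) (hD j) (.inl (hc1 k))]
  simp only [hpt]
  rw [integral_sub (hi2 j k) (hi3 j k)]
  have h5 := integral_sesq_vecPD_left hH j (hv1' k) (hv2 j k) (.inl (hc1 k))
  have h6 : vecPD k (vecPD j v) = vecPD j (vecPD k v) :=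
    funext fun p => vecPD_comm (hv.of_le (by norm_num)) j k p
  rw [h6] at h5 ⊢
  rw [h5]
  ring

end Metric

section GaussTwist

open Matrix

variable {N r : ℕ} {G : (Fin N → ℝ) → Matrix (Fin r) (Fin r) ℂ}

/-- The Gaussian weight `exp (-∑_j lam_j (q_j - c_j)² / 2)`. -/
def gaussWeight (lam c : Fin N → ℝ) (q : Fin N → ℝ) : ℝ :=
  Real.exp (-∑ i, lam i / 2 * (q i - c i) ^ 2)

/-- The metric `G` multiplied by a Gaussian weight. -/
def gaussTwist (lam c : Fin N → ℝ) (G : (Fin N → ℝ) → Matrix (Fin r) (Fin r) ℂ)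
    (q : Fin N → ℝ) : Matrix (Fin r) (Fin r) ℂ :=
  (gaussWeight lam c q : ℂ) • G q

lemma gaussWeight_pos (lam c q : Fin N → ℝ) : 0 < gaussWeight lam c q := Real.exp_pos _

lemma contDiff_gaussWeight {n : WithTop ℕ∞} (lam c : Fin N → ℝ) :
    ContDiff ℝ n (gaussWeight lam c) := by
  unfold gaussWeight
  fun_prop

lemma hasFDerivAt_gaussWeight (lam c q : Fin N → ℝ) :
    HasFDerivAt (gaussWeight lam c) (gaussWeight lam c q •
      -∑ i, (lam i / 2) • ((2 * (q i - c i)) •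
        (ContinuousLinearMap.proj i : (Fin N → ℝ) →L[ℝ] ℝ))) q := by
  unfold gaussWeight
  refine HasFDerivAt.exp (HasFDerivAt.neg (HasFDerivAt.fun_sum fun i _ => ?_))
  refine HasFDerivAt.const_mul ?_ _
  have h := ((hasFDerivAt_apply (𝕜 := ℝ) i q).sub_const (c i)).pow 2
  simpa [Pi.pow_def] using h

lemma realPD_ofReal (j : Fin N) {g : (Fin N → ℝ) → ℝ} {g' : (Fin N → ℝ) →L[ℝ] ℝ}
    {p : Fin N → ℝ} (h : HasFDerivAt g g' p) :
    realPD j (fun q => (g q : ℂ)) p = (g' (Pi.single j 1) : ℂ) := by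
  have := (Complex.ofRealCLM.hasFDerivAt (x := g p)).comp p h
  simp only [realPD]
  rw [show (fun q => (g q : ℂ)) = Complex.ofRealCLM ∘ g from rfl, this.fderiv]
  simp

lemma realPD_gaussWeight (lam c : Fin N → ℝ) (j : Fin N) (q : Fin N → ℝ) :
    realPD j (fun q => (gaussWeight lam c q : ℂ)) q
      = -(lam j * (q j - c j) : ℝ) * (gaussWeight lam c q : ℂ) := by
  rw [realPD_ofReal j (hasFDerivAt_gaussWeight lam c q)]
  simp [Pi.single_apply]
  ring

lemma isHermitianMetricReal_gaussTwist (hG : IsHermitianMetricReal Set.univ G)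
    (lam c : Fin N → ℝ) : IsHermitianMetricReal Set.univ (gaussTwist lam c G) := by
  refine ⟨fun p _ => ?_, fun a b => ContDiff.contDiffOn ?_⟩
  · exact (hG.posDef p).smul (by exact_mod_cast gaussWeight_pos lam c p)
  · simp only [gaussTwist, Matrix.smul_apply, smul_eq_mul]
    exact (Complex.ofRealCLM.contDiff.comp (contDiff_gaussWeight lam c)).mul (hG.contDiff a b)

lemma differentiable_gaussWeight (lam c : Fin N → ℝ) :
    Differentiable ℝ (fun q => (gaussWeight lam c q : ℂ)) :=
  (Complex.ofRealCLM.contDiff.comp (contDiff_gaussWeight (n := 1) lam c)).differentiable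
    (by norm_num)

lemma sesq_gaussTwist (lam c : Fin N → ℝ) (p : Fin N → ℝ) (u v : Fin r → ℂ) :
    sesq (gaussTwist lam c G p) u v = gaussWeight lam c p * sesq (G p) u v := by
  simp [sesq, gaussTwist, smul_mulVec, dotProduct_smul]

lemma inv_mul_matRealPD_gaussTwist (hG : IsHermitianMetricReal Set.univ G)
    (lam c : Fin N → ℝ) (j : Fin N) (q : Fin N → ℝ) :
    (gaussTwist lam c G q)⁻¹ * matRealPD j (gaussTwist lam c G) q
      = (G q)⁻¹ * matRealPD j G q - ((lam j * (q j - c j) : ℝ) : ℂ) • 1 := by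
  have hw : (gaussWeight lam c q : ℂ) ≠ 0 := by exact_mod_cast (gaussWeight_pos lam c q).ne'
  have h1 : matRealPD j (gaussTwist lam c G) q = (gaussWeight lam c q : ℂ) •
      (matRealPD j G q - ((lam j * (q j - c j) : ℝ) : ℂ) • G q) := by
    ext a b
    simp only [matRealPD, gaussTwist, Matrix.smul_apply, smul_eq_mul, of_apply, Matrix.sub_apply]
    rw [realPD_mul j (differentiable_gaussWeight lam c q)
      ((hG.contDiff_one a b).differentiable (by norm_num) q), realPD_gaussWeight]
    ring
  have h2 : (gaussTwist lam c G q)⁻¹ = (gaussWeight lam c q : ℂ)⁻¹ • (G q)⁻¹ := by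
    apply inv_eq_left_inv
    rw [gaussTwist, smul_mul_smul_comm, inv_mul_cancel₀ hw, one_smul, hG.inv_mul]
  rw [h1, h2, smul_mul_smul_comm, inv_mul_cancel₀ hw, one_smul, mul_sub, mul_smul_comm, hG.inv_mul]

lemma realChernCurv_gaussTwist (hG : IsHermitianMetricReal Set.univ G)
    (lam c : Fin N → ℝ) (j k : Fin N) (p : Fin N → ℝ) :
    realChernCurv (gaussTwist lam c G) j k p
      = realChernCurv G j k p + (if j = k then (lam j : ℂ) else 0) • 1 := by
  ext a b
  simp only [realChernCurv, inv_mul_matRealPD_gaussTwist hG, of_apply, Matrix.add_apply,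
    Matrix.sub_apply, Matrix.smul_apply, smul_eq_mul]
  have hB : ContDiff ℝ 1 (fun q => ((G q)⁻¹ * matRealPD j G q) a b) := by
    simp only [mul_apply]
    exact ContDiff.sum fun c _ => ((hG.contDiff_inv a c).of_le (by norm_num)).mul
      (hG.contDiff_matRealPD j c b)
  have hl : HasFDerivAt (fun q : Fin N → ℝ => lam j * (q j - c j))
      (lam j • (ContinuousLinearMap.proj j : (Fin N → ℝ) →L[ℝ] ℝ)) p :=
    ((hasFDerivAt_apply (𝕜 := ℝ) j p).sub_const (c j)).const_mul _
  have hl' : DifferentiableAt ℝ (fun q : Fin N → ℝ => ((lam j * (q j - c j) : ℝ) : ℂ)) p :=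
    Complex.ofRealCLM.differentiableAt.comp p hl.differentiableAt
  rw [realPD_sub k (hB.differentiable (by norm_num) p) (hl'.mul_const _),
    realPD_mul k hl' (differentiableAt_const _), realPD_const, realPD_ofReal k hl]
  simp only [_root_.smul_apply, ContinuousLinearMap.proj_apply, Pi.single_apply]
  split_ifs <;> simp
  ring

lemma sesq_realChernCurv_gaussTwist (hG : IsHermitianMetricReal Set.univ G)
    (lam c : Fin N → ℝ) (j k : Fin N) (p : Fin N → ℝ) (u v : Fin r → ℂ) :
    sesq (gaussTwist lam c G p) u (realChernCurv (gaussTwist lam c G) j k p *ᵥ v)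
      = gaussWeight lam c p * (sesq (G p) u (realChernCurv G j k p *ᵥ v)
        + if j = k then lam j * sesq (G p) u v else 0) := by
  rw [sesq_gaussTwist, realChernCurv_gaussTwist hG, add_mulVec, sesq_add_right, smul_mulVec,
    sesq_smul_right, one_mulVec]
  split_ifs <;> simp

/-- The curvature sum of `NakanoSemiPositiveReal` in terms of `sesq`. -/
lemma nakano_sum_eq_sesq (A : Matrix (Fin r) (Fin r) ℂ)
    (T : Fin N → Fin N → Matrix (Fin r) (Fin r) ℂ) (u : Fin N → Fin r → ℂ) :
    (∑ j : Fin N, ∑ k : Fin N, ∑ a : Fin r, ∑ b : Fin r,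
      star (u k b) * A b a * Matrix.mulVec (T j k) (u j) a)
      = ∑ j, ∑ k, sesq A (u k) (T j k *ᵥ u j) := by
  refine Finset.sum_congr rfl fun j _ => Finset.sum_congr rfl fun k _ => ?_
  rw [Finset.sum_comm]
  simp only [sesq, dotProduct, mulVec, Pi.star_apply, Finset.mul_sum, mul_assoc]

end GaussTwist

section Mollify

open Matrix

variable {N r : ℕ} {F : Type*} [NormedAddCommGroup F] [NormedSpace ℝ F]

/-- Convolution of the vector-valued function `f` with the scalar kernel `η`. -/
def moll (η : (Fin N → ℝ) → ℝ) (f : (Fin N → ℝ) → F) (x : Fin N → ℝ) : F :=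
  ∫ y, η (x - y) • f y

lemma moll_eq_convolution (η : (Fin N → ℝ) → ℝ) (f : (Fin N → ℝ) → F) :
    moll η f = convolution η f (ContinuousLinearMap.lsmul ℝ ℝ) volume :=
  funext fun _ => convolution_lsmul_swap.symm

lemma contDiff_moll {n : ℕ∞} {η : (Fin N → ℝ) → ℝ} (hη : ContDiff ℝ n η)
    (hc : HasCompactSupport η) {f : (Fin N → ℝ) → F} (hf : LocallyIntegrable f) :
    ContDiff ℝ n (moll η f) := by
  rw [moll_eq_convolution]
  exact hc.contDiff_convolution_left _ hη hf

lemma hasCompactSupport_sub_left {η : (Fin N → ℝ) → ℝ} (hc : HasCompactSupport η)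
    (x : Fin N → ℝ) : HasCompactSupport fun y => η (x - y) :=
  hc.comp_homeomorph (Homeomorph.subLeft x)

lemma integrable_sub_smul {η : (Fin N → ℝ) → ℝ} (hη : Continuous η)
    (hc : HasCompactSupport η) {f : (Fin N → ℝ) → F} (hf : LocallyIntegrable f)
    (x : Fin N → ℝ) : Integrable fun y => η (x - y) • f y :=
  hf.integrable_smul_left_of_hasCompactSupport (by fun_prop) (hasCompactSupport_sub_left hc x)

lemma moll_apply {η : (Fin N → ℝ) → ℝ} (hη : Continuous η)
    (hc : HasCompactSupport η) {f : (Fin N → ℝ) → Fin r → ℂ} (hf : LocallyIntegrable f)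
    (x : Fin N → ℝ) (a : Fin r) : moll η f x a = ∫ y, (η (x - y) : ℂ) * f y a := by
  have := (ContinuousLinearMap.proj (R := ℝ) (φ := fun _ : Fin r => ℂ) a).integral_comp_comm
    (integrable_sub_smul hη hc hf x)
  simpa [moll] using this.symm

lemma vecPD_moll (j : Fin N) {η : (Fin N → ℝ) → ℝ} (hη : ContDiff ℝ 1 η)
    (hc : HasCompactSupport η) {f : (Fin N → ℝ) → Fin r → ℂ} (hf : LocallyIntegrable f)
    (x : Fin N → ℝ) :
    vecPD j (moll η f) x = moll (fun z => fderiv ℝ η z (Pi.single j 1)) f x := by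
  have h := hc.hasFDerivAt_convolution_left (ContinuousLinearMap.lsmul ℝ ℝ) hη hf x
  rw [← moll_eq_convolution] at h
  have hi := (hc.fderiv ℝ).convolutionExists_left
    ((ContinuousLinearMap.lsmul ℝ ℝ : ℝ →L[ℝ] (Fin r → ℂ) →L[ℝ] Fin r → ℂ).precompL (Fin N → ℝ))
    (hη.continuous_fderiv (by norm_num)) hf x
  funext a
  have h' := (ContinuousLinearMap.proj (R := ℝ) (φ := fun _ : Fin r => ℂ) a).hasFDerivAt.comp x h
  have : vecPD j (moll η f) x a = realPD j (ContinuousLinearMap.proj (R := ℝ)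
    (φ := fun _ : Fin r => ℂ) a ∘ moll η f) x := rfl
  rw [this, realPD, h'.fderiv, moll_eq_convolution]
  simp only [ContinuousLinearMap.comp_apply, convolution]
  rw [ContinuousLinearMap.integral_apply hi]
  rfl

lemma sesq_real_smul_right (A : Matrix (Fin r) (Fin r) ℂ) (c : ℝ) (u v : Fin r → ℂ) :
    (sesq A u (c • v)).re = c * (sesq A u v).re := by
  have : c • v = (c : ℂ) • v := by ext; simp
  rw [this, sesq_smul_right, Complex.re_ofReal_mul]

/-- Jensen's inequality for the squared norm given by a positive definite matrix. -/
lemma sesq_integral_self_le {A : Matrix (Fin r) (Fin r) ℂ} (hA : A.PosDef)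
    {ρ : (Fin N → ℝ) → ℝ} (h0 : ∀ y, 0 ≤ ρ y) (hi : Integrable ρ) (h1 : ∫ y, ρ y = 1)
    {w : (Fin N → ℝ) → Fin r → ℂ} (hw : Integrable fun y => ρ y • w y)
    (hww : Integrable fun y => ρ y * (sesq A (w y) (w y)).re) :
    (sesq A (∫ y, ρ y • w y) (∫ y, ρ y • w y)).re ≤ ∫ y, ρ y * (sesq A (w y) (w y)).re := by
  set m := ∫ y, ρ y • w y with hm
  let L : (Fin r → ℂ) →L[ℝ] ℝ := LinearMap.toContinuousLinearMap
    { toFun := fun v => (sesq A m v).re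
      map_add' := fun u v => by simp [sesq_add_right]
      map_smul' := fun c v => sesq_real_smul_right A c m v }
  have hL : ∀ v, L v = (sesq A m v).re := fun _ => rfl
  have h2 : ∫ y, ρ y * (sesq A m (w y)).re = (sesq A m m).re := by
    have := L.integral_comp_comm hw
    simpa [hL, ← hm, sesq_real_smul_right] using this
  have h2i : Integrable fun y => ρ y * (sesq A m (w y)).re := by
    simpa [hL, sesq_real_smul_right] using L.integrable_comp hw
  have h3 : ∀ y, 0 ≤ ρ y * (sesq A (w y) (w y)).re - 2 * (ρ y * (sesq A m (w y)).re)
      + ρ y * (sesq A m m).re := by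
    intro y
    have h := mul_nonneg (h0 y) (sesq_self_re_nonneg hA (w y - m))
    have hs : (sesq A (w y) m).re = (sesq A m (w y)).re := by
      rw [← star_sesq hA.1]; rfl
    have he : w y - m = w y + (-1 : ℂ) • m := by simp [sub_eq_add_neg]
    rw [he] at h
    simp only [sesq_add_right, sesq_add_left, sesq_smul_left, sesq_smul_right] at h
    simp at h
    rw [hs] at h
    linarith
  have h4 := integral_nonneg (μ := volume) (Pi.le_def.2 h3)
  have h5 : Integrable fun y => ρ y * (sesq A (w y) (w y)).re - 2 * (ρ y * (sesq A m (w y)).re) :=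
    hww.sub (h2i.const_mul 2)
  rw [integral_add h5 (hi.mul_const _), integral_sub hww (h2i.const_mul 2),
    integral_const_mul, h2, integral_mul_const, h1] at h4
  linarith

lemma continuous_sesq {X : Type*} [TopologicalSpace X] {A : X → Matrix (Fin r) (Fin r) ℂ}
    {u v : X → Fin r → ℂ} (hA : Continuous A) (hu : Continuous u) (hv : Continuous v) :
    Continuous fun x => sesq (A x) (u x) (v x) :=
  hu.star.dotProduct (hA.matrix_mulVec hv)

lemma sesq_smul_smul_real (A : Matrix (Fin r) (Fin r) ℂ) (c : ℝ) (u : Fin r → ℂ) :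
    (sesq A ((c : ℂ) • u) ((c : ℂ) • u)).re = c ^ 2 * (sesq A u u).re := by
  rw [sesq_smul_left, sesq_smul_right]
  simp
  ring

/-- A quadratic form inequality depending continuously on parameters and strict on a compact set
of parameters holds nearby. -/
lemma exists_pos_forall_sesq_le {H : (Fin N → ℝ) → Matrix (Fin r) (Fin r) ℂ}
    (hH : Continuous H)
    {A : (Fin N → ℝ) → (Fin N → ℝ) → Matrix (Fin r) (Fin r) ℂ}
    (hA : Continuous fun p : (Fin N → ℝ) × (Fin N → ℝ) => A p.1 p.2)
    {K : Set (Fin N → ℝ)} (hK : IsCompact K) {C : ℝ}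
    (h : ∀ x ∈ K, ∀ u ≠ 0, (sesq (H x) (A x x *ᵥ u) (A x x *ᵥ u)).re < C * (sesq (H x) u u).re) :
    ∃ δ > 0, ∀ x ∈ K, ∀ y, dist x y < δ → ∀ u,
      (sesq (H x) (A x y *ᵥ u) (A x y *ᵥ u)).re ≤ C * (sesq (H y) u u).re := by
  let f : (Fin N → ℝ) × (Fin N → ℝ) × (Fin r → ℂ) → ℝ := fun z =>
    C * (sesq (H z.2.1) z.2.2 z.2.2).re
      - (sesq (H z.1) (A z.1 z.2.1 *ᵥ z.2.2) (A z.1 z.2.1 *ᵥ z.2.2)).re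
  have hf : Continuous f := by
    have hA' : Continuous fun z : (Fin N → ℝ) × (Fin N → ℝ) × (Fin r → ℂ) =>
        A z.1 z.2.1 *ᵥ z.2.2 :=
      (hA.comp (by fun_prop : Continuous fun z : (Fin N → ℝ) × (Fin N → ℝ) × (Fin r → ℂ) =>
        (z.1, z.2.1))).matrix_mulVec (by fun_prop)
    refine ((Complex.continuous_re.comp (continuous_sesq (hH.comp (by fun_prop)) (by fun_prop)
      (by fun_prop))).const_mul C).sub (Complex.continuous_re.comp
        (continuous_sesq (hH.comp (by fun_prop)) hA' hA'))
  let S : Set ((Fin N → ℝ) × (Fin N → ℝ) × (Fin r → ℂ)) :=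
    (fun z : (Fin N → ℝ) × (Fin r → ℂ) => (z.1, z.1, z.2)) '' (K ×ˢ Metric.sphere 0 1)
  have hS : IsCompact S := (hK.prod (isCompact_sphere 0 1)).image (by fun_prop)
  have hSU : S ⊆ f ⁻¹' Set.Ioi 0 := by
    rintro _ ⟨⟨x, u⟩, ⟨hx, hu⟩, rfl⟩
    have hu0 : u ≠ 0 := by
      rintro rfl
      simp at hu
    simpa [f] using h x hx u hu0
  obtain ⟨δ, hδ, hδU⟩ := hS.exists_thickening_subset_open (isOpen_Ioi.preimage hf) hSU
  refine ⟨δ, hδ, fun x hx y hxy u => ?_⟩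
  by_cases hu : u = 0
  · simp [hu, sesq]
  have hn : (0 : ℝ) < ‖u‖ := norm_pos_iff.2 hu
  set w : Fin r → ℂ := ((‖u‖⁻¹ : ℝ) : ℂ) • u with hw
  have huw : u = ((‖u‖ : ℝ) : ℂ) • w := by
    rw [hw, smul_smul, ← Complex.ofReal_mul, mul_inv_cancel₀ hn.ne']
    simp
  have hmem : (x, y, w) ∈ Metric.thickening δ S := by
    refine Metric.mem_thickening_iff.2 ⟨(x, x, w), ⟨(x, w), ⟨hx, ?_⟩, rfl⟩, ?_⟩
    · rw [mem_sphere_zero_iff_norm, hw, norm_smul, Complex.norm_real, norm_inv, norm_norm,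
        inv_mul_cancel₀ hn.ne']
    · simpa [Prod.dist_eq, dist_comm y x, hδ] using hxy
  have h1 : 0 < f (x, y, w) := hδU hmem
  simp only [f] at h1
  rw [huw, mulVec_smul, sesq_smul_smul_real, sesq_smul_smul_real]
  nlinarith [sq_nonneg ‖u‖]

lemma exists_norm_sq_le_sesq {H : (Fin N → ℝ) → Matrix (Fin r) (Fin r) ℂ}
    (hH : Continuous H) (hpos : ∀ q, (H q).PosDef) {K : Set (Fin N → ℝ)} (hK : IsCompact K) :
    ∃ C : ℝ, 0 < C ∧ ∀ q ∈ K, ∀ u, ‖u‖ ^ 2 ≤ C * (sesq (H q) u u).re := by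
  let f : (Fin N → ℝ) × (Fin r → ℂ) → ℝ := fun z => (sesq (H z.1) z.2 z.2).re
  have hf : Continuous f := Complex.continuous_re.comp
    (continuous_sesq (hH.comp continuous_fst) continuous_snd continuous_snd)
  have hS : IsCompact (K ×ˢ Metric.sphere (0 : Fin r → ℂ) 1) := hK.prod (isCompact_sphere 0 1)
  obtain ⟨c, hc, hcf⟩ : ∃ c > 0, ∀ z ∈ K ×ˢ Metric.sphere (0 : Fin r → ℂ) 1, c ≤ f z := by
    rcases (K ×ˢ Metric.sphere (0 : Fin r → ℂ) 1).eq_empty_or_nonempty with h | h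
    · exact ⟨1, one_pos, fun z hz => by simp [h] at hz⟩
    obtain ⟨z, hz, hmin⟩ := hS.exists_isMinOn h hf.continuousOn
    refine ⟨f z, ?_, fun y hy => hmin hy⟩
    have hz0 : z.2 ≠ 0 := by
      intro h0
      have := hz.2
      simp [h0] at this
    exact (hpos z.1).re_dotProduct_pos hz0
  refine ⟨c⁻¹, by positivity, fun q hq u => ?_⟩
  by_cases hu : u = 0
  · simp [hu, sesq]
  have hn : (0 : ℝ) < ‖u‖ := norm_pos_iff.2 hu
  set w : Fin r → ℂ := ((‖u‖⁻¹ : ℝ) : ℂ) • u with hw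
  have huw : u = ((‖u‖ : ℝ) : ℂ) • w := by
    rw [hw, smul_smul, ← Complex.ofReal_mul, mul_inv_cancel₀ hn.ne']
    simp
  have h1 : c ≤ (sesq (H q) w w).re := hcf (q, w) ⟨hq, by
    rw [mem_sphere_zero_iff_norm, hw, norm_smul, Complex.norm_real, norm_inv, norm_norm,
        inv_mul_cancel₀ hn.ne']⟩
  have h2 : (sesq (H q) u u).re = ‖u‖ ^ 2 * (sesq (H q) w w).re := by
    conv_lhs => rw [huw]
    rw [sesq_smul_smul_real]
  rw [h2, inv_mul_eq_div, le_div_iff₀ hc]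
  exact mul_le_mul_of_nonneg_left h1 (sq_nonneg _)

section LocallyIntegrable

variable {H : (Fin N → ℝ) → Matrix (Fin r) (Fin r) ℂ} {h : (Fin N → ℝ) → Fin r → ℂ}

lemma locallyIntegrable_norm_sq (hH : Continuous H) (hpos : ∀ q, (H q).PosDef)
    (hm : AEStronglyMeasurable h) (hh : Integrable fun q => (sesq (H q) (h q) (h q)).re) :
    LocallyIntegrable fun q => ‖h q‖ ^ 2 := by
  refine locallyIntegrable_iff.2 fun K hK => ?_
  obtain ⟨C, -, hC⟩ := exists_norm_sq_le_sesq hH hpos hK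
  refine Integrable.mono' (hh.integrableOn.const_mul C) (hm.norm.pow 2).restrict ?_
  filter_upwards [ae_restrict_mem hK.measurableSet] with q hq
  rw [Real.norm_of_nonneg (by positivity)]
  exact hC q hq (h q)

lemma locallyIntegrable_of_sesq (hH : Continuous H) (hpos : ∀ q, (H q).PosDef)
    (hm : AEStronglyMeasurable h) (hh : Integrable fun q => (sesq (H q) (h q) (h q)).re) :
    LocallyIntegrable h := by
  refine ((locallyIntegrable_const (1 : ℝ)).add (locallyIntegrable_norm_sq hH hpos hm hh)).mono
    hm (Filter.Eventually.of_forall fun q => ?_)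
  simp only [Pi.add_apply]
  rw [Real.norm_of_nonneg (by positivity)]
  nlinarith [sq_nonneg (‖h q‖ - 1)]

lemma continuous_entry {X : Type*} [TopologicalSpace X] {B : X → Matrix (Fin r) (Fin r) ℂ}
    (hB : Continuous B) (a b : Fin r) : Continuous fun q => B q a b := by
  fun_prop

lemma locallyIntegrable_mulVec (hH : Continuous H) (hpos : ∀ q, (H q).PosDef)
    (hm : AEStronglyMeasurable h) (hh : Integrable fun q => (sesq (H q) (h q) (h q)).re)
    {B : (Fin N → ℝ) → Matrix (Fin r) (Fin r) ℂ} (hB : Continuous B) :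
    LocallyIntegrable fun q => B q *ᵥ h q := by
  have hl := locallyIntegrable_of_sesq hH hpos hm hh
  refine locallyIntegrable_iff.2 fun K hK => ?_
  have hlK := hl.integrableOn_isCompact hK
  refine Integrable.of_eval fun a => ?_
  simp only [mulVec, dotProduct]
  refine integrable_finsetSum _ fun b _ => ?_
  exact IntegrableOn.continuousOn_mul (continuous_entry hB a b).continuousOn (hlK.eval b) hK

lemma locallyIntegrable_sesq (hH : Continuous H) (hpos : ∀ q, (H q).PosDef)
    (hm : AEStronglyMeasurable h) (hh : Integrable fun q => (sesq (H q) (h q) (h q)).re)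
    {B : (Fin N → ℝ) → Matrix (Fin r) (Fin r) ℂ} (hB : Continuous B) :
    LocallyIntegrable fun q => (sesq (B q) (h q) (h q)).re := by
  have hl := locallyIntegrable_norm_sq hH hpos hm hh
  refine locallyIntegrable_iff.2 fun K hK => ?_
  have hlK := hl.integrableOn_isCompact hK
  have hma : ∀ a, AEStronglyMeasurable (fun q => h q a) :=
    fun a => (continuous_apply a).comp_aestronglyMeasurable hm
  have hab : ∀ a b, IntegrableOn (fun q => star (h q a) * h q b) K := by
    intro a b
    refine Integrable.mono' hlK ((hma a).star.mul (hma b)).restrict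
      (Filter.Eventually.of_forall fun q => ?_)
    rw [norm_mul, norm_star, sq]
    exact mul_le_mul (norm_le_pi_norm _ _) (norm_le_pi_norm _ _) (norm_nonneg _) (norm_nonneg _)
  refine Integrable.re (f := fun q => sesq (B q) (h q) (h q)) ?_
  simp only [sesq, mulVec, dotProduct, Finset.mul_sum]
  refine integrable_finsetSum _ fun a _ => integrable_finsetSum _ fun b _ => ?_
  have : (fun q => star (h q) a * (B q a b * h q b))
      = fun q => B q a b * (star (h q a) * h q b) := by
    funext q
    simp only [Pi.star_apply]
    ring
  rw [this]
  exact IntegrableOn.continuousOn_mul (continuous_entry hB a b).continuousOn (hab a b) hK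

lemma sesq_mulVec_mulVec (A B : Matrix (Fin r) (Fin r) ℂ) (u v : Fin r → ℂ) :
    sesq A (B *ᵥ u) (B *ᵥ v) = sesq (Bᴴ * A * B) u v := by
  simp only [sesq, star_mulVec, ← mulVec_mulVec, dotProduct_mulVec, vecMul_vecMul]

/-- `L²` bound for the mollification with a matrix kernel. -/
lemma integral_cutoff_kernel_le (hH : Continuous H) (hpos : ∀ q, (H q).PosDef)
    (hm : AEStronglyMeasurable h) (hh : Integrable fun q => (sesq (H q) (h q) (h q)).re)
    {η : (Fin N → ℝ) → ℝ} (hη : Continuous η) (hηc : HasCompactSupport η) (hη0 : ∀ z, 0 ≤ η z)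
    (hη1 : ∫ z, η z = 1) {δ : ℝ} (hηδ : ∀ z, δ ≤ ‖z‖ → η z = 0)
    {A : (Fin N → ℝ) → (Fin N → ℝ) → Matrix (Fin r) (Fin r) ℂ}
    (hA : ∀ x, Continuous (A x)) {K : Set (Fin N → ℝ)} {C : ℝ} (hC : 0 ≤ C)
    (hAC : ∀ x ∈ K, ∀ y, dist x y < δ → ∀ u,
      (sesq (H x) (A x y *ᵥ u) (A x y *ᵥ u)).re ≤ C * (sesq (H y) u u).re)
    {χ : (Fin N → ℝ) → ℝ} (hχ0 : ∀ x, 0 ≤ χ x) {B : ℝ} (hχB : ∀ x, χ x ≤ B)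
    (hχK : ∀ x, x ∉ K → χ x = 0) {g : (Fin N → ℝ) → Fin r → ℂ}
    (hg : ∀ x, g x = ∫ y, η (x - y) • (A x y *ᵥ h y)) :
    ∫ x, χ x * (sesq (H x) (g x) (g x)).re ≤ B * C * ∫ y, (sesq (H y) (h y) (h y)).re := by
  set s : (Fin N → ℝ) → ℝ := fun y => (sesq (H y) (h y) (h y)).re with hs
  have hs0 : ∀ y, 0 ≤ s y := fun y => sesq_self_re_nonneg (hpos y) _
  have hηi : Integrable η := hη.integrable_of_hasCompactSupport hηc
  have hmi : Integrable (moll η s) := by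
    rw [moll_eq_convolution]
    exact hηi.integrable_convolution _ hh
  have hmI : ∫ x, moll η s x = ∫ y, s y := by
    rw [moll_eq_convolution, integral_convolution _ hηi hh, hη1]
    simp
  have hB0 : 0 ≤ B := (hχ0 0).trans (hχB 0)
  rw [← hmI, ← integral_const_mul]
  refine integral_mono_of_nonneg (Filter.Eventually.of_forall fun x =>
    mul_nonneg (hχ0 x) (sesq_self_re_nonneg (hpos x) _)) (hmi.const_mul _)
    (Filter.Eventually.of_forall fun x => ?_)
  have hm0 : 0 ≤ moll η s x := integral_nonneg fun y => mul_nonneg (hη0 _) (hs0 y)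
  by_cases hx : x ∈ K
  swap
  · simp only [hχK x hx, zero_mul]
    positivity
  have hJ := sesq_integral_self_le (hpos x) (ρ := fun y => η (x - y)) (fun y => hη0 _)
    (hηi.comp_sub_left x) (by rw [integral_sub_left_eq_self η volume x, hη1])
    (w := fun y => A x y *ᵥ h y)
    (integrable_sub_smul hη hηc (locallyIntegrable_mulVec hH hpos hm hh (hA x)) x)
    (by
      simp only [sesq_mulVec_mulVec]
      exact integrable_sub_smul hη hηc (locallyIntegrable_sesq hH hpos hm hh
        (((hA x).matrix_conjTranspose.matrix_mul continuous_const).matrix_mul (hA x))) x)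
  rw [← hg] at hJ
  have hle : (sesq (H x) (g x) (g x)).re ≤ C * moll η s x := by
    refine hJ.trans ?_
    rw [moll, ← integral_const_mul]
    refine integral_mono_of_nonneg (Filter.Eventually.of_forall fun y =>
      mul_nonneg (hη0 _) (sesq_self_re_nonneg (hpos x) _))
      ((integrable_sub_smul hη hηc hh.locallyIntegrable x).const_mul C)
      (Filter.Eventually.of_forall fun y => ?_)
    simp only [smul_eq_mul]
    by_cases hy : dist x y < δ
    · have := mul_le_mul_of_nonneg_left (hAC x hx y hy (h y)) (hη0 (x - y))
      simp only [hs]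
      linarith
    · rw [hηδ (x - y) (by rw [← dist_eq_norm]; exact not_lt.1 hy)]
      simp
  calc χ x * (sesq (H x) (g x) (g x)).re ≤ B * (C * moll η s x) :=
        mul_le_mul (hχB x) hle (sesq_self_re_nonneg (hpos x) _) hB0
    _ = B * C * moll η s x := by ring

end LocallyIntegrable

end Mollify

section TranslationInvariance

variable {N : ℕ} {F : Type*} [NormedAddCommGroup F] [NormedSpace ℝ F] [CompleteSpace F]

lemma enorm_sub_le_lintegral_fderiv {f : (Fin N → ℝ) → F} (hf : ContDiff ℝ 1 f)
    (x v : Fin N → ℝ) :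
    ‖f (x + v) - f x‖ₑ ≤ ‖v‖ₑ * ∫⁻ s in Set.Ioc (0 : ℝ) 1, ‖fderiv ℝ f (x + s • v)‖ₑ := by
  have hd : ∀ s : ℝ, HasDerivAt (fun s : ℝ => f (x + s • v)) (fderiv ℝ f (x + s • v) v) s := by
    intro s
    have h1 : HasDerivAt (fun s : ℝ => x + s • v) v s := by
      simpa using ((hasDerivAt_id s).smul_const v).const_add x
    exact (hf.differentiable (by norm_num) _).hasFDerivAt.comp_hasDerivAt s h1
  have hc : Continuous fun s : ℝ => fderiv ℝ f (x + s • v) v :=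
    ((hf.continuous_fderiv (by norm_num)).comp (by fun_prop)).clm_apply continuous_const
  have hI := intervalIntegral.integral_eq_sub_of_hasDerivAt (a := 0) (b := 1)
    (fun s _ => hd s) (hc.intervalIntegrable 0 1)
  simp only [one_smul, zero_smul, add_zero] at hI
  rw [← hI, intervalIntegral.integral_of_le zero_le_one]
  refine (enorm_integral_le_lintegral_enorm _).trans ?_
  rw [← lintegral_const_mul' _ _ enorm_ne_top]
  refine lintegral_mono fun s => ?_
  rw [mul_comm]
  exact ContinuousLinearMap.le_opENorm _ _

lemma lintegral_translate_sub_le {f : (Fin N → ℝ) → F} (hf : ContDiff ℝ 1 f)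
    (v : Fin N → ℝ) (R : ℝ) :
    ∫⁻ x in Metric.ball 0 R, ‖f (x + v) - f x‖ₑ
      ≤ ‖v‖ₑ * ∫⁻ x in Metric.ball 0 (R + ‖v‖), ‖fderiv ℝ f x‖ₑ := by
  have hc : Continuous (fderiv ℝ f) := hf.continuous_fderiv (by norm_num)
  calc ∫⁻ x in Metric.ball 0 R, ‖f (x + v) - f x‖ₑ
      ≤ ∫⁻ x in Metric.ball 0 R,
          ‖v‖ₑ * ∫⁻ s in Set.Ioc (0 : ℝ) 1, ‖fderiv ℝ f (x + s • v)‖ₑ :=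
        lintegral_mono fun x => enorm_sub_le_lintegral_fderiv hf x v
    _ = ‖v‖ₑ * ∫⁻ s in Set.Ioc (0 : ℝ) 1, ∫⁻ x in Metric.ball 0 R,
          ‖fderiv ℝ f (x + s • v)‖ₑ := by
        rw [lintegral_const_mul' _ _ enorm_ne_top, lintegral_lintegral_swap]
        have : Continuous fun p : (Fin N → ℝ) × ℝ => ‖fderiv ℝ f (p.1 + p.2 • v)‖ₑ :=
          (hc.comp (by fun_prop)).enorm
        exact this.aemeasurable
    _ ≤ ‖v‖ₑ * ∫⁻ s in Set.Ioc (0 : ℝ) 1, ∫⁻ x in Metric.ball 0 (R + ‖v‖), ‖fderiv ℝ f x‖ₑ := by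
        refine mul_le_mul' le_rfl ?_
        refine setLIntegral_mono' measurableSet_Ioc fun s hs => ?_
        rw [← lintegral_indicator Metric.isOpen_ball.measurableSet,
          ← lintegral_indicator Metric.isOpen_ball.measurableSet,
          ← lintegral_add_right_eq_self (Set.indicator (Metric.ball 0 (R + ‖v‖)) _) (s • v)]
        refine lintegral_mono fun x => ?_
        by_cases hx : x ∈ Metric.ball 0 R
        · have hx' : x + s • v ∈ Metric.ball 0 (R + ‖v‖) := by
            rw [mem_ball_zero_iff] at hx ⊢
            have h1 : ‖s • v‖ ≤ ‖v‖ := by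
              rw [norm_smul, Real.norm_of_nonneg hs.1.le]
              exact mul_le_of_le_one_left (norm_nonneg v) hs.2
            linarith [norm_add_le x (s • v)]
          simp [Set.indicator_of_mem hx, Set.indicator_of_mem hx']
        · simp [Set.indicator_of_notMem hx]
    _ = _ := by simp

/-- An almost everywhere limit of functions whose derivatives tend to zero locally in `L¹` is
almost everywhere constant. -/
lemma exists_ae_eq_const_of_tendsto {f : ℕ → (Fin N → ℝ) → F} (hf : ∀ n, ContDiff ℝ 1 (f n))
    {h : (Fin N → ℝ) → F} (hlim : ∀ᵐ x, Filter.Tendsto (fun n => f n x) Filter.atTop (nhds (h x)))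
    (hD : ∀ R : ℝ, Filter.Tendsto (fun n => ∫⁻ x in Metric.ball 0 R, ‖fderiv ℝ (f n) x‖ₑ)
      Filter.atTop (nhds 0)) : ∃ c, h =ᵐ[volume] fun _ => c := by
  have hm : AEStronglyMeasurable h :=
    aestronglyMeasurable_of_tendsto_ae _ (fun n => (hf n).continuous.aestronglyMeasurable) hlim
  have htr : ∀ v, ∀ᵐ x, h (x + v) = h x := by
    intro v
    have hlim' := (measurePreserving_add_right volume v).quasiMeasurePreserving.ae hlim
    have hR : ∀ R : ℕ, ∀ᵐ x, x ∈ Metric.ball (0 : Fin N → ℝ) R → h (x + v) = h x := by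
      intro R
      rw [← ae_restrict_iff' Metric.isOpen_ball.measurableSet]
      have hT : ∀ᵐ x, Filter.Tendsto (fun n => ‖f n (x + v) - f n x‖ₑ) Filter.atTop
          (nhds ‖h (x + v) - h x‖ₑ) := by
        filter_upwards [hlim, hlim'] with x h1 h2
        exact (h2.sub h1).enorm
      have h0 : ∫⁻ x in Metric.ball (0 : Fin N → ℝ) R, ‖h (x + v) - h x‖ₑ = 0 := by
        refine le_antisymm ?_ bot_le
        calc ∫⁻ x in Metric.ball (0 : Fin N → ℝ) R, ‖h (x + v) - h x‖ₑ
            = ∫⁻ x in Metric.ball (0 : Fin N → ℝ) R,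
                Filter.liminf (fun n => ‖f n (x + v) - f n x‖ₑ) Filter.atTop := by
              refine lintegral_congr_ae (ae_restrict_of_ae ?_)
              filter_upwards [hT] with x hx
              exact hx.liminf_eq.symm
          _ ≤ Filter.liminf (fun n => ∫⁻ x in Metric.ball (0 : Fin N → ℝ) R,
                ‖f n (x + v) - f n x‖ₑ) Filter.atTop :=
              lintegral_liminf_le fun n =>
                (((hf n).continuous.comp (by fun_prop)).sub (hf n).continuous).enorm.measurable
          _ = 0 := by
              refine Filter.Tendsto.liminf_eq ?_
              have h1 := ENNReal.Tendsto.const_mul (a := ‖v‖ₑ) (hD (R + ‖v‖))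
                (Or.inr enorm_ne_top)
              rw [mul_zero] at h1
              exact tendsto_of_tendsto_of_tendsto_of_le_of_le tendsto_const_nhds h1
                (fun _ => bot_le) fun n => lintegral_translate_sub_le (hf n) v R
      have hmv : AEStronglyMeasurable (fun x => h (x + v)) :=
        hm.comp_measurePreserving (measurePreserving_add_right volume v)
      rw [lintegral_eq_zero_iff' (hmv.fun_sub hm).enorm.restrict] at h0
      filter_upwards [h0] with x hx
      simpa [sub_eq_zero] using hx
    filter_upwards [ae_all_iff.2 hR] with x hx
    obtain ⟨n, hn⟩ := exists_nat_gt ‖x‖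
    exact hx n (by simpa using hn)
  set k := hm.mk h with hk
  have hkm : StronglyMeasurable k := hm.stronglyMeasurable_mk
  have hkh : h =ᵐ[volume] k := hm.ae_eq_mk
  have hktr : ∀ v, ∀ᵐ x, k (x + v) = k x := by
    intro v
    filter_upwards [htr v, hkh, (measurePreserving_add_right volume v).quasiMeasurePreserving.ae hkh]
      with x h1 h2 h3
    rw [← h3, h1, h2]
  have hset : MeasurableSet {p : (Fin N → ℝ) × (Fin N → ℝ) | k (p.2 + p.1) = k p.2} :=
    (hkm.comp_measurable (by fun_prop)).measurableSet_eq_fun (hkm.comp_measurable (by fun_prop))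
  have h2 := (Measure.ae_ae_comm (μ := volume) (ν := volume)
    (p := fun v x : Fin N → ℝ => k (x + v) = k x) hset).1 (Filter.Eventually.of_forall hktr)
  obtain ⟨x, hx⟩ := h2.exists
  refine ⟨k x, ?_⟩
  have h3 := (measurePreserving_add_left volume (-x)).quasiMeasurePreserving.ae hx
  filter_upwards [h3, hkh] with y hy hy'
  rw [hy']
  simpa using hy

end TranslationInvariance

section MollifiedEquation

open Matrix
open scoped ContDiff

variable {N r : ℕ} {H : (Fin N → ℝ) → Matrix (Fin r) (Fin r) ℂ} {h : (Fin N → ℝ) → Fin r → ℂ}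

lemma IsHermitianMetricReal.continuous (hH : IsHermitianMetricReal Set.univ H) : Continuous H :=
  continuous_matrix fun a b => (hH.contDiff a b).continuous

lemma IsHermitianMetricReal.continuous_matRealPD (hH : IsHermitianMetricReal Set.univ H)
    (j : Fin N) : Continuous (matRealPD j H) :=
  continuous_matrix fun a b => (hH.contDiff_matRealPD j a b).continuous

lemma IsHermitianMetricReal.continuous_inv (hH : IsHermitianMetricReal Set.univ H) :
    Continuous fun q => (H q)⁻¹ :=
  continuous_matrix fun a b => (hH.contDiff_inv a b).continuous

lemma IsHermitianMetricReal.isHermitian_matRealPD (hH : IsHermitianMetricReal Set.univ H)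
    (j : Fin N) (p : Fin N → ℝ) : (matRealPD j H p).IsHermitian := by
  ext a b
  simp only [conjTranspose_apply, matRealPD, of_apply]
  rw [← realPD_star]
  congr 1
  funext q
  exact (hH.posDef q).1.apply a b

lemma sesq_pi_single {A : Matrix (Fin r) (Fin r) ℂ} (hA : A.IsHermitian) (u : Fin r → ℂ) (c : ℂ)
    (a : Fin r) : sesq A u (c • Pi.single a 1) = c * star ((A *ᵥ u) a) := by
  rw [sesq_smul_right, ← star_sesq hA]
  simp [sesq]

lemma vecPD_ofReal_smul (j : Fin N) {g : (Fin N → ℝ) → ℝ} (e : Fin r → ℂ) {p : Fin N → ℝ}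
    (hg : DifferentiableAt ℝ g p) :
    vecPD j (fun q => (g q : ℂ) • e) p = ((fderiv ℝ g p (Pi.single j 1) : ℝ) : ℂ) • e := by
  funext a
  simp only [vecPD, Pi.smul_apply, smul_eq_mul]
  have hg' : DifferentiableAt ℝ (fun q => (g q : ℂ)) p :=
    Complex.ofRealCLM.differentiableAt.comp p hg
  rw [realPD_mul j hg' (differentiableAt_const _),
    realPD_const, realPD_ofReal j hg.hasFDerivAt]
  simp

lemma fderiv_comp_const_sub {η : (Fin N → ℝ) → ℝ} (x y : Fin N → ℝ)
    (hη : DifferentiableAt ℝ η (x - y)) (v : Fin N → ℝ) :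
    fderiv ℝ (fun y => η (x - y)) y v = - fderiv ℝ η (x - y) v := by
  have h1 : HasFDerivAt (fun y => x - y) (-ContinuousLinearMap.id ℝ (Fin N → ℝ)) y :=
    (hasFDerivAt_id y).const_sub x
  have := hη.hasFDerivAt.comp y h1
  rw [show (fun y => η (x - y)) = η ∘ fun y => x - y from rfl, this.fderiv]
  simp

lemma vecPD_const_sub_smul (j : Fin N) {η : (Fin N → ℝ) → ℝ} (hη : Differentiable ℝ η)
    (x : Fin N → ℝ) (e : Fin r → ℂ) :
    vecPD j (fun y => ((η (x - y) : ℝ) : ℂ) • e)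
      = fun y => ((-fderiv ℝ η (x - y) (Pi.single j 1) : ℝ) : ℂ) • e := by
  funext y
  have hd : DifferentiableAt ℝ (fun y => η (x - y)) y := by
    have := (hη (x - y)).comp y ((differentiableAt_id (𝕜 := ℝ)).const_sub x)
    exact this
  rw [vecPD_ofReal_smul j e hd, fderiv_comp_const_sub x y (hη _)]

/-- The mollified form of the weak equation `L* h = 0`. -/
lemma sum_vecPD_moll_eq_zero (hH : IsHermitianMetricReal Set.univ H)
    (hm : AEStronglyMeasurable h) (hh : Integrable fun q => (sesq (H q) (h q) (h q)).re)
    (hweak : ∀ φ : (Fin N → ℝ) → Fin r → ℂ, ContDiff ℝ ∞ φ → HasCompactSupport φ →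
      ∫ q, sesq (H q) (h q) (metricLap H φ q) = 0)
    {η : (Fin N → ℝ) → ℝ} (hη : ContDiff ℝ ∞ η) (hηc : HasCompactSupport η) (x : Fin N → ℝ) :
    ∑ j, vecPD j (fun z => vecPD j (moll η fun q => H q *ᵥ h q) z
      - moll η (fun q => matRealPD j H q *ᵥ h q) z) x = 0 := by
  have hP := locallyIntegrable_mulVec hH.continuous hH.posDef hm hh hH.continuous
  have hF := fun j => locallyIntegrable_mulVec hH.continuous hH.posDef hm hh
    (hH.continuous_matRealPD j)
  let dη : Fin N → (Fin N → ℝ) → ℝ := fun j z => fderiv ℝ η z (Pi.single j 1)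
  let ddη : Fin N → (Fin N → ℝ) → ℝ := fun j z => fderiv ℝ (dη j) z (Pi.single j 1)
  have hη1 : Differentiable ℝ η := hη.differentiable (by simp)
  have hdη : ∀ j, ContDiff ℝ ∞ (dη j) := fun j => (hη.fderiv_right (by simp)).clm_apply contDiff_const
  have hddη : ∀ j, ContDiff ℝ ∞ (ddη j) :=
    fun j => ((hdη j).fderiv_right (by simp)).clm_apply contDiff_const
  have hcd : ∀ (g : (Fin N → ℝ) → ℝ), HasCompactSupport g → ∀ j,
      HasCompactSupport fun z => fderiv ℝ g z (Pi.single j 1 : Fin N → ℝ) := fun g hg j =>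
    (hg.fderiv ℝ).comp_left (g := fun L : (Fin N → ℝ) →L[ℝ] ℝ => L (Pi.single j 1)) (by simp)
  have hdηc : ∀ j, HasCompactSupport (dη j) := fun j => hcd η hηc j
  have hddηc : ∀ j, HasCompactSupport (ddη j) := fun j => hcd (dη j) (hdηc j) j
  have hC1 : ∀ {g : (Fin N → ℝ) → ℝ}, ContDiff ℝ ∞ g → ContDiff ℝ 1 g :=
    fun hg => hg.of_le (by exact_mod_cast le_top)
  have hL : ∀ j, vecPD j (fun z => vecPD j (moll η fun q => H q *ᵥ h q) z
      - moll η (fun q => matRealPD j H q *ᵥ h q) z) x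
      = moll (ddη j) (fun q => H q *ᵥ h q) x - moll (dη j) (fun q => matRealPD j H q *ᵥ h q) x := by
    intro j
    have e1 : vecPD j (moll η fun q => H q *ᵥ h q) = moll (dη j) (fun q => H q *ᵥ h q) :=
      funext fun z => vecPD_moll j (hC1 hη) hηc hP z
    have d1 : ContDiff ℝ (1 : ℕ∞) (moll (dη j) fun q => H q *ᵥ h q) :=
      contDiff_moll (hC1 (hdη j)) (hdηc j) hP
    have d2 : ContDiff ℝ (1 : ℕ∞) (moll η fun q => matRealPD j H q *ᵥ h q) :=
      contDiff_moll (hC1 hη) hηc (hF j)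
    rw [e1]
    have := vecPD_moll j (hC1 (hdη j)) (hdηc j) hP x
    have h2 := vecPD_moll j (hC1 hη) hηc (hF j) x
    funext a
    simp only [Pi.sub_apply]
    rw [← congrFun this a, ← congrFun h2 a]
    exact realPD_sub j (differentiableAt_pi_apply d1 x a) (differentiableAt_pi_apply d2 x a)
  simp only [hL]
  funext a
  let e : Fin r → ℂ := Pi.single a 1
  let φ : (Fin N → ℝ) → Fin r → ℂ := fun y => ((η (x - y) : ℝ) : ℂ) • e
  have hφ : ContDiff ℝ ∞ φ := by
    refine ContDiff.smul (Complex.ofRealCLM.contDiff.comp ?_) contDiff_const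
    exact hη.comp (by fun_prop)
  have hφc : HasCompactSupport φ := by
    refine HasCompactSupport.smul_right (f := fun y => ((η (x - y) : ℝ) : ℂ)) ?_
    exact (hasCompactSupport_sub_left hηc x).comp_left (g := fun t : ℝ => (t : ℂ)) (by simp)
  have hpt : ∀ y, sesq (H y) (h y) (metricLap H φ y)
      = star (∑ j, (((ddη j (x - y) : ℝ) : ℂ) * (H y *ᵥ h y) a
        - ((dη j (x - y) : ℝ) : ℂ) * (matRealPD j H y *ᵥ h y) a)) := by
    intro y
    rw [metricLap, sesq_sum_right, star_sum]
    refine Finset.sum_congr rfl fun j _ => ?_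
    have e1 : vecPD j φ = fun y => ((-dη j (x - y) : ℝ) : ℂ) • e :=
      vecPD_const_sub_smul j hη1 x e
    have e2 : vecPD j (vecPD j φ) y = ((ddη j (x - y) : ℝ) : ℂ) • e := by
      have := vecPD_const_sub_smul j (η := fun z => - dη j z)
        ((hdη j).differentiable (by simp)).neg x e
      rw [e1, this]
      simp [ddη, fderiv_fun_neg]
    have e3 : sesq (H y) (h y) (covD H j (vecPD j φ) y)
        = sesq (H y) (h y) (vecPD j (vecPD j φ) y)
          + sesq (matRealPD j H y) (h y) (vecPD j φ y) := by
      rw [covD_eq hH j (contDiff_vecPD (n := 2) (by norm_num) j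
          (by exact_mod_cast contDiff_infty.1 hφ 2)), sesq_add_right]
      congr 1
      simp only [sesq, mulVec_mulVec]
      rw [← Matrix.mul_assoc, hH.mul_inv, Matrix.one_mul]
    rw [e3, e2, e1, sesq_pi_single (hH.posDef y).1, sesq_pi_single (hH.isHermitian_matRealPD j y)]
    simp [sub_eq_add_neg]
  have hw := hweak φ hφ hφc
  simp only [hpt] at hw
  have hi1 : ∀ j, Integrable fun y => ((ddη j (x - y) : ℝ) : ℂ) * (H y *ᵥ h y) a := fun j => by
    simpa using (integrable_sub_smul (hddη j).continuous (hddηc j) hP x).eval a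
  have hi2 : ∀ j, Integrable fun y => ((dη j (x - y) : ℝ) : ℂ) * (matRealPD j H y *ᵥ h y) a :=
    fun j => by simpa using (integrable_sub_smul (hdη j).continuous (hdηc j) (hF j) x).eval a
  have hst : ∫ y, star (∑ j, (((ddη j (x - y) : ℝ) : ℂ) * (H y *ᵥ h y) a
        - ((dη j (x - y) : ℝ) : ℂ) * (matRealPD j H y *ᵥ h y) a))
      = star (∫ y, ∑ j, (((ddη j (x - y) : ℝ) : ℂ) * (H y *ᵥ h y) a
        - ((dη j (x - y) : ℝ) : ℂ) * (matRealPD j H y *ᵥ h y) a)) := integral_conj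
  have hi3 : ∀ j, Integrable fun y => ((ddη j (x - y) : ℝ) : ℂ) * (H y *ᵥ h y) a
      - ((dη j (x - y) : ℝ) : ℂ) * (matRealPD j H y *ᵥ h y) a := fun j => (hi1 j).sub (hi2 j)
  rw [hst, star_eq_zero, integral_finsetSum _ fun j _ => hi3 j] at hw
  rw [Finset.sum_apply, Pi.zero_apply, ← hw]
  refine Finset.sum_congr rfl fun j _ => ?_
  rw [integral_sub (hi1 j) (hi2 j), Pi.sub_apply, moll_apply (hddη j).continuous (hddηc j) hP,
    moll_apply (hdη j).continuous (hdηc j) (hF j)]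

end MollifiedEquation

section Caccioppoli

open Matrix
open scoped ContDiff

variable {N r : ℕ} {H : (Fin N → ℝ) → Matrix (Fin r) (Fin r) ℂ}

lemma vecPD_real_smul (j : Fin N) {g : (Fin N → ℝ) → ℝ} {f : (Fin N → ℝ) → Fin r → ℂ}
    {p : Fin N → ℝ} (hg : DifferentiableAt ℝ g p)
    (hf : ∀ a, DifferentiableAt ℝ (fun q => f q a) p) :
    vecPD j (fun q => (g q : ℂ) • f q) p
      = ((fderiv ℝ g p (Pi.single j 1) : ℝ) : ℂ) • f p + (g p : ℂ) • vecPD j f p := by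
  have hg' : DifferentiableAt ℝ (fun q => (g q : ℂ)) p :=
    Complex.ofRealCLM.differentiableAt.comp p hg
  funext a
  simp only [vecPD, Pi.smul_apply, smul_eq_mul, Pi.add_apply]
  rw [realPD_mul j hg' (hf a), realPD_ofReal j hg.hasFDerivAt]

lemma caccioppoli_pointwise {A : Matrix (Fin r) (Fin r) ℂ} (hA : A.PosDef) (χ κ : ℝ)
    (a b e : Fin r → ℂ) :
    χ ^ 2 / 2 * (sesq A a a).re - 5 * (κ ^ 2 * (sesq A b b).re) - 2 * (χ ^ 2 * (sesq A e e).re)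
      ≤ (sesq A (((2 * χ * κ : ℝ) : ℂ) • b + ((χ ^ 2 : ℝ) : ℂ) • a) (a - e)).re := by
  have hs : ∀ u v, (sesq A u v).re = (sesq A v u).re := fun u v => by
    rw [← star_sesq hA.1]; rfl
  have key : ∀ (c d : ℝ) (u v : Fin r → ℂ), 0 ≤ c ^ 2 * (sesq A u u).re
      + 2 * (c * d) * (sesq A u v).re + d ^ 2 * (sesq A v v).re := by
    intro c d u v
    have h := sesq_self_re_nonneg hA ((c : ℂ) • u + (d : ℂ) • v)
    simp only [sesq_add_right, sesq_add_left, sesq_smul_left, sesq_smul_right] at h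
    simp [hs v u] at h
    linarith
  have h1 := key (χ / 2) (-χ) a e
  have h2 := key (χ / 2) (2 * κ) a b
  have h3 := key κ (-χ) b e
  rw [sesq_sub_right, sesq_add_left, sesq_add_left]
  simp only [sesq_smul_left]
  simp only [Complex.sub_re, Complex.add_re, Complex.star_def, Complex.conj_ofReal,
    Complex.re_ofReal_mul]
  rw [hs a b] at h2
  linarith

lemma caccioppoli (hH : IsHermitianMetricReal Set.univ H) {f : (Fin N → ℝ) → Fin r → ℂ}
    (hf : ContDiff ℝ 2 f) {W : Fin N → (Fin N → ℝ) → Fin r → ℂ} (hW : ∀ j, ContDiff ℝ 1 (W j))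
    (heq : ∀ x, ∑ j, vecPD j (fun z => vecPD j (fun q => H q *ᵥ f q) z - W j z) x = 0)
    {e : Fin N → (Fin N → ℝ) → Fin r → ℂ}
    (he : ∀ j x, e j x = (H x)⁻¹ *ᵥ (W j x - matRealPD j H x *ᵥ f x))
    {χ : (Fin N → ℝ) → ℝ} (hχ : ContDiff ℝ 1 χ) (hχc : HasCompactSupport χ) :
    ∑ j, ∫ x, χ x ^ 2 * (sesq (H x) (vecPD j f x) (vecPD j f x)).re
      ≤ ∑ j, (10 * (∫ x, fderiv ℝ χ x (Pi.single j 1) ^ 2 * (sesq (H x) (f x) (f x)).re)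
        + 4 * ∫ x, χ x ^ 2 * (sesq (H x) (e j x) (e j x)).re) := by
  have hf1 : ContDiff ℝ 1 f := hf.of_le (by norm_num)
  have hcf : ∀ j, Continuous (vecPD j f) :=
    fun j => (contDiff_vecPD (m := 0) (by norm_num) j hf1).continuous
  have hce : ∀ j, Continuous (e j) := fun j => by
    rw [show e j = _ from funext (he j)]
    exact hH.continuous_inv.matrix_mulVec ((hW j).continuous.sub
      ((hH.continuous_matRealPD j).matrix_mulVec hf.continuous))
  have hcκ : ∀ j : Fin N, Continuous fun x => fderiv ℝ χ x (Pi.single j 1) := fun j =>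
    (hχ.continuous_fderiv (by norm_num)).clm_apply continuous_const
  have hκc : ∀ j : Fin N, HasCompactSupport fun x => fderiv ℝ χ x (Pi.single j 1) := fun j =>
    (hχc.fderiv ℝ).comp_left (g := fun L : (Fin N → ℝ) →L[ℝ] ℝ => L (Pi.single j 1)) (by simp)
  have hmul_int : ∀ {ψ : (Fin N → ℝ) → ℝ} {u : (Fin N → ℝ) → Fin r → ℂ}, Continuous ψ →
      HasCompactSupport ψ → Continuous u →
      Integrable fun x => ψ x ^ 2 * (sesq (H x) (u x) (u x)).re := by
    intro ψ u h1 h2 h3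
    refine Continuous.integrable_of_hasCompactSupport ((h1.pow 2).mul
      (Complex.continuous_re.comp (continuous_sesq hH.continuous h3 h3))) ?_
    exact HasCompactSupport.mul_right (h2.comp_left (g := fun t : ℝ => t ^ 2) (by simp))
  let V : Fin N → (Fin N → ℝ) → Fin r → ℂ := fun j z => vecPD j (fun q => H q *ᵥ f q) z - W j z
  have hV : ∀ j, ContDiff ℝ 1 (V j) := fun j =>
    (contDiff_vecPD (by norm_num) j (contDiff_mulVec hH.contDiff hf)).sub (hW j)
  let F : (Fin N → ℝ) → Fin r → ℂ := fun q => ((χ q ^ 2 : ℝ) : ℂ) • f q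
  have hF : ContDiff ℝ 1 F := (Complex.ofRealCLM.contDiff.comp (hχ.pow 2)).smul hf1
  have hFc : HasCompactSupport F :=
    HasCompactSupport.smul_right (f := fun q => ((χ q ^ 2 : ℝ) : ℂ))
      (hχc.comp_left (g := fun t : ℝ => ((t ^ 2 : ℝ) : ℂ)) (by simp))
  have hVe : ∀ j x, V j x = H x *ᵥ (vecPD j f x - e j x) := by
    intro j x
    simp only [V]
    rw [vecPD_mulVec j (fun a b => (hH.contDiff_one a b).differentiable (by norm_num) x)
      (fun a => differentiableAt_pi_apply hf1 x a), he, mulVec_sub, mulVec_mulVec, hH.mul_inv,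
      one_mulVec]
    abel
  have hFd : ∀ j x, vecPD j F x = ((2 * χ x * fderiv ℝ χ x (Pi.single j 1) : ℝ) : ℂ) • f x
      + ((χ x ^ 2 : ℝ) : ℂ) • vecPD j f x := by
    intro j x
    have hχx := hχ.differentiable (by norm_num) x
    rw [vecPD_real_smul j (hχx.fun_pow 2) fun a => differentiableAt_pi_apply hf1 x a,
      fderiv_fun_pow 2 hχx]
    simp
  have hpd : ∀ j x, realPD j (fun q => star (F q) ⬝ᵥ V j q) x
      = sesq (H x) (vecPD j F x) (vecPD j f x - e j x) + star (F x) ⬝ᵥ vecPD j (V j) x := by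
    intro j x
    rw [realPD_dotProduct j (fun a => differentiableAt_pi_apply hF x a)
      (fun a => differentiableAt_pi_apply (hV j) x a), hVe]
    rfl
  have hG : ∀ j, ContDiff ℝ 1 (fun q => star (F q) ⬝ᵥ V j q) := fun j => by
    simpa [sesq] using contDiff_sesq (A := fun _ => 1) (fun a b => contDiff_const) hF (hV j)
  have hGc : ∀ j, HasCompactSupport (fun q => star (F q) ⬝ᵥ V j q) := fun j => by
    simpa [sesq] using hasCompactSupport_sesq (fun _ => 1) (v := V j) (Or.inl hFc)
  have hGi : ∀ j, Integrable (realPD j (fun q => star (F q) ⬝ᵥ V j q)) := fun j =>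
    (contDiff_realPD (m := 0) (by norm_num) j (hG j)).continuous.integrable_of_hasCompactSupport
      (hasCompactSupport_realPD j (hGc j))
  have hzero : ∫ x, ∑ j, (sesq (H x) (vecPD j F x) (vecPD j f x - e j x)).re = 0 := by
    have h1 : ∫ x, ∑ j, realPD j (fun q => star (F q) ⬝ᵥ V j q) x = 0 := by
      rw [integral_finsetSum _ fun j _ => hGi j]
      exact Finset.sum_eq_zero fun j _ => integral_realPD_eq_zero j (hG j) (hGc j)
    have h2 : ∀ x, ∑ j, realPD j (fun q => star (F q) ⬝ᵥ V j q) x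
        = ∑ j, sesq (H x) (vecPD j F x) (vecPD j f x - e j x) := by
      intro x
      simp only [hpd, Finset.sum_add_distrib]
      rw [← dotProduct_sum, heq x, dotProduct_zero, add_zero]
    have h3 := congrArg Complex.re h1
    have h4 : Integrable fun x => ∑ j, realPD j (fun q => star (F q) ⬝ᵥ V j q) x :=
      integrable_finsetSum _ fun j _ => hGi j
    have h5 : ∫ x, (∑ j, realPD j (fun q => star (F q) ⬝ᵥ V j q) x).re
        = (∫ x, ∑ j, realPD j (fun q => star (F q) ⬝ᵥ V j q) x).re :=
      integral_re h4
    rw [← h5] at h3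
    simpa [h2] using h3
  have hi1 : ∀ j, Integrable fun x => χ x ^ 2 / 2 * (sesq (H x) (vecPD j f x) (vecPD j f x)).re :=
    fun j => by
      have := (hmul_int hχ.continuous hχc (hcf j)).const_mul (1 / 2)
      refine this.congr (Filter.Eventually.of_forall fun x => ?_)
      simp only
      ring
  have hi2 := fun j => (hmul_int (hcκ j) (hκc j) hf.continuous).const_mul 5
  have hi3 := fun j => (hmul_int hχ.continuous hχc (hce j)).const_mul 2
  have hi4 : ∀ j, Integrable fun x => χ x ^ 2 / 2 * (sesq (H x) (vecPD j f x) (vecPD j f x)).re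
      - 5 * (fderiv ℝ χ x (Pi.single j 1) ^ 2 * (sesq (H x) (f x) (f x)).re) :=
    fun j => (hi1 j).sub (hi2 j)
  have hi5 : ∀ j, Integrable fun x => χ x ^ 2 / 2 * (sesq (H x) (vecPD j f x) (vecPD j f x)).re
      - 5 * (fderiv ℝ χ x (Pi.single j 1) ^ 2 * (sesq (H x) (f x) (f x)).re)
      - 2 * (χ x ^ 2 * (sesq (H x) (e j x) (e j x)).re) := fun j => (hi4 j).sub (hi3 j)
  have hi6 : Integrable fun x => ∑ j, (sesq (H x) (vecPD j F x) (vecPD j f x - e j x)).re := by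
    refine integrable_finsetSum _ fun j _ =>
      Integrable.re (f := fun x => sesq (H x) (vecPD j F x) (vecPD j f x - e j x)) ?_
    exact integrable_sesq hH (contDiff_vecPD (m := 0) (by norm_num) j hF).continuous
      ((hcf j).sub (hce j)) (Or.inl (hasCompactSupport_vecPD j hFc))
  have hmono := integral_mono (integrable_finsetSum Finset.univ fun j _ => hi5 j) hi6 fun x =>
    Finset.sum_le_sum fun j _ => by
      rw [hFd]
      exact caccioppoli_pointwise (hH.posDef x) (χ x) (fderiv ℝ χ x (Pi.single j 1))
        (vecPD j f x) (f x) (e j x)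
  rw [hzero, integral_finsetSum _ fun j _ => hi5 j] at hmono
  have hsplit : ∀ j, ∫ x, (χ x ^ 2 / 2 * (sesq (H x) (vecPD j f x) (vecPD j f x)).re
      - 5 * (fderiv ℝ χ x (Pi.single j 1) ^ 2 * (sesq (H x) (f x) (f x)).re)
      - 2 * (χ x ^ 2 * (sesq (H x) (e j x) (e j x)).re))
      = 1 / 2 * (∫ x, χ x ^ 2 * (sesq (H x) (vecPD j f x) (vecPD j f x)).re)
        - 5 * (∫ x, fderiv ℝ χ x (Pi.single j 1) ^ 2 * (sesq (H x) (f x) (f x)).re)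
        - 2 * ∫ x, χ x ^ 2 * (sesq (H x) (e j x) (e j x)).re := by
    intro j
    rw [integral_sub (hi4 j) (hi3 j), integral_sub (hi1 j) (hi2 j), integral_const_mul,
      integral_const_mul, ← integral_const_mul (1 / 2)]
    congr 3
    funext x
    ring
  simp only [hsplit, Finset.sum_sub_distrib, ← Finset.mul_sum] at hmono
  rw [Finset.sum_add_distrib, ← Finset.mul_sum, ← Finset.mul_sum]
  linarith

end Caccioppoli

section WeakSolutions

open Matrix
open scoped ContDiff

variable {N r : ℕ} {H : (Fin N → ℝ) → Matrix (Fin r) (Fin r) ℂ} {h : (Fin N → ℝ) → Fin r → ℂ}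

lemma mulVec_moll {η : (Fin N → ℝ) → ℝ} (hη : Continuous η) (hc : HasCompactSupport η)
    {f : (Fin N → ℝ) → Fin r → ℂ} (hf : LocallyIntegrable f) (B : Matrix (Fin r) (Fin r) ℂ)
    (x : Fin N → ℝ) : B *ᵥ moll η f x = ∫ y, η (x - y) • (B *ᵥ f y) := by
  let L : (Fin r → ℂ) →L[ℝ] (Fin r → ℂ) :=
    (LinearMap.toContinuousLinearMap (Matrix.mulVecLin B)).restrictScalars ℝ
  have := L.integral_comp_comm (integrable_sub_smul hη hc hf x)
  rw [moll]
  refine Eq.trans this.symm ?_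
  congr 1
  funext y
  exact map_smul L _ _

/-- Cutoff functions equal to one on large balls, with small gradient. -/
lemma exists_cutoff (N : ℕ) (R₀ : ℝ) {θ : ℝ} (hθ : 0 < θ) :
    ∃ (χ : (Fin N → ℝ) → ℝ) (K : Set (Fin N → ℝ)), ContDiff ℝ ∞ χ ∧ HasCompactSupport χ ∧
      IsCompact K ∧ (∀ x, 0 ≤ χ x) ∧ (∀ x, χ x ≤ 1) ∧ (∀ x ∈ Metric.ball 0 R₀, χ x = 1) ∧
      (∀ x ∉ K, χ x = 0) ∧ (∀ x ∉ K, fderiv ℝ χ x = 0) ∧ ∀ x, ‖fderiv ℝ χ x‖ ≤ θ := by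
  let b : ContDiffBump (0 : Fin N → ℝ) := ⟨1, 2, one_pos, one_lt_two⟩
  have hb : ContDiff ℝ ∞ b := b.contDiff
  obtain ⟨C, hC⟩ := (b.hasCompactSupport.fderiv ℝ).exists_bound_of_continuous
    (hb.continuous_fderiv (by simp))
  have hC0 : 0 ≤ C := (norm_nonneg _).trans (hC 0)
  let R : ℝ := max R₀ 1 + C / θ
  have hR : 0 < R := by positivity
  let χ : (Fin N → ℝ) → ℝ := fun x => b (R⁻¹ • x)
  have hχ : ContDiff ℝ ∞ χ := hb.comp (contDiff_const_smul _)
  have hχc : HasCompactSupport χ := b.hasCompactSupport.comp_smul (inv_ne_zero hR.ne')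
  refine ⟨χ, tsupport χ, hχ, hχc, hχc, fun x => b.nonneg, fun x => b.le_one, fun x hx => ?_,
    fun x hx => image_eq_zero_of_notMem_tsupport hx, fun x hx => ?_, fun x => ?_⟩
  · refine b.one_of_mem_closedBall ?_
    rw [mem_closedBall_zero_iff, norm_smul, Real.norm_of_nonneg (by positivity),
      inv_mul_le_iff₀ hR]
    rw [mem_ball_zero_iff] at hx
    have : R₀ ≤ R := (le_max_left _ _).trans (le_add_of_nonneg_right (by positivity))
    change ‖x‖ ≤ R * 1
    linarith
  · by_contra h0
    exact hx (support_fderiv_subset ℝ h0)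
  · have : fderiv ℝ χ x = R⁻¹ • fderiv ℝ b (R⁻¹ • x) := fderiv_comp_smul _
    rw [this, norm_smul, Real.norm_of_nonneg (by positivity), inv_mul_le_iff₀ hR]
    refine (hC _).trans ?_
    have h1 : C = C / θ * θ := by field_simp
    have h2 : 0 ≤ max R₀ 1 := zero_le_one.trans (le_max_right _ _)
    nlinarith

lemma exists_energy_moll_le (hH : IsHermitianMetricReal Set.univ H)
    (hm : AEStronglyMeasurable h) (hh : Integrable fun q => (sesq (H q) (h q) (h q)).re)
    (hweak : ∀ φ : (Fin N → ℝ) → Fin r → ℂ, ContDiff ℝ ∞ φ → HasCompactSupport φ →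
      ∫ q, sesq (H q) (h q) (metricLap H φ q) = 0) (R₀ : ℝ) {τ : ℝ} (hτ : 0 < τ) :
    ∃ δ > 0, ∀ η : (Fin N → ℝ) → ℝ, ContDiff ℝ ∞ η → HasCompactSupport η → (∀ z, 0 ≤ η z) →
      ∫ z, η z = 1 → (∀ z, δ ≤ ‖z‖ → η z = 0) →
      ∫ x in Metric.ball 0 R₀, ∑ j,
        (sesq (H x) (vecPD j (fun q => (H q)⁻¹ *ᵥ moll η (fun q => H q *ᵥ h q) q) x)
          (vecPD j (fun q => (H q)⁻¹ *ᵥ moll η (fun q => H q *ᵥ h q) q) x)).re ≤ τ := by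
  set M : ℝ := ∫ q, (sesq (H q) (h q) (h q)).re with hM
  have hM0 : 0 ≤ M := integral_nonneg fun q => sesq_self_re_nonneg (hH.posDef q) _
  let A : (Fin N → ℝ) → (Fin N → ℝ) → Matrix (Fin r) (Fin r) ℂ := fun x y => (H x)⁻¹ * H y
  let D : Fin N → (Fin N → ℝ) → (Fin N → ℝ) → Matrix (Fin r) (Fin r) ℂ := fun j x y =>
    (H x)⁻¹ * (matRealPD j H y - matRealPD j H x * A x y)
  have hcA : Continuous fun p : (Fin N → ℝ) × (Fin N → ℝ) => A p.1 p.2 :=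
    (hH.continuous_inv.comp continuous_fst).matrix_mul (hH.continuous.comp continuous_snd)
  have hcD : ∀ j, Continuous fun p : (Fin N → ℝ) × (Fin N → ℝ) => D j p.1 p.2 := fun j =>
    (hH.continuous_inv.comp continuous_fst).matrix_mul
      (((hH.continuous_matRealPD j).comp continuous_snd).sub
        (((hH.continuous_matRealPD j).comp continuous_fst).matrix_mul hcA))
  let α : ℝ := τ / (40 * (N + 1) * (M + 1))
  have hα : 0 < α := by positivity
  obtain ⟨χ, K, hχ, hχc, hK, hχ0, hχ1, hχR, hχK, hκK, hκ⟩ :=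
    exists_cutoff N R₀ (Real.sqrt_pos.2 hα)
  have hAx : ∀ x, A x x = 1 := fun x => hH.inv_mul x
  have hDx : ∀ j x, D j x x = 0 := fun j x => by simp [D, hAx]
  have hpos : ∀ x (u : Fin r → ℂ), u ≠ 0 → 0 < (sesq (H x) u u).re := fun x u hu =>
    (Complex.pos_iff.1 ((hH.posDef x).dotProduct_mulVec_pos hu)).1
  obtain ⟨δ₀, hδ₀, hA2⟩ := exists_pos_forall_sesq_le hH.continuous hcA hK (C := 2)
    fun x _ u hu => by
      rw [hAx, one_mulVec]
      linarith [hpos x u hu]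
  have hDj : ∀ j, ∃ δ > 0, ∀ x ∈ K, ∀ y, dist x y < δ → ∀ u,
      (sesq (H x) (D j x y *ᵥ u) (D j x y *ᵥ u)).re ≤ α * (sesq (H y) u u).re := fun j =>
    exists_pos_forall_sesq_le hH.continuous (hcD j) hK fun x _ u hu => by
      rw [hDx, zero_mulVec]
      simpa [sesq] using mul_pos hα (hpos x u hu)
  choose δ₁ hδ₁ hD2 using hDj
  obtain ⟨δ, hδ, hδ0, hδj⟩ : ∃ δ > 0, δ ≤ δ₀ ∧ ∀ j, δ ≤ δ₁ j := by
    rcases isEmpty_or_nonempty (Fin N) with hN | hN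
    · exact ⟨δ₀, hδ₀, le_rfl, fun j => hN.elim j⟩
    · refine ⟨min δ₀ (Finset.univ.inf' Finset.univ_nonempty δ₁), ?_, min_le_left _ _, fun j =>
        (min_le_right _ _).trans (Finset.inf'_le _ (Finset.mem_univ j))⟩
      exact lt_min hδ₀ ((Finset.lt_inf'_iff _).2 fun j _ => hδ₁ j)
  refine ⟨δ, hδ, fun η hη hηc hη0 hη1 hηδ => ?_⟩
  have hP := locallyIntegrable_mulVec hH.continuous hH.posDef hm hh hH.continuous
  have hF := fun j => locallyIntegrable_mulVec hH.continuous hH.posDef hm hh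
    (hH.continuous_matRealPD j)
  set f : (Fin N → ℝ) → Fin r → ℂ := fun q => (H q)⁻¹ *ᵥ moll η (fun q => H q *ᵥ h q) q with hf
  let W : Fin N → (Fin N → ℝ) → Fin r → ℂ := fun j => moll η fun q => matRealPD j H q *ᵥ h q
  let e : Fin N → (Fin N → ℝ) → Fin r → ℂ := fun j x =>
    (H x)⁻¹ *ᵥ (W j x - matRealPD j H x *ᵥ f x)
  have hf2 : ContDiff ℝ 2 f := contDiff_mulVec hH.contDiff_inv
    (contDiff_moll (n := 2) (by exact_mod_cast contDiff_infty.1 hη 2) hηc hP)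
  have hW : ∀ j, ContDiff ℝ 1 (W j) := fun j =>
    contDiff_moll (n := 1) (by exact_mod_cast contDiff_infty.1 hη 1) hηc (hF j)
  have hHf : (fun q => H q *ᵥ f q) = moll η fun q => H q *ᵥ h q := by
    funext q
    simp only [hf, mulVec_mulVec, hH.mul_inv, one_mulVec]
  have hcac := caccioppoli hH hf2 hW (e := e) (χ := χ) (fun x => by
      rw [hHf]; exact sum_vecPD_moll_eq_zero hH hm hh hweak hη hηc x) (fun j x => rfl)
    (hχ.of_le (by exact_mod_cast le_top)) hχc
  have hfe : ∀ x, f x = ∫ y, η (x - y) • (A x y *ᵥ h y) := fun x => by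
    simp only [hf, A]
    rw [mulVec_moll hη.continuous hηc hP]
    simp only [mulVec_mulVec]
  have hee : ∀ j x, e j x = ∫ y, η (x - y) • (D j x y *ᵥ h y) := fun j x => by
    have h1 : Integrable fun y => η (x - y) • ((H x)⁻¹ *ᵥ (matRealPD j H y *ᵥ h y)) := by
      have := locallyIntegrable_mulVec hH.continuous hH.posDef hm hh
        (B := fun y => (H x)⁻¹ * matRealPD j H y)
        (continuous_const.matrix_mul (hH.continuous_matRealPD j))
      simpa only [mulVec_mulVec] using integrable_sub_smul hη.continuous hηc this x
    have h2 : Integrable fun y =>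
        η (x - y) • (((H x)⁻¹ * matRealPD j H x * (H x)⁻¹) *ᵥ (H y *ᵥ h y)) := by
      have := locallyIntegrable_mulVec hH.continuous hH.posDef hm hh
        (B := fun y => (H x)⁻¹ * matRealPD j H x * (H x)⁻¹ * H y)
        (continuous_const.matrix_mul hH.continuous)
      simpa only [mulVec_mulVec] using integrable_sub_smul hη.continuous hηc this x
    simp only [e, W, mulVec_sub]
    rw [mulVec_moll hη.continuous hηc (hF j), hf]
    simp only
    rw [mulVec_mulVec, mulVec_mulVec, mulVec_moll hη.continuous hηc hP,
      ← integral_sub h1 h2]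
    congr 1
    funext y
    rw [← smul_sub]
    simp only [mulVec_mulVec, ← sub_mulVec, D, A, Matrix.mul_sub, Matrix.mul_assoc]
  have hb1 : ∀ j, ∫ x, fderiv ℝ χ x (Pi.single j 1) ^ 2 * (sesq (H x) (f x) (f x)).re
      ≤ α * 2 * M := fun j =>
    integral_cutoff_kernel_le hH.continuous hH.posDef hm hh hη.continuous hηc hη0 hη1 hηδ
      (fun x => hcA.comp (by fun_prop : Continuous fun y => (x, y))) zero_le_two
      (fun x hx y hxy => hA2 x hx y (hxy.trans_le hδ0)) (fun x => sq_nonneg _)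
      (fun x => by
        have h1 : ‖fderiv ℝ χ x (Pi.single j 1)‖ ≤ Real.sqrt α := by
          refine ((fderiv ℝ χ x).le_opNorm _).trans ?_
          rw [Pi.norm_single, norm_one, mul_one]
          exact hκ x
        rw [← Real.sq_sqrt hα.le, ← sq_abs]
        exact pow_le_pow_left₀ (abs_nonneg _) h1 2)
      (fun x hx => by simp [hκK x hx]) hfe
  have hb2 : ∀ j, ∫ x, χ x ^ 2 * (sesq (H x) (e j x) (e j x)).re ≤ 1 * α * M := fun j =>
    integral_cutoff_kernel_le hH.continuous hH.posDef hm hh hη.continuous hηc hη0 hη1 hηδ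
      (fun x => (hcD j).comp (by fun_prop : Continuous fun y => (x, y))) hα.le
      (fun x hx y hxy => hD2 j x hx y (hxy.trans_le (hδj j))) (fun x => sq_nonneg _)
      (fun x => pow_le_one₀ (hχ0 x) (hχ1 x)) (fun x hx => by simp [hχK x hx]) (hee j)
  have hcf : ∀ j, Continuous (vecPD j f) := fun j =>
    (contDiff_vecPD (m := 1) (by norm_num) j hf2).continuous
  have hcs : ∀ j, Continuous fun x => (sesq (H x) (vecPD j f x) (vecPD j f x)).re := fun j =>
    Complex.continuous_re.comp (continuous_sesq hH.continuous (hcf j) (hcf j))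
  have hs0 : ∀ j x, 0 ≤ (sesq (H x) (vecPD j f x) (vecPD j f x)).re :=
    fun j x => sesq_self_re_nonneg (hH.posDef x) _
  have hi : ∀ j, Integrable fun x => χ x ^ 2 * (sesq (H x) (vecPD j f x) (vecPD j f x)).re :=
    fun j => Continuous.integrable_of_hasCompactSupport ((hχ.continuous.pow 2).mul (hcs j))
      (HasCompactSupport.mul_right (hχc.comp_left (g := fun t : ℝ => t ^ 2) (by simp)))
  calc ∫ x in Metric.ball 0 R₀, ∑ j, (sesq (H x) (vecPD j f x) (vecPD j f x)).re
      = ∫ x in Metric.ball 0 R₀, ∑ j, χ x ^ 2 * (sesq (H x) (vecPD j f x) (vecPD j f x)).re :=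
        setIntegral_congr_fun measurableSet_ball fun x hx => by simp [hχR x hx]
    _ ≤ ∫ x, ∑ j, χ x ^ 2 * (sesq (H x) (vecPD j f x) (vecPD j f x)).re :=
        setIntegral_le_integral (integrable_finsetSum _ fun j _ => hi j)
          (Filter.Eventually.of_forall fun x =>
            Finset.sum_nonneg fun j _ => mul_nonneg (sq_nonneg _) (hs0 j x))
    _ = ∑ j, ∫ x, χ x ^ 2 * (sesq (H x) (vecPD j f x) (vecPD j f x)).re :=
        integral_finsetSum _ fun j _ => hi j
    _ ≤ ∑ j : Fin N, (10 * (α * 2 * M) + 4 * (1 * α * M)) := by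
        refine hcac.trans (Finset.sum_le_sum fun j _ => ?_)
        linarith [hb1 j, hb2 j]
    _ = (N * M) * (24 * α) := by
        rw [Finset.sum_const, Finset.card_univ, Fintype.card_fin, nsmul_eq_mul]
        ring
    _ ≤ ((N + 1) * (M + 1)) * (40 * α) := by gcongr <;> linarith
    _ = τ := by simp only [α]; field_simp

lemma norm_clm_le_sum {F : Type*} [NormedAddCommGroup F] [NormedSpace ℝ F]
    (L : (Fin N → ℝ) →L[ℝ] F) : ‖L‖ ≤ ∑ j, ‖L (Pi.single j 1)‖ := by
  refine L.opNorm_le_bound (Finset.sum_nonneg fun j _ => norm_nonneg _) fun v => ?_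
  conv_lhs => rw [pi_eq_sum_univ' v, map_sum]
  rw [Finset.sum_mul]
  refine (norm_sum_le _ _).trans (Finset.sum_le_sum fun j _ => ?_)
  rw [map_smul, norm_smul, mul_comm]
  exact mul_le_mul_of_nonneg_left (norm_le_pi_norm v j) (norm_nonneg _)

/-- A square integrable weak solution of `L* h = 0` is almost everywhere constant. -/
theorem exists_ae_eq_const_of_weak (hH : IsHermitianMetricReal Set.univ H)
    (hm : AEStronglyMeasurable h) (hh : Integrable fun q => (sesq (H q) (h q) (h q)).re)
    (hweak : ∀ φ : (Fin N → ℝ) → Fin r → ℂ, ContDiff ℝ ∞ φ → HasCompactSupport φ →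
      ∫ q, sesq (H q) (h q) (metricLap H φ q) = 0) :
    ∃ c, h =ᵐ[volume] fun _ => c := by
  have hP := locallyIntegrable_mulVec hH.continuous hH.posDef hm hh hH.continuous
  choose δ hδ hδη using fun n : ℕ => exists_energy_moll_le hH hm hh hweak n
    (τ := 1 / ((n : ℝ) + 1) ^ 2) (by positivity)
  let d : ℕ → ℝ := fun n => min (δ n) (1 / ((n : ℝ) + 1))
  have hd : ∀ n, 0 < d n := fun n => lt_min (hδ n) (by positivity)
  let b : ℕ → ContDiffBump (0 : Fin N → ℝ) := fun n =>
    ⟨d n / 2, d n, half_pos (hd n), half_lt_self (hd n)⟩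
  let η : ℕ → (Fin N → ℝ) → ℝ := fun n => (b n).normed volume
  let f : ℕ → (Fin N → ℝ) → Fin r → ℂ := fun n q =>
    (H q)⁻¹ *ᵥ moll (η n) (fun q => H q *ᵥ h q) q
  have hη : ∀ n, ContDiff ℝ ∞ (η n) := fun n => (b n).contDiff_normed
  have hηc : ∀ n, HasCompactSupport (η n) := fun n => (b n).hasCompactSupport_normed
  have hf2 : ∀ n, ContDiff ℝ 2 (f n) := fun n => contDiff_mulVec hH.contDiff_inv
    (contDiff_moll (n := 2) (by exact_mod_cast contDiff_infty.1 (hη n) 2) (hηc n) hP)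
  have hf1 : ∀ n, ContDiff ℝ 1 (f n) := fun n => (hf2 n).of_le (by norm_num)
  have hen := fun n => hδη n (η n) (hη n) (hηc n) (b n).nonneg_normed (b n).integral_normed
    fun z hz => by
      by_contra h0
      have : z ∈ Function.support ((b n).normed volume) := h0
      rw [(b n).support_normed_eq, mem_ball_zero_iff] at this
      exact absurd this (not_lt.2 ((min_le_left _ _).trans hz))
  have hd0 : Filter.Tendsto d Filter.atTop (nhds 0) :=
    squeeze_zero (fun n => (hd n).le) (fun n => min_le_right _ _)
      tendsto_one_div_add_atTop_nhds_zero_nat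
  refine exists_ae_eq_const_of_tendsto hf1 ?_ fun R => ?_
  · filter_upwards [ContDiffBump.ae_convolution_tendsto_right_of_locallyIntegrable (K := 2)
      (φ := b) hd0 (Filter.Eventually.of_forall fun n => by simp [b]; linarith) hP] with x hx
    have h1 : Filter.Tendsto (fun n => moll (η n) (fun q => H q *ᵥ h q) x) Filter.atTop
        (nhds (H x *ᵥ h x)) := by
      simpa only [moll_eq_convolution] using hx
    have h2 : Continuous fun v : Fin r → ℂ => (H x)⁻¹ *ᵥ v := continuous_const.matrix_mulVec
      continuous_id
    have h3 := (h2.tendsto _).comp h1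
    rw [mulVec_mulVec, hH.inv_mul, one_mulVec] at h3
    exact h3
  · obtain ⟨C, hC0, hC⟩ := exists_norm_sq_le_sesq hH.continuous hH.posDef
      (isCompact_closedBall (0 : Fin N → ℝ) R)
    let s : ℕ → (Fin N → ℝ) → ℝ := fun n x =>
      ∑ j, (sesq (H x) (vecPD j (f n) x) (vecPD j (f n) x)).re
    have hcf : ∀ n j, Continuous (vecPD j (f n)) := fun n j =>
      (contDiff_vecPD (m := 1) (by norm_num) j (hf2 n)).continuous
    have hcs : ∀ n, Continuous (s n) := fun n => continuous_finsetSum _ fun j _ =>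
      Complex.continuous_re.comp (continuous_sesq hH.continuous (hcf n j) (hcf n j))
    have hs0 : ∀ n x, 0 ≤ s n x := fun n x =>
      Finset.sum_nonneg fun j _ => sesq_self_re_nonneg (hH.posDef x) _
    have hsi : ∀ n (ρ : ℝ), IntegrableOn (s n) (Metric.ball 0 ρ) := fun n ρ =>
      ((hcs n).continuousOn.integrableOn_compact (isCompact_closedBall 0 ρ)).mono_set
        Metric.ball_subset_closedBall
    let V : ℝ := volume.real (Metric.ball (0 : Fin N → ℝ) R)
    have hbound : ∀ n : ℕ, R ≤ n → ∫⁻ x in Metric.ball 0 R, ‖fderiv ℝ (f n) x‖ₑ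
        ≤ ENNReal.ofReal ((N * V + C) * (1 / ((n : ℝ) + 1))) := by
      intro n hn
      set t : ℝ := (n : ℝ) + 1 with ht
      have ht0 : 0 < t := by positivity
      have hpt : ∀ x ∈ Metric.ball (0 : Fin N → ℝ) R, ‖fderiv ℝ (f n) x‖
          ≤ N * (1 / t) + (t * C) * s n x := by
        intro x hx
        have hfd : ∀ j, fderiv ℝ (f n) x (Pi.single j 1) = vecPD j (f n) x := fun j => by
          funext a
          have h1 := ((hf1 n).differentiable (by norm_num) x).hasFDerivAt
          exact congrFun (congrArg DFunLike.coe (hasFDerivAt_pi'.1 h1 a).fderiv.symm) _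
        refine (norm_clm_le_sum _).trans ?_
        simp only [hfd]
        have : ∀ j, ‖vecPD j (f n) x‖
            ≤ 1 / t + (t * C) * (sesq (H x) (vecPD j (f n) x) (vecPD j (f n) x)).re := fun j => by
          have h2 := hC x (Metric.ball_subset_closedBall hx) (vecPD j (f n) x)
          have h3 : t * ‖vecPD j (f n) x‖ ^ 2
              ≤ t * (C * (sesq (H x) (vecPD j (f n) x) (vecPD j (f n) x)).re) :=
            mul_le_mul_of_nonneg_left h2 ht0.le
          have h4 : ‖vecPD j (f n) x‖ ≤ 1 / t + t * ‖vecPD j (f n) x‖ ^ 2 := by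
            rw [div_add' _ _ _ ht0.ne', le_div_iff₀ ht0]
            nlinarith [sq_nonneg (t * ‖vecPD j (f n) x‖ - 1), norm_nonneg (vecPD j (f n) x)]
          linarith
        refine (Finset.sum_le_sum fun j _ => this j).trans (le_of_eq ?_)
        rw [Finset.sum_add_distrib, ← Finset.mul_sum, Finset.sum_const, Finset.card_univ,
          Fintype.card_fin, nsmul_eq_mul]
      have hgi : IntegrableOn (fun x => N * (1 / t) + (t * C) * s n x) (Metric.ball 0 R) :=
        (integrableOn_const (by finiteness)).add ((hsi n R).const_mul _)
      calc ∫⁻ x in Metric.ball 0 R, ‖fderiv ℝ (f n) x‖ₑ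
          ≤ ∫⁻ x in Metric.ball 0 R, ENNReal.ofReal (N * (1 / t) + (t * C) * s n x) := by
            refine setLIntegral_mono' measurableSet_ball fun x hx => ?_
            rw [← ofReal_norm]
            exact ENNReal.ofReal_le_ofReal (hpt x hx)
        _ = ENNReal.ofReal (∫ x in Metric.ball 0 R, (N * (1 / t) + (t * C) * s n x)) := by
            rw [ofReal_integral_eq_lintegral_ofReal hgi]
            exact Filter.Eventually.of_forall fun x => by
              have := hs0 n x
              simp only [Pi.zero_apply]
              positivity
        _ ≤ ENNReal.ofReal ((N * V + C) * (1 / t)) := by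
            refine ENNReal.ofReal_le_ofReal ?_
            have h0 : IntegrableOn (fun _ : Fin N → ℝ => (N : ℝ) * (1 / t)) (Metric.ball 0 R) :=
              integrableOn_const (by finiteness)
            rw [integral_add h0 ((hsi n R).const_mul _), setIntegral_const, integral_const_mul]
            have h5 : ∫ x in Metric.ball 0 R, s n x ≤ 1 / t ^ 2 :=
              (setIntegral_mono_set (hsi n n) (Filter.Eventually.of_forall fun x => hs0 n x)
                (Filter.Eventually.of_forall (Metric.ball_subset_ball hn))).trans (hen n)
            have h6 : t * C * ∫ x in Metric.ball 0 R, s n x ≤ t * C * (1 / t ^ 2) :=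
              mul_le_mul_of_nonneg_left h5 (by positivity)
            have h7 : t * C * (1 / t ^ 2) = C * (1 / t) := by field_simp
            rw [smul_eq_mul]
            change V * (N * (1 / t)) + _ ≤ _
            linarith
    have hlim : Filter.Tendsto (fun n : ℕ => ENNReal.ofReal ((N * V + C) * (1 / ((n : ℝ) + 1))))
        Filter.atTop (nhds 0) := by
      have := (tendsto_one_div_add_atTop_nhds_zero_nat (𝕜 := ℝ)).const_mul (N * V + C)
      rw [mul_zero] at this
      simpa using ENNReal.tendsto_ofReal this
    obtain ⟨n₀, hn₀⟩ := exists_nat_ge R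
    refine tendsto_of_tendsto_of_tendsto_of_le_of_le' tendsto_const_nhds hlim
      (Filter.Eventually.of_forall fun n => bot_le) ?_
    filter_upwards [Filter.eventually_ge_atTop n₀] with n hn
    exact hbound n (hn₀.trans (by exact_mod_cast hn))

end WeakSolutions

section MatrixSqrt

open Matrix
open scoped MatrixOrder Matrix.Norms.L2Operator

lemma exists_continuous_conjTranspose_mul_self {X : Type*} [TopologicalSpace X] {r : ℕ}
    {H : X → Matrix (Fin r) (Fin r) ℂ} (hH : Continuous H) (hpos : ∀ q, (H q).PosDef) :
    ∃ S : X → Matrix (Fin r) (Fin r) ℂ, Continuous S ∧ ∀ q, (S q)ᴴ * S q = H q := by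
  refine ⟨fun q => CFC.sqrt (H q), ?_, fun q => ?_⟩
  · exact CFC.continuousOn_sqrt.comp_continuous hH fun q => (hpos q).posSemidef.nonneg
  · rw [← star_eq_conjTranspose, (IsSelfAdjoint.of_nonneg (CFC.sqrt_nonneg (H q))).star_eq]
    exact CFC.sqrt_mul_sqrt_self _ (hpos q).posSemidef.nonneg

end MatrixSqrt

section HilbertSpace

open Matrix
open scoped ContDiff

lemma le_of_forall_mem_of_orthogonal {X : Type*} [NormedAddCommGroup X] [InnerProductSpace ℂ X]
    [CompleteSpace X] (P : Submodule ℂ X) {v y : X} {A κ : ℝ}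
    (hy : ∀ F ∈ Pᗮ, inner ℂ F y = 0)
    (hP : ∀ w ∈ P, -2 * (inner ℂ v w).re ≤ A + κ * (inner ℂ w w).re) :
    -2 * (inner ℂ v y).re ≤ A + κ * (inner ℂ y y).re := by
  have hmem : y ∈ closure (P : Set X) := by
    rw [← Submodule.topologicalClosure_coe, SetLike.mem_coe,
      ← Submodule.orthogonal_orthogonal_eq_closure, Submodule.mem_orthogonal]
    exact hy
  have hcl : IsClosed {w : X | -2 * (inner ℂ v w).re ≤ A + κ * (inner ℂ w w).re} :=
    isClosed_le (by fun_prop) (by fun_prop)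
  exact closure_minimal (fun w hw => hP w hw) hcl hmem

variable {N r : ℕ} {H : (Fin N → ℝ) → Matrix (Fin r) (Fin r) ℂ}

lemma metricLap_add_smul (hH : IsHermitianMetricReal Set.univ H) (c : ℂ)
    {φ ψ : (Fin N → ℝ) → Fin r → ℂ} (hφ : ContDiff ℝ 2 φ) (hψ : ContDiff ℝ 2 ψ) :
    metricLap H (φ + c • ψ) = metricLap H φ + c • metricLap H ψ := by
  have hpd : ∀ (j : Fin N) {φ ψ : (Fin N → ℝ) → Fin r → ℂ}, ContDiff ℝ 1 φ → ContDiff ℝ 1 ψ →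
      vecPD j (φ + c • ψ) = vecPD j φ + c • vecPD j ψ := by
    intro j φ ψ hφ hψ
    funext p a
    have h1 := differentiableAt_pi_apply hφ p a
    have h2 := differentiableAt_pi_apply hψ p a
    have h3 : DifferentiableAt ℝ (fun q => c * ψ q a) p := h2.const_mul c
    have h4 := realPD_add j h1 h3
    have h5 := realPD_mul j (differentiableAt_const c) h2
    rw [realPD_const] at h5
    simpa [vecPD, h5] using h4
  funext p
  simp only [metricLap, Pi.add_apply, Pi.smul_apply, Finset.smul_sum, ← Finset.sum_add_distrib]
  refine Finset.sum_congr rfl fun j _ => ?_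
  have h1 : ContDiff ℝ 1 (vecPD j φ) := contDiff_vecPD (by norm_num) j hφ
  have h2 : ContDiff ℝ 1 (vecPD j ψ) := contDiff_vecPD (by norm_num) j hψ
  have h3 : ContDiff ℝ 1 (vecPD j φ + c • vecPD j ψ) := h1.add (h2.const_smul c)
  rw [hpd j (hφ.of_le (by norm_num)) (hψ.of_le (by norm_num)), covD_eq hH j h3, covD_eq hH j h1,
    covD_eq hH j h2, hpd j h1 h2]
  simp only [Pi.add_apply, Pi.smul_apply, mulVec_add, mulVec_smul, smul_add]
  abel

/-- A continuous metric is isometric to the standard one. -/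
lemma exists_isometry_euclideanSpace (hH : IsHermitianMetricReal Set.univ H) :
    ∃ (T : (Fin N → ℝ) → (Fin r → ℂ) →ₗ[ℂ] EuclideanSpace ℂ (Fin r))
      (R : (Fin N → ℝ) → EuclideanSpace ℂ (Fin r) → Fin r → ℂ),
      (∀ q u w, inner ℂ (T q u) (T q w) = sesq (H q) u w) ∧ (∀ q w, T q (R q w) = w) ∧
      (Continuous fun z : (Fin N → ℝ) × (Fin r → ℂ) => T z.1 z.2) ∧
      Continuous fun z : (Fin N → ℝ) × EuclideanSpace ℂ (Fin r) => R z.1 z.2 := by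
  obtain ⟨S, hS, hSH⟩ := exists_continuous_conjTranspose_mul_self hH.continuous hH.posDef
  refine ⟨fun q => (WithLp.linearEquiv 2 ℂ (Fin r → ℂ)).symm.toLinearMap ∘ₗ (S q).mulVecLin,
    fun q w => ((H q)⁻¹ * (S q)ᴴ) *ᵥ w.ofLp, fun q u w => ?_, fun q w => ?_, ?_, ?_⟩
  · rw [EuclideanSpace.inner_eq_star_dotProduct, dotProduct_comm]
    change star (S q *ᵥ u) ⬝ᵥ (S q *ᵥ w) = _
    rw [sesq, ← hSH, star_mulVec, ← mulVec_mulVec, dotProduct_mulVec, dotProduct_mulVec,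
      dotProduct_mulVec]
  · have h1 : (H q)⁻¹ * (S q)ᴴ * S q = 1 := by rw [Matrix.mul_assoc, hSH, hH.inv_mul]
    change WithLp.toLp 2 (S q *ᵥ (((H q)⁻¹ * (S q)ᴴ) *ᵥ w.ofLp)) = w
    rw [mulVec_mulVec, mul_eq_one_comm.1 h1, one_mulVec]
  · exact (PiLp.continuous_toLp 2 _).comp
      ((hS.comp continuous_fst).matrix_mulVec continuous_snd)
  · exact ((hH.continuous_inv.matrix_mul hS.matrix_conjTranspose).comp
      continuous_fst).matrix_mulVec ((PiLp.continuous_ofLp 2 _).comp continuous_snd)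

/-- An inequality for all `metricLap H φ`, with `φ` a test function, extends to all square
integrable `y` orthogonal to the square integrable constants. -/
theorem le_of_forall_metricLap (hH : IsHermitianMetricReal Set.univ H)
    {v y : (Fin N → ℝ) → Fin r → ℂ} (hv : Continuous v) (hy : Continuous y)
    (hvi : Integrable fun q => (sesq (H q) (v q) (v q)).re)
    (hyi : Integrable fun q => (sesq (H q) (y q) (y q)).re)
    (hort : ∀ c : Fin r → ℂ, Integrable (fun q => (sesq (H q) c c).re) →
      ∫ q, sesq (H q) c (y q) = 0) {A κ : ℝ}
    (hle : ∀ φ : (Fin N → ℝ) → Fin r → ℂ, ContDiff ℝ ∞ φ → HasCompactSupport φ →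
      -2 * (∫ q, sesq (H q) (v q) (metricLap H φ q)).re
        ≤ A + κ * (∫ q, sesq (H q) (metricLap H φ q) (metricLap H φ q)).re) :
    -2 * (∫ q, sesq (H q) (v q) (y q)).re ≤ A + κ * (∫ q, sesq (H q) (y q) (y q)).re := by
  obtain ⟨T, R, hT, hTR, hTc, hRc⟩ := exists_isometry_euclideanSpace hH
  have hTn : ∀ q u, ‖T q u‖ ^ 2 = (sesq (H q) u u).re := fun q u => by
    rw [← hT, ← inner_self_eq_norm_sq (𝕜 := ℂ)]; rfl
  have hLp : ∀ u : (Fin N → ℝ) → Fin r → ℂ, Continuous u →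
      (Integrable fun q => (sesq (H q) (u q) (u q)).re) → MemLp (fun q => T q (u q)) 2 := by
    intro u hu hui
    have hm : AEStronglyMeasurable (fun q => T q (u q)) :=
      (hTc.comp (by fun_prop : Continuous fun q => (q, u q))).aestronglyMeasurable
    rw [memLp_two_iff_integrable_sq_norm hm]
    simpa only [hTn] using hui
  have hinner : ∀ {u w : (Fin N → ℝ) → Fin r → ℂ} {U W : Lp (EuclideanSpace ℂ (Fin r)) 2 (volume : Measure (Fin N → ℝ))}, (U =ᵐ[volume] fun q => T q (u q)) →
      (W =ᵐ[volume] fun q => T q (w q)) → inner ℂ U W = ∫ q, sesq (H q) (u q) (w q) := by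
    intro u w U W hU hW
    rw [L2.inner_def]
    refine integral_congr_ae ?_
    filter_upwards [hU, hW] with q h1 h2
    rw [h1, h2, hT]
  have hφ2 : ∀ {φ : (Fin N → ℝ) → Fin r → ℂ}, ContDiff ℝ ∞ φ → ContDiff ℝ 2 φ := fun hφ => by
    exact_mod_cast contDiff_infty.1 hφ 2
  have h0 : ∀ {n : WithTop ℕ∞}, ContDiff ℝ n (0 : (Fin N → ℝ) → Fin r → ℂ) := contDiff_const
  have hL0 : metricLap H 0 = 0 := by
    have h1 := metricLap_add_smul hH (-1) h0 h0
    simpa using h1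
  have hcs : ∀ (c : ℂ) {φ : (Fin N → ℝ) → Fin r → ℂ}, ContDiff ℝ ∞ φ → ContDiff ℝ ∞ (c • φ) :=
    fun c φ hφ => contDiff_const.smul hφ
  obtain ⟨P, hPmem⟩ : ∃ P : Submodule ℂ
      (Lp (EuclideanSpace ℂ (Fin r)) 2 (volume : Measure (Fin N → ℝ))),
      ∀ W, W ∈ P ↔ ∃ φ : (Fin N → ℝ) → Fin r → ℂ, ContDiff ℝ ∞ φ ∧ HasCompactSupport φ ∧
        W =ᵐ[volume] fun q => T q (metricLap H φ q) := by
    refine ⟨Submodule.mk (AddSubmonoid.mk (AddSubsemigroup.mk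
      {W | ∃ φ : (Fin N → ℝ) → Fin r → ℂ, ContDiff ℝ ∞ φ ∧ HasCompactSupport φ ∧
        W =ᵐ[volume] fun q => T q (metricLap H φ q)} ?_) ?_) ?_, fun W => Iff.rfl⟩
    · rintro U W ⟨φ, hφ, hφc, hU⟩ ⟨ψ, hψ, hψc, hW⟩
      refine ⟨φ + (1 : ℂ) • ψ, hφ.add (hcs 1 hψ), ?_, ?_⟩
      · rw [one_smul]
        exact hφc.add hψc
      · filter_upwards [Lp.coeFn_add U W, hU, hW] with q h1 h2 h3
        rw [h1, Pi.add_apply, h2, h3, metricLap_add_smul hH 1 (hφ2 hφ) (hφ2 hψ)]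
        simp
    · refine ⟨0, h0, HasCompactSupport.zero, ?_⟩
      filter_upwards [Lp.coeFn_zero (EuclideanSpace ℂ (Fin r)) 2 (volume : Measure (Fin N → ℝ))]
        with q hq
      rw [hq, hL0]
      simp
    · rintro c W ⟨φ, hφ, hφc, hW⟩
      refine ⟨0 + c • φ, h0.add (hcs c hφ), ?_, ?_⟩
      · exact HasCompactSupport.zero.add (HasCompactSupport.smul_left (f := fun _ => c) hφc)
      · filter_upwards [Lp.coeFn_smul c W, hW] with q h1 h2
        rw [h1, Pi.smul_apply, h2, metricLap_add_smul hH c h0 (hφ2 hφ), hL0]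
        simp
  have hV := (hLp v hv hvi).coeFn_toLp
  have hY := (hLp y hy hyi).coeFn_toLp
  have main := le_of_forall_mem_of_orthogonal P (v := (hLp v hv hvi).toLp)
    (y := (hLp y hy hyi).toLp) (A := A) (κ := κ) ?_ ?_
  · rwa [hinner hV hY, hinner hY hY] at main
  · intro F hF
    have hFP := (Submodule.mem_orthogonal' P F).1 hF
    let h : (Fin N → ℝ) → Fin r → ℂ := fun q => R q (F q)
    have hTh : ∀ q, T q (h q) = F q := fun q => hTR q _
    have hm : AEStronglyMeasurable h :=
      hRc.comp_aestronglyMeasurable (aestronglyMeasurable_id.prodMk (Lp.aestronglyMeasurable F))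
    have hFh : F =ᵐ[volume] fun q => T q (h q) :=
      Filter.Eventually.of_forall fun q => (hTh q).symm
    have hh : Integrable fun q => (sesq (H q) (h q) (h q)).re := by
      simp only [← hTn, hTh]
      exact (Lp.memLp F).integrable_norm_pow (by norm_num)
    obtain ⟨c, hc⟩ := exists_ae_eq_const_of_weak hH hm hh fun φ hφ hφc => by
      have hLφ : Integrable fun q => (sesq (H q) (metricLap H φ q) (metricLap H φ q)).re :=
        Integrable.re (f := fun q => sesq (H q) (metricLap H φ q) (metricLap H φ q))
        (integrable_sesq hH (contDiff_metricLap hH (hφ2 hφ)).continuous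
          (contDiff_metricLap hH (hφ2 hφ)).continuous (Or.inl (hasCompactSupport_metricLap hφc)))
      have hw := (hLp _ (contDiff_metricLap hH (hφ2 hφ)).continuous hLφ).coeFn_toLp
      rw [← hinner hFh hw]
      exact hFP _ ((hPmem _).2 ⟨φ, hφ, hφc, hw⟩)
    have hFc : F =ᵐ[volume] fun q => T q c := by
      filter_upwards [hc] with q hq
      rw [← hTh, hq]
    have hci : Integrable fun q => (sesq (H q) c c).re := by
      refine hh.congr ?_
      filter_upwards [hc] with q hq
      rw [hq]
    rw [hinner hFc hY]
    exact hort c hci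
  · intro W hWP
    obtain ⟨φ, hφ, hφc, hW⟩ := (hPmem W).1 hWP
    rw [hinner hV hW, hinner hW hW]
    exact hle φ hφ hφc

end HilbertSpace

section Marginal

open Matrix

variable {n m r : ℕ}

lemma norm_apply_le_of_posDef {A : Matrix (Fin r) (Fin r) ℂ} (hA : A.PosDef) (a b : Fin r) :
    ‖A a b‖ ≤ (A a a).re + (A b b).re := by
  have hs : ∀ i j, sesq A (Pi.single i 1) (Pi.single j 1) = A i j := fun i j => by
    simp [sesq]
  have h0 : ∀ i, 0 ≤ (A i i).re := fun i => by
    rw [← hs]; exact sesq_self_re_nonneg hA _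
  rcases eq_or_ne (A a b) 0 with hz | hz
  · rw [hz, norm_zero]
    exact add_nonneg (h0 a) (h0 b)
  have h1 := sesq_self_re_nonneg hA
    (((‖A a b‖ : ℝ) : ℂ) • Pi.single a 1 - star (A a b) • Pi.single b 1)
  have hba : A b a = star (A a b) := (hA.1.apply b a).symm
  have h2 : sesq A (((‖A a b‖ : ℝ) : ℂ) • Pi.single a 1 - star (A a b) • Pi.single b 1)
      (((‖A a b‖ : ℝ) : ℂ) • Pi.single a 1 - star (A a b) • Pi.single b 1)
      = ((‖A a b‖ ^ 2 : ℝ) : ℂ) * (A a a + A b b - ((2 * ‖A a b‖ : ℝ) : ℂ)) := by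
    have hn : A a b * star (A a b) = ((‖A a b‖ ^ 2 : ℝ) : ℂ) := by
      rw [Complex.ofReal_pow]; exact Complex.mul_conj' _
    simp only [sub_eq_add_neg, ← neg_smul, sesq_add_left, sesq_add_right, sesq_smul_left,
      sesq_smul_right, hs, hba]
    push_cast at hn ⊢
    simp only [star_neg, RCLike.star_def, Complex.conj_ofReal, Complex.conj_conj] at hn ⊢
    linear_combination (A b b - 2 * (‖A a b‖ : ℂ)) * hn
  rw [h2, Complex.re_ofReal_mul] at h1
  have h3 : 0 < ‖A a b‖ ^ 2 := by positivity
  have h4 := nonneg_of_mul_nonneg_right h1 h3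
  simp at h4
  linarith [norm_nonneg (A a b)]

lemma measurePreserving_append (n m : ℕ) :
    MeasurePreserving (fun z : (Fin n → ℝ) × (Fin m → ℝ) => Fin.append z.1 z.2) := by
  have h1 := volume_measurePreserving_sumPiEquivProdPi_symm (fun _ : Fin n ⊕ Fin m => ℝ)
  have h2 := volume_measurePreserving_piCongrLeft (fun _ : Fin (n + m) => ℝ) finSumFinEquiv
  have h3 : (fun z : (Fin n → ℝ) × (Fin m → ℝ) => Fin.append z.1 z.2)
      = MeasurableEquiv.piCongrLeft (fun _ : Fin (n + m) => ℝ) finSumFinEquiv ∘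
        (MeasurableEquiv.sumPiEquivProdPi (fun _ : Fin n ⊕ Fin m => ℝ)).symm := by
    funext z i
    refine Fin.addCases (fun j => ?_) (fun j => ?_) i
    · rw [Fin.append_left, ← finSumFinEquiv_apply_left, Function.comp_apply,
        MeasurableEquiv.coe_piCongrLeft, Equiv.piCongrLeft_apply_apply]
      rfl
    · rw [Fin.append_right, ← finSumFinEquiv_apply_right, Function.comp_apply,
        MeasurableEquiv.coe_piCongrLeft, Equiv.piCongrLeft_apply_apply]
      rfl
  rw [h3]
  exact h2.comp h1

lemma measurableEmbedding_append (n m : ℕ) :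
    MeasurableEmbedding (fun z : (Fin n → ℝ) × (Fin m → ℝ) => Fin.append z.1 z.2) :=
  (Fin.appendHomeomorph (X := ℝ) n m).measurableEmbedding

variable {Gt : (Fin (n + m) → ℝ) → Matrix (Fin r) (Fin r) ℂ}
  {G : (Fin n → ℝ) → Matrix (Fin r) (Fin r) ℂ}

/-- Fubini's theorem for an entry of a metric and its fibre integral. -/
lemma integral_comp_castAdd_mul (hGt : IsHermitianMetricReal Set.univ Gt)
    (hGt_int : ∀ (t : Fin n → ℝ) (a b : Fin r),
      Integrable (fun x : Fin m → ℝ => Gt (Fin.append t x) a b))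
    (hG : ∀ (t : Fin n → ℝ) (a b : Fin r), G t a b = ∫ x : Fin m → ℝ, Gt (Fin.append t x) a b)
    (hGc : Continuous G) {β : (Fin n → ℝ) → ℂ} (hβ : Continuous β) (hβc : HasCompactSupport β)
    (a b : Fin r) :
    Integrable (fun p : Fin (n + m) → ℝ => β (fun i => p (Fin.castAdd m i)) * Gt p a b) ∧
      ∫ p : Fin (n + m) → ℝ, β (fun i => p (Fin.castAdd m i)) * Gt p a b
        = ∫ t, β t * G t a b := by
  let f : (Fin n → ℝ) × (Fin m → ℝ) → ℂ := fun z => β z.1 * Gt (Fin.append z.1 z.2) a b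
  have hf : Continuous f := (hβ.comp continuous_fst).mul
    ((continuous_entry hGt.continuous a b).comp (Fin.appendHomeomorph (X := ℝ) n m).continuous)
  have hcomp : (fun p : Fin (n + m) → ℝ => β (fun i => p (Fin.castAdd m i)) * Gt p a b) ∘
      (fun z : (Fin n → ℝ) × (Fin m → ℝ) => Fin.append z.1 z.2) = f := by
    funext z
    simp [f, Fin.append_left]
  have hre : ∀ (t : Fin n → ℝ) (c : Fin r),
      Integrable fun x : Fin m → ℝ => (Gt (Fin.append t x) c c).re := fun t c => (hGt_int t c c).re
  have hreG : ∀ (t : Fin n → ℝ) (c : Fin r),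
      ∫ x : Fin m → ℝ, (Gt (Fin.append t x) c c).re = (G t c c).re := fun t c => by
    rw [hG]
    exact integral_re (hGt_int t c c)
  have hfi : Integrable f (volume.prod volume) := by
    rw [integrable_prod_iff hf.aestronglyMeasurable]
    refine ⟨Filter.Eventually.of_forall fun t => ?_, ?_⟩
    · exact (hGt_int t a b).const_mul (β t)
    have hB : Integrable fun t => ‖β t‖ * ((G t a a).re + (G t b b).re) := by
      refine Continuous.integrable_of_hasCompactSupport ?_ hβc.norm.mul_right
      exact hβ.norm.mul ((Complex.continuous_re.comp (continuous_entry hGc a a)).add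
        (Complex.continuous_re.comp (continuous_entry hGc b b)))
    refine hB.mono' hf.norm.aestronglyMeasurable.integral_prod_right'
      (Filter.Eventually.of_forall fun t => ?_)
    rw [Real.norm_of_nonneg (integral_nonneg fun x => norm_nonneg _)]
    simp only [f, norm_mul]
    rw [integral_const_mul, ← hreG, ← hreG, ← integral_add (hre t a) (hre t b)]
    exact mul_le_mul_of_nonneg_left (integral_mono (hGt_int t a b).norm ((hre t a).add (hre t b))
      fun x => norm_apply_le_of_posDef (hGt.posDef _) a b) (norm_nonneg _)
  refine ⟨?_, ?_⟩
  · rw [← (measurePreserving_append n m).integrable_comp_emb (measurableEmbedding_append n m),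
      hcomp]
    exact hfi
  · rw [← (measurePreserving_append n m).integral_comp (measurableEmbedding_append n m)]
    have h1 := integral_prod f hfi
    have h2 : ∀ t, ∫ x, f (t, x) = β t * G t a b := fun t => by
      simp only [f]
      rw [integral_const_mul, ← hG]
    simp only [h2] at h1
    rw [← h1, ← hcomp]
    rfl

end Marginal

section TwistedBochner

open Matrix

variable {N r : ℕ} {G : (Fin N → ℝ) → Matrix (Fin r) (Fin r) ℂ}

lemma continuous_realChernCurv (hG : IsHermitianMetricReal Set.univ G) (j k : Fin N) :
    Continuous (realChernCurv G j k) := by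
  refine continuous_matrix fun a b => ?_
  simp only [realChernCurv, of_apply]
  refine (contDiff_realPD (m := 0) (n := 1) (by norm_num) k ?_).continuous.neg
  simp only [mul_apply]
  exact ContDiff.sum fun c _ => ((hG.contDiff_inv a c).of_le (by norm_num)).mul
    (hG.contDiff_matRealPD j c b)

/-- The integrand of the Bochner formula for the weight-free metric `G`. -/
def bochnerDensity (G : (Fin N → ℝ) → Matrix (Fin r) (Fin r) ℂ) (v : (Fin N → ℝ) → Fin r → ℂ)
    (p : Fin N → ℝ) : ℝ :=
  (∑ j, ∑ k, sesq (G p) (vecPD j (vecPD k v) p) (vecPD j (vecPD k v) p)).re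
    + (∑ j, ∑ k, sesq (G p) (vecPD k v p) (realChernCurv G j k p *ᵥ vecPD j v p)).re

lemma continuous_vecPD {v : (Fin N → ℝ) → Fin r → ℂ} (hv : ContDiff ℝ 1 v) (j : Fin N) :
    Continuous (vecPD j v) :=
  (contDiff_vecPD (m := 0) (n := 1) (by norm_num) j hv).continuous

lemma vecPD_const (j : Fin N) (u : Fin r → ℂ) (p : Fin N → ℝ) :
    vecPD j (fun _ => u) p = 0 :=
  funext fun a => realPD_const j (u a) p

lemma vecPD_eventuallyEq (j : Fin N) {f g : (Fin N → ℝ) → Fin r → ℂ} {p : Fin N → ℝ}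
    (h : f =ᶠ[nhds p] g) : vecPD j f =ᶠ[nhds p] vecPD j g := by
  filter_upwards [h.eventuallyEq_nhds] with q hq
  funext a
  exact realPD_of_eventuallyEq j (hq.mono fun x hx => congrFun hx a)

lemma continuous_bochnerDensity (hG : IsHermitianMetricReal Set.univ G)
    {v : (Fin N → ℝ) → Fin r → ℂ} (hv : ContDiff ℝ 3 v) : Continuous (bochnerDensity G v) := by
  have h1 : ∀ k, Continuous (vecPD k v) := continuous_vecPD (hv.of_le (by norm_num))
  have h2 : ∀ j k, Continuous (vecPD j (vecPD k v)) := fun j k =>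
    continuous_vecPD (contDiff_vecPD (m := 1) (n := 3) (by norm_num) k hv) j
  refine (Complex.continuous_re.comp ?_).add (Complex.continuous_re.comp ?_)
  · exact continuous_finsetSum _ fun j _ => continuous_finsetSum _ fun k _ =>
      continuous_sesq hG.continuous (h2 j k) (h2 j k)
  · exact continuous_finsetSum _ fun j _ => continuous_finsetSum _ fun k _ =>
      continuous_sesq hG.continuous (h1 k) ((continuous_realChernCurv hG j k).matrix_mulVec (h1 j))

lemma hasCompactSupport_bochnerDensity (G : (Fin N → ℝ) → Matrix (Fin r) (Fin r) ℂ)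
    {v : (Fin N → ℝ) → Fin r → ℂ} (hc : HasCompactSupport v) :
    HasCompactSupport (bochnerDensity G v) := by
  refine HasCompactSupport.intro' hc (isClosed_tsupport v) fun p hp => ?_
  have h0 : ∀ (j : Fin N) {f : (Fin N → ℝ) → Fin r → ℂ}, f =ᶠ[nhds p] 0 →
      vecPD j f =ᶠ[nhds p] 0 := fun j f hf =>
    (vecPD_eventuallyEq j hf).trans (.of_eq (funext (vecPD_const j 0)))
  have hv := notMem_tsupport_iff_eventuallyEq.1 hp
  have h1 : ∀ j, vecPD j v p = 0 := fun j => (h0 j hv).eq_of_nhds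
  have h2 : ∀ j k, vecPD j (vecPD k v) p = 0 := fun j k => (h0 j (h0 k hv)).eq_of_nhds
  simp [bochnerDensity, h1, h2, sesq]

lemma bochnerDensity_nonneg (hG : IsHermitianMetricReal Set.univ G)
    (hN : NakanoSemiPositiveReal Set.univ G) (v : (Fin N → ℝ) → Fin r → ℂ) (p : Fin N → ℝ) :
    0 ≤ bochnerDensity G v p := by
  refine add_nonneg ?_ ?_
  · simp only [Complex.re_sum]
    exact Finset.sum_nonneg fun j _ => Finset.sum_nonneg fun k _ =>
      sesq_self_re_nonneg (hG.posDef p) _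
  · rw [← nakano_sum_eq_sesq (G p) (fun j k => realChernCurv G j k p) (fun j => vecPD j v p)]
    exact hN p (Set.mem_univ p) _

lemma re_integral_metricLap_gaussTwist (hG : IsHermitianMetricReal Set.univ G)
    (lam c : Fin N → ℝ) {v : (Fin N → ℝ) → Fin r → ℂ} (hv : ContDiff ℝ 3 v)
    (hc : HasCompactSupport v) :
    (∫ p, sesq (gaussTwist lam c G p) (metricLap (gaussTwist lam c G) v p)
        (metricLap (gaussTwist lam c G) v p)).re
      = (∫ p, gaussWeight lam c p * bochnerDensity G v p)
        + ∑ j, lam j * (∫ p, sesq (gaussTwist lam c G p) (vecPD j v p) (vecPD j v p)).re := by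
  have hH := isHermitianMetricReal_gaussTwist hG lam c
  have h1 : ∀ k, Continuous (vecPD k v) := continuous_vecPD (hv.of_le (by norm_num))
  have hk1 : ∀ k, HasCompactSupport (vecPD k v) := fun k => hasCompactSupport_vecPD k hc
  have h2 : ∀ j k, Continuous (vecPD j (vecPD k v)) := fun j k =>
    continuous_vecPD (contDiff_vecPD (m := 1) (n := 3) (by norm_num) k hv) j
  have i1 : Integrable fun p => ∑ j, ∑ k, sesq (gaussTwist lam c G p)
      (vecPD j (vecPD k v) p) (vecPD j (vecPD k v) p) :=
    integrable_finsetSum _ fun j _ => integrable_finsetSum _ fun k _ =>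
      integrable_sesq hH (h2 j k) (h2 j k) (Or.inl (hasCompactSupport_vecPD j (hk1 k)))
  have i2 : Integrable fun p => ∑ j, ∑ k, sesq (gaussTwist lam c G p) (vecPD k v p)
      (realChernCurv (gaussTwist lam c G) j k p *ᵥ vecPD j v p) :=
    integrable_finsetSum _ fun j _ => integrable_finsetSum _ fun k _ =>
      integrable_sesq hH (h1 k) ((continuous_realChernCurv hH j k).matrix_mulVec (h1 j))
        (Or.inl (hk1 k))
  have i3 : ∀ j, Integrable fun p => sesq (gaussTwist lam c G p) (vecPD j v p) (vecPD j v p) :=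
    fun j => integrable_sesq hH (h1 j) (h1 j) (Or.inl (hk1 j))
  have i4 : Integrable fun p => gaussWeight lam c p * bochnerDensity G v p :=
    (((contDiff_gaussWeight (n := 0) lam c).continuous.mul
      (continuous_bochnerDensity hG hv))).integrable_of_hasCompactSupport
      (hasCompactSupport_bochnerDensity G hc).mul_left
  have h3 : ∀ j, (∫ p, sesq (gaussTwist lam c G p) (vecPD j v p) (vecPD j v p)).re
      = ∫ p, (sesq (gaussTwist lam c G p) (vecPD j v p) (vecPD j v p)).re := fun j =>
    (integral_re (i3 j)).symm
  have i5 : ∀ j, Integrable fun p =>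
      lam j * (sesq (gaussTwist lam c G p) (vecPD j v p) (vecPD j v p)).re := fun j =>
    (i3 j).re.const_mul (lam j)
  rw [integral_sesq_metricLap_self hH hv hc, ← integral_add i1 i2]
  simp only [h3, ← integral_const_mul]
  rw [← integral_finsetSum _ fun j _ => i5 j, ← integral_add i4
    (integrable_finsetSum _ fun j _ => i5 j)]
  refine (integral_re (i1.add i2)).symm.trans (integral_congr_ae (.of_forall fun p => ?_))
  simp only [bochnerDensity, Pi.add_apply, sesq_realChernCurv_gaussTwist hG, sesq_gaussTwist,
    ← Finset.mul_sum, Finset.sum_add_distrib, Finset.sum_ite_eq, Finset.mem_univ, if_true]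
  simp only [RCLike.re_eq_complex_re, ← mul_add, Complex.re_ofReal_mul, Complex.add_re,
    Complex.re_sum]
  simp only [mul_add, Finset.mul_sum, add_assoc]
  congr 2
  exact Finset.sum_congr rfl fun j _ => by ring

lemma sum_lam_mul_le_re_integral_metricLap (hG : IsHermitianMetricReal Set.univ G)
    (hN : NakanoSemiPositiveReal Set.univ G)
    (lam c : Fin N → ℝ) {v : (Fin N → ℝ) → Fin r → ℂ} (hv : ContDiff ℝ 3 v)
    (hc : HasCompactSupport v) :
    ∑ j, lam j * (∫ p, sesq (gaussTwist lam c G p) (vecPD j v p) (vecPD j v p)).re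
      ≤ (∫ p, sesq (gaussTwist lam c G p) (metricLap (gaussTwist lam c G) v p)
        (metricLap (gaussTwist lam c G) v p)).re := by
  rw [re_integral_metricLap_gaussTwist hG lam c hv hc]
  exact le_add_of_nonneg_left (integral_nonneg fun p =>
    mul_nonneg (gaussWeight_pos lam c p).le (bochnerDensity_nonneg hG hN v p))

/-- Laplace's method: Gaussian averages concentrate at the centre. -/
lemma nonneg_of_integral_gaussWeight_nonneg {D : (Fin N → ℝ) → ℝ} (hD : Continuous D)
    (hc : HasCompactSupport D) (c : Fin N → ℝ)
    (h : ∀ k : ℕ, 0 < k → 0 ≤ ∫ p, gaussWeight (fun _ => (k : ℝ)) c p * D p) : 0 ≤ D c := by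
  obtain ⟨R, hR0, hR⟩ : ∃ R, 0 < R ∧ tsupport D ⊆ Metric.closedBall c R := by
    obtain ⟨R, hR⟩ := hc.isCompact.isBounded.subset_closedBall c
    exact ⟨max R 1, by positivity, hR.trans (Metric.closedBall_subset_closedBall (le_max_left _ _))⟩
  have hlt : ∀ y ∈ Metric.closedBall c R, y ≠ c →
      gaussWeight (fun _ => 1) c y < gaussWeight (fun _ => 1) c c := by
    intro y _ hy
    obtain ⟨i, hi⟩ := Function.ne_iff.1 hy
    have : 0 < ∑ i, 1 / 2 * (y i - c i) ^ 2 :=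
      Finset.sum_pos' (fun i _ => by positivity)
        ⟨i, Finset.mem_univ i, by have := sub_ne_zero.2 hi; positivity⟩
    simp only [gaussWeight]
    apply Real.exp_lt_exp.2
    simpa using this
  have hcl : c ∈ closure (interior (Metric.closedBall c R)) := by
    apply subset_closure
    rw [interior_closedBall _ hR0.ne']
    exact Metric.mem_ball_self hR0
  have ht := tendsto_setIntegral_pow_smul_of_unique_maximum_of_isCompact_of_continuousOn
    (μ := volume) (isCompact_closedBall c R)
    (contDiff_gaussWeight (n := 0) (fun _ => 1) c).continuous.continuousOn hlt
    (fun y _ => (gaussWeight_pos _ c y).le) (gaussWeight_pos _ c c) hcl hD.continuousOn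
  refine ge_of_tendsto ht (Filter.eventually_atTop.2 ⟨1, fun k hk => ?_⟩)
  refine smul_nonneg (inv_nonneg.2 (setIntegral_nonneg measurableSet_closedBall fun y _ =>
    pow_nonneg (gaussWeight_pos _ c y).le k)) ?_
  have hpow : ∀ p, gaussWeight (fun _ => 1) c p ^ k = gaussWeight (fun _ => (k : ℝ)) c p := by
    intro p
    simp only [gaussWeight]
    rw [← Real.exp_nat_mul, mul_neg, Finset.mul_sum]
    congr 2
    exact Finset.sum_congr rfl fun i _ => by ring
  simp only [hpow, smul_eq_mul]
  rw [setIntegral_eq_integral_of_forall_compl_eq_zero]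
  · exact h k hk
  · intro p hp
    rw [image_eq_zero_of_notMem_tsupport fun h' => hp (hR h'), mul_zero]

end TwistedBochner

section FibreIntegral

open Matrix
open scoped ContDiff

variable {n m r : ℕ} {Gt : (Fin (n + m) → ℝ) → Matrix (Fin r) (Fin r) ℂ}
  {G : (Fin n → ℝ) → Matrix (Fin r) (Fin r) ℂ}

/-- The first `n` coordinates of a point of `ℝⁿ⁺ᵐ`. -/
def headCoords (n m : ℕ) : (Fin (n + m) → ℝ) →L[ℝ] (Fin n → ℝ) :=
  ContinuousLinearMap.pi fun i => ContinuousLinearMap.proj (Fin.castAdd m i)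

lemma headCoords_apply (p : Fin (n + m) → ℝ) :
    headCoords n m p = fun i => p (Fin.castAdd m i) := rfl

lemma headCoords_single_castAdd (j : Fin n) :
    headCoords n m (Pi.single (Fin.castAdd m j) 1) = Pi.single j 1 := by
  ext i
  simp [headCoords_apply, Pi.single_apply]

lemma headCoords_single_natAdd (j : Fin m) :
    headCoords n m (Pi.single (Fin.natAdd n j) 1) = 0 := by
  ext i
  have : Fin.castAdd m i ≠ Fin.natAdd n j := by
    intro h
    have := congrArg Fin.val h
    simp at this
    omega
  simp [headCoords_apply, this]

lemma vecPD_comp_headCoords_castAdd {v : (Fin n → ℝ) → Fin r → ℂ} (hv : ContDiff ℝ 1 v)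
    (j : Fin n) (p : Fin (n + m) → ℝ) :
    vecPD (Fin.castAdd m j) (fun q => v (headCoords n m q)) p
      = vecPD j v (headCoords n m p) := by
  funext a
  have h := (differentiableAt_pi_apply hv (headCoords n m p) a).hasFDerivAt.comp p
    (headCoords n m).hasFDerivAt
  have h' : fderiv ℝ (fun q => v (headCoords n m q) a) p = _ := h.fderiv
  simp only [vecPD, realPD]
  rw [h', ContinuousLinearMap.comp_apply, headCoords_single_castAdd]

lemma vecPD_comp_headCoords_natAdd {v : (Fin n → ℝ) → Fin r → ℂ} (hv : ContDiff ℝ 1 v)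
    (j : Fin m) (p : Fin (n + m) → ℝ) :
    vecPD (Fin.natAdd n j) (fun q => v (headCoords n m q)) p = 0 := by
  funext a
  have h := (differentiableAt_pi_apply hv (headCoords n m p) a).hasFDerivAt.comp p
    (headCoords n m).hasFDerivAt
  have h' : fderiv ℝ (fun q => v (headCoords n m q) a) p = _ := h.fderiv
  simp only [vecPD, realPD]
  rw [h', ContinuousLinearMap.comp_apply, headCoords_single_natAdd, map_zero]
  rfl

lemma gaussWeight_append (lam c : Fin n → ℝ) (p : Fin (n + m) → ℝ) :
    gaussWeight (Fin.append lam 0) (Fin.append c 0) p = gaussWeight lam c (headCoords n m p) := by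
  simp [gaussWeight, Fin.sum_univ_add, headCoords_apply]

lemma sesq_eq_sum (A : Matrix (Fin r) (Fin r) ℂ) (u v : Fin r → ℂ) :
    sesq A u v = ∑ a, ∑ b, star (u a) * v b * A a b := by
  simp only [sesq, dotProduct, mulVec, Pi.star_apply, Finset.mul_sum]
  exact Finset.sum_congr rfl fun a _ => Finset.sum_congr rfl fun b _ => by ring

/-- Pull-back from the base does not change weighted pairings. -/
lemma integral_sesq_comp_headCoords (hGt : IsHermitianMetricReal Set.univ Gt)
    (hGt_int : ∀ (t : Fin n → ℝ) (a b : Fin r),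
      Integrable (fun x : Fin m → ℝ => Gt (Fin.append t x) a b))
    (hG : ∀ (t : Fin n → ℝ) (a b : Fin r), G t a b = ∫ x : Fin m → ℝ, Gt (Fin.append t x) a b)
    (hGc : Continuous G) (lam c : Fin n → ℝ) {u v : (Fin n → ℝ) → Fin r → ℂ}
    (hu : Continuous u) (hv : Continuous v) (hc : HasCompactSupport u ∨ HasCompactSupport v) :
    Integrable (fun p => sesq (gaussTwist (Fin.append lam 0) (Fin.append c 0) Gt p)
        (u (headCoords n m p)) (v (headCoords n m p))) ∧
      ∫ p, sesq (gaussTwist (Fin.append lam 0) (Fin.append c 0) Gt p)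
        (u (headCoords n m p)) (v (headCoords n m p))
        = ∫ t, sesq (gaussTwist lam c G t) (u t) (v t) := by
  let β : Fin r → Fin r → (Fin n → ℝ) → ℂ := fun a b t =>
    (gaussWeight lam c t : ℂ) * (star (u t a) * v t b)
  have hw : Continuous fun t => (gaussWeight lam c t : ℂ) :=
    Complex.continuous_ofReal.comp (contDiff_gaussWeight (n := 0) lam c).continuous
  have hβ : ∀ a b, Continuous (β a b) := fun a b =>
    hw.mul (((continuous_apply a).comp hu).star.mul ((continuous_apply b).comp hv))
  have hβc : ∀ a b, HasCompactSupport (β a b) := by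
    intro a b
    refine HasCompactSupport.mul_left ?_
    rcases hc with h | h
    · exact (h.comp_left (g := fun z : Fin r → ℂ => star (z a)) (by simp)).mul_right
    · exact (h.comp_left (g := fun z : Fin r → ℂ => z b) (by simp)).mul_left
  have hm := fun a b => integral_comp_castAdd_mul hGt hGt_int hG hGc (hβ a b) (hβc a b) a b
  have hL : ∀ p, sesq (gaussTwist (Fin.append lam 0) (Fin.append c 0) Gt p)
      (u (headCoords n m p)) (v (headCoords n m p))
      = ∑ a, ∑ b, β a b (fun i => p (Fin.castAdd m i)) * Gt p a b := by
    intro p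
    rw [sesq_gaussTwist, gaussWeight_append, sesq_eq_sum]
    simp only [Finset.mul_sum, β, ← headCoords_apply]
    exact Finset.sum_congr rfl fun a _ => Finset.sum_congr rfl fun b _ => by ring
  have hR : ∀ t, sesq (gaussTwist lam c G t) (u t) (v t) = ∑ a, ∑ b, β a b t * G t a b := by
    intro t
    rw [sesq_gaussTwist, sesq_eq_sum]
    simp only [Finset.mul_sum, β]
    exact Finset.sum_congr rfl fun a _ => Finset.sum_congr rfl fun b _ => by ring
  have hi : ∀ a b, Integrable fun t => β a b t * G t a b := fun a b =>
    ((hβ a b).mul (continuous_entry hGc a b)).integrable_of_hasCompactSupport (hβc a b).mul_right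
  simp only [hL, hR]
  refine ⟨integrable_finsetSum _ fun a _ => integrable_finsetSum _ fun b _ => (hm a b).1, ?_⟩
  rw [integral_finsetSum _ fun a _ => integrable_finsetSum _ fun b _ => (hm a b).1,
    integral_finsetSum _ fun a _ => integrable_finsetSum _ fun b _ => hi a b]
  refine Finset.sum_congr rfl fun a _ => ?_
  rw [integral_finsetSum _ fun b _ => (hm a b).1, integral_finsetSum _ fun b _ => hi a b]
  exact Finset.sum_congr rfl fun b _ => (hm a b).2

lemma two_mul_re_sesq_le {A : Matrix (Fin r) (Fin r) ℂ} (hA : A.PosDef) (u v : Fin r → ℂ) :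
    2 * (sesq A u v).re ≤ (sesq A u u).re + (sesq A v v).re := by
  have h := sesq_self_re_nonneg hA (u - v)
  have hs : (sesq A v u).re = (sesq A u v).re := by
    rw [← star_sesq hA.1]; exact Complex.conj_re _
  have he : sesq A (u - v) (u - v) = sesq A u u - sesq A u v - sesq A v u + sesq A v v := by
    rw [sub_eq_add_neg, ← neg_one_smul ℂ v]
    simp only [sesq_add_left, sesq_add_right, sesq_smul_left, sesq_smul_right]
    simp
    ring
  rw [he] at h
  simp only [Complex.add_re, Complex.sub_re, hs] at h
  linarith

/-- The Poincaré inequality for the fibre integral of a Nakano semi-positive metric. -/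
lemma mul_sum_integral_vecPD_le (hGt : IsHermitianMetricReal Set.univ Gt)
    (hN : NakanoSemiPositiveReal Set.univ Gt)
    (hGt_int : ∀ (t : Fin n → ℝ) (a b : Fin r),
      Integrable (fun x : Fin m → ℝ => Gt (Fin.append t x) a b))
    (hG : ∀ (t : Fin n → ℝ) (a b : Fin r), G t a b = ∫ x : Fin m → ℝ, Gt (Fin.append t x) a b)
    (hGm : IsHermitianMetricReal Set.univ G) {s : ℝ} (hs : 0 < s) (c : Fin n → ℝ)
    {v : (Fin n → ℝ) → Fin r → ℂ} (hv : ContDiff ℝ 3 v) (hc : HasCompactSupport v) :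
    s * ∑ j, (∫ t, sesq (gaussTwist (fun _ => s) c G t) (vecPD j v t) (vecPD j v t)).re
      ≤ (∫ t, sesq (gaussTwist (fun _ => s) c G t) (metricLap (gaussTwist (fun _ => s) c G) v t)
        (metricLap (gaussTwist (fun _ => s) c G) v t)).re := by
  set Hn := gaussTwist (fun _ => s) c G with hHn_def
  set lam : Fin (n + m) → ℝ := Fin.append (fun _ => s) 0 with hlam
  set HN := gaussTwist lam (Fin.append c 0) Gt with hHN_def
  have hHn : IsHermitianMetricReal Set.univ Hn := isHermitianMetricReal_gaussTwist hGm _ _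
  have hHN : IsHermitianMetricReal Set.univ HN := isHermitianMetricReal_gaussTwist hGt _ _
  have hv1 : ContDiff ℝ 1 v := hv.of_le (by norm_num)
  have hv2 : ContDiff ℝ 2 v := hv.of_le (by norm_num)
  have hy : Continuous (metricLap Hn v) := (contDiff_metricLap hHn hv2).continuous
  have hyc : HasCompactSupport (metricLap Hn v) := hasCompactSupport_metricLap hc
  have hd : ∀ j, Continuous (vecPD j v) := continuous_vecPD hv1
  have hpull : ∀ {u w : (Fin n → ℝ) → Fin r → ℂ}, Continuous u → Continuous w →
      (HasCompactSupport u ∨ HasCompactSupport w) →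
      Integrable (fun p => sesq (HN p) (u (headCoords n m p)) (w (headCoords n m p))) ∧
        ∫ p, sesq (HN p) (u (headCoords n m p)) (w (headCoords n m p))
          = ∫ t, sesq (Hn t) (u t) (w t) := fun hu hw h =>
    integral_sesq_comp_headCoords hGt hGt_int hG hGm.continuous (fun _ => s) c hu hw h
  have hπ : Continuous (headCoords n m) := (headCoords n m).continuous
  have hvπ : ContDiff ℝ 1 fun q => v (headCoords n m q) := hv1.comp (headCoords n m).contDiff
  have hkey := le_of_forall_metricLap hHN (v := fun q => v (headCoords n m q))
    (y := fun q => metricLap Hn v (headCoords n m q)) (hv.continuous.comp hπ) (hy.comp hπ)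
    (hpull hv.continuous hv.continuous (Or.inl hc)).1.re (hpull hy hy (Or.inl hyc)).1.re
    (A := ∑ j, (∫ t, sesq (Hn t) (vecPD j v t) (vecPD j v t)).re) (κ := s⁻¹) ?_ ?_
  · rw [(hpull hv.continuous hy (Or.inl hc)).2, (hpull hy hy (Or.inl hyc)).2,
      integral_sesq_metricLap hHn hv1 hv2 (Or.inl hc), Complex.neg_re, Complex.re_sum] at hkey
    have h1 : ∑ j, (∫ t, sesq (Hn t) (vecPD j v t) (vecPD j v t)).re
        ≤ s⁻¹ * (∫ t, sesq (Hn t) (metricLap Hn v t) (metricLap Hn v t)).re := by linarith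
    have h2 := mul_le_mul_of_nonneg_left h1 hs.le
    rwa [mul_inv_cancel_left₀ hs.ne'] at h2
  · intro d _
    rw [(hpull (u := fun _ => d) continuous_const hy (Or.inr hyc)).2,
      integral_sesq_metricLap hHn contDiff_const hv2 (Or.inr hc)]
    simp [vecPD_const, sesq]
  · intro φ hφ hφc
    have hφ3 : ContDiff ℝ 3 φ := by exact_mod_cast contDiff_infty.1 hφ 3
    have hφ1 : ContDiff ℝ 1 φ := hφ3.of_le (by norm_num)
    have hB := sum_lam_mul_le_re_integral_metricLap hGt hN lam (Fin.append c 0) hφ3 hφc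
    rw [← hHN_def, Fin.sum_univ_add] at hB
    simp only [hlam, Fin.append_left, Fin.append_right, Pi.zero_apply, zero_mul,
      Finset.sum_const_zero, add_zero, ← Finset.mul_sum] at hB
    have hB' : ∑ j : Fin n, (∫ p, sesq (HN p) (vecPD (Fin.castAdd m j) φ p)
        (vecPD (Fin.castAdd m j) φ p)).re
        ≤ s⁻¹ * (∫ p, sesq (HN p) (metricLap HN φ p) (metricLap HN φ p)).re := by
      rw [← div_eq_inv_mul, le_div_iff₀ hs, mul_comm]
      exact hB
    rw [integral_sesq_metricLap hHN hvπ (hφ3.of_le (by norm_num)) (Or.inr hφc),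
      Fin.sum_univ_add]
    simp only [vecPD_comp_headCoords_castAdd hv1, vecPD_comp_headCoords_natAdd hv1]
    have hz : ∀ p (w : Fin r → ℂ), sesq (HN p) 0 w = 0 := fun p w => by simp [sesq]
    simp only [hz, integral_zero, Finset.sum_const_zero, add_zero, Complex.neg_re,
      Complex.re_sum]
    have hj : ∀ j : Fin n, 2 * (∫ p, sesq (HN p) (vecPD j v (headCoords n m p))
        (vecPD (Fin.castAdd m j) φ p)).re
        ≤ (∫ t, sesq (Hn t) (vecPD j v t) (vecPD j v t)).re
          + (∫ p, sesq (HN p) (vecPD (Fin.castAdd m j) φ p)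
            (vecPD (Fin.castAdd m j) φ p)).re := by
      intro j
      have hφd := continuous_vecPD hφ1 (Fin.castAdd m j)
      have hφdc := hasCompactSupport_vecPD (Fin.castAdd m j) hφc
      obtain ⟨i1, e1⟩ := hpull (hd j) (hd j) (Or.inl (hasCompactSupport_vecPD j hc))
      have i2 := integrable_sesq hHN ((hd j).comp hπ) hφd (Or.inr hφdc)
      have i3 := integrable_sesq hHN hφd hφd (Or.inr hφdc)
      rw [← e1]
      have r1 := integral_re i1
      have r2 := integral_re i2
      have r3 := integral_re i3
      simp only [RCLike.re_eq_complex_re, Function.comp_apply] at r1 r2 r3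
      rw [← r1, ← r2, ← r3, ← integral_const_mul]
      exact (integral_mono (i2.re.const_mul 2) (i1.re.add i3.re)
        fun p => two_mul_re_sesq_le (hHN.posDef p) _ _).trans_eq (integral_add i1.re i3.re)
    have hsum := Finset.sum_le_sum fun j (_ : j ∈ Finset.univ) => hj j
    rw [← Finset.mul_sum, Finset.sum_add_distrib] at hsum
    linarith

/-- A compactly supported section that is affine near `c` with prescribed derivatives there. -/
lemma exists_section_vecPD_eq (c : Fin n → ℝ) (u : Fin n → Fin r → ℂ) :
    ∃ v : (Fin n → ℝ) → Fin r → ℂ, ContDiff ℝ 3 v ∧ HasCompactSupport v ∧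
      (∀ j, vecPD j v c = u j) ∧ ∀ j k, vecPD j (vecPD k v) c = 0 := by
  let χ : ContDiffBump c := ⟨1, 2, one_pos, one_lt_two⟩
  let l : (Fin n → ℝ) → Fin r → ℂ := fun t a => ∑ j, ((t j - c j : ℝ) : ℂ) * u j a
  have hl : ContDiff ℝ 3 l := by
    refine contDiff_pi.2 fun a => ContDiff.sum fun j _ => ContDiff.mul ?_ contDiff_const
    exact Complex.ofRealCLM.contDiff.comp ((contDiff_apply ℝ ℝ j).sub contDiff_const)
  have hlD : ∀ j t, vecPD j l t = u j := by
    intro j t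
    funext a
    have h : ∀ i, HasFDerivAt (fun q : Fin n → ℝ => q i - c i)
        (ContinuousLinearMap.proj i : (Fin n → ℝ) →L[ℝ] ℝ) t := fun i =>
      (hasFDerivAt_apply (𝕜 := ℝ) i t).sub_const (c i)
    have h' : ∀ i, DifferentiableAt ℝ (fun q : Fin n → ℝ => ((q i - c i : ℝ) : ℂ)) t := fun i =>
      Complex.ofRealCLM.differentiableAt.comp t (h i).differentiableAt
    simp only [vecPD, l]
    rw [realPD_sum _ _ fun i _ => (h' i).mul_const _]
    have : ∀ i, realPD j (fun q : Fin n → ℝ => ((q i - c i : ℝ) : ℂ) * u i a) t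
        = if i = j then u i a else 0 := by
      intro i
      rw [realPD_mul j (h' i) (differentiableAt_const _), realPD_const, realPD_ofReal j (h i)]
      simp only [ContinuousLinearMap.proj_apply, Pi.single_apply]
      split_ifs <;> simp
    simp only [this, Finset.sum_ite_eq', Finset.mem_univ, if_true]
  have hv : (fun t => ((χ t : ℝ) : ℂ) • l t) =ᶠ[nhds c] l := by
    filter_upwards [χ.eventuallyEq_one] with t ht
    simp [ht]
  have h1 : ∀ j, vecPD j (fun t => ((χ t : ℝ) : ℂ) • l t) =ᶠ[nhds c] fun _ => u j := fun j =>
    (vecPD_eventuallyEq j hv).trans (.of_eq (funext (hlD j)))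
  refine ⟨fun t => ((χ t : ℝ) : ℂ) • l t, ?_, ?_, fun j => (h1 j).eq_of_nhds, fun j k => ?_⟩
  · exact (Complex.ofRealCLM.contDiff.comp χ.contDiff).smul hl
  · exact (χ.hasCompactSupport.comp_left (g := fun x : ℝ => (x : ℂ)) (by simp)).smul_right
  · rw [(vecPD_eventuallyEq j (h1 k)).eq_of_nhds, vecPD_const]

end FibreIntegral

/-- **Raufi's matrix-valued Prekopa theorem.**
Points of `ℝⁿ_t × ℝᵐ_x` are modeled as `Fin (n+m) → ℝ` via `Fin.append`. -/
theorem matrix_prekopa {n m r : ℕ}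
    -- the Hermitian metric `g̃` on the trivial bundle `ℝⁿ⁺ᵐ × ℂʳ`
    (Gt : (Fin (n + m) → ℝ) → Matrix (Fin r) (Fin r) ℂ)
    (hGt : IsHermitianMetricReal Set.univ Gt)
    (hNakano : NakanoSemiPositiveReal Set.univ Gt)
    -- `g(t) = ∫_{ℝᵐ} g̃(t,x) dV_x` is finite for every `t`
    (hGt_int : ∀ (t : Fin n → ℝ) (a b : Fin r),
      Integrable (fun x : Fin m → ℝ => Gt (Fin.append t x) a b))
    (G : (Fin n → ℝ) → Matrix (Fin r) (Fin r) ℂ)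
    (hG : ∀ (t : Fin n → ℝ) (a b : Fin r),
      G t a b = ∫ x : Fin m → ℝ, Gt (Fin.append t x) a b)
    -- and defines a `C²` Hermitian metric `g : ℝⁿ → GL(r,ℂ)`
    (hG_metric : IsHermitianMetricReal Set.univ G) :
    NakanoSemiPositiveReal Set.univ G := by
  intro c _ u
  obtain ⟨v, hv, hc, hv1, hv2⟩ := exists_section_vecPD_eq c u
  have h := nonneg_of_integral_gaussWeight_nonneg (continuous_bochnerDensity hG_metric hv)
    (hasCompactSupport_bochnerDensity G hc) c fun k hk => by
      have h1 := mul_sum_integral_vecPD_le hGt hNakano hGt_int hG hG_metric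
        (Nat.cast_pos.2 hk : (0 : ℝ) < k) c hv hc
      rw [re_integral_metricLap_gaussTwist hG_metric _ c hv hc, ← Finset.mul_sum] at h1
      linarith
  rw [nakano_sum_eq_sesq (G c) (fun j k => realChernCurv G j k c) u]
  simpa [bochnerDensity, hv1, hv2, sesq] using h

end
end

section
/- Let U ⊆ ℝᴺ be a connected open set and let Ω = U + iℝᴺ ⊆ ℂᴺ be the tube domain with base U. Let h be a C² Hermitian metric on the trivial holomorphic vector bundle E = Ω × ℂʳ which is independent of the imaginary part of z, so that h is determined by a C² map g: U → GL(r,ℂ) with values in positive definite Hermitian matrices via h(z) = g(Re z). Then (E,h) is Nakano semi-positive as an Hermitian holomorphic vector bundle if and only if (U × ℂʳ, g) is Nakano semi-positive in the real sense. -/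
open MeasureTheory Complex Metric
open scoped ENNReal ComplexOrder

noncomputable section

/-- Subharmonicity on a set for `[-∞,+∞]`-valued functions: upper semicontinuity together
with the sub-mean value inequality over circles, stated via continuous majorants. -/
def SubharmonicOn (u : ℂ → EReal) (S : Set ℂ) : Prop :=
  UpperSemicontinuousOn u S ∧
  ∀ (c : ℂ) (R : ℝ), 0 < R → Metric.closedBall c R ⊆ S →
    ∀ g : ℝ → ℝ, Continuous g →
      (∀ θ : ℝ, u (c + (R : ℂ) * Complex.exp ((θ : ℂ) * Complex.I)) ≤ (g θ : EReal)) →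
      u c ≤ (((2 * Real.pi)⁻¹ * ∫ θ in (0:ℝ)..(2 * Real.pi), g θ : ℝ) : EReal)

/-- Plurisubharmonic on a set: upper semicontinuous and subharmonic along every complex line. -/
def PlurisubharmonicOn {V : Type*} [AddCommGroup V] [Module ℂ V] [TopologicalSpace V]
    (φ : V → EReal) (Ω : Set V) : Prop :=
  UpperSemicontinuousOn φ Ω ∧
  ∀ a b : V, SubharmonicOn (fun w : ℂ => φ (a + w • b)) {w : ℂ | a + w • b ∈ Ω}

/-- A pseudoconvex domain: open, connected, and admitting a plurisubharmonic exhaustion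
function (all sublevel sets are relatively compact in the domain). -/
def PseudoconvexDomain {V : Type*} [AddCommGroup V] [Module ℂ V] [TopologicalSpace V]
    (Ω : Set V) : Prop :=
  IsOpen Ω ∧ IsConnected Ω ∧
  ∃ φ : V → EReal, PlurisubharmonicOn φ Ω ∧
    ∀ c : ℝ, ∃ K : Set V, IsCompact K ∧ K ⊆ Ω ∧ {x ∈ Ω | φ x ≤ (c : EReal)} ⊆ K

/-- Wirtinger derivative `∂f/∂z_j` (via the real Fréchet derivative). -/
def wirtD {N : ℕ} (j : Fin N) (f : (Fin N → ℂ) → ℂ) (p : Fin N → ℂ) : ℂ :=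
  (fderiv ℝ f p (Pi.single j 1) - Complex.I * fderiv ℝ f p (Pi.single j Complex.I)) / 2

/-- Wirtinger derivative `∂f/∂z̄_j` (via the real Fréchet derivative). -/
def wirtDbar {N : ℕ} (j : Fin N) (f : (Fin N → ℂ) → ℂ) (p : Fin N → ℂ) : ℂ :=
  (fderiv ℝ f p (Pi.single j 1) + Complex.I * fderiv ℝ f p (Pi.single j Complex.I)) / 2

/-- Entrywise Wirtinger derivative `∂H/∂z_j` of a matrix-valued function. -/
def matWirtD {N r : ℕ} (j : Fin N) (H : (Fin N → ℂ) → Matrix (Fin r) (Fin r) ℂ)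
    (p : Fin N → ℂ) : Matrix (Fin r) (Fin r) ℂ :=
  Matrix.of fun a b => wirtD j (fun q => H q a b) p

/-- Chern curvature coefficient `Θ^H_{jk} = -∂/∂z̄_k (H⁻¹ ∂H/∂z_j)` (entrywise). -/
def chernCurv {N r : ℕ} (H : (Fin N → ℂ) → Matrix (Fin r) (Fin r) ℂ) (j k : Fin N)
    (p : Fin N → ℂ) : Matrix (Fin r) (Fin r) ℂ :=
  Matrix.of fun a b => - wirtDbar k (fun q => ((H q)⁻¹ * matWirtD j H q) a b) p

/-- A `C²` Hermitian metric on the trivial holomorphic bundle `Ω × ℂʳ`: positive definite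
Hermitian matrix valued and `C²` entrywise. -/
def IsHermitianMetric {N r : ℕ} (Ω : Set (Fin N → ℂ))
    (H : (Fin N → ℂ) → Matrix (Fin r) (Fin r) ℂ) : Prop :=
  (∀ p ∈ Ω, (H p).PosDef) ∧ ∀ a b : Fin r, ContDiffOn ℝ 2 (fun q => H q a b) Ω

/-- Nakano semi-positivity: `∑_{j,k} (Θ^H_{jk} u_j, u_k)_H ≥ 0` at every point of `Ω`,
where `(v, w)_H = w* H v`. -/
def NakanoSemiPositive {N r : ℕ} (Ω : Set (Fin N → ℂ))
    (H : (Fin N → ℂ) → Matrix (Fin r) (Fin r) ℂ) : Prop :=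
  ∀ p ∈ Ω, ∀ u : Fin N → Fin r → ℂ,
    0 ≤ (∑ j : Fin N, ∑ k : Fin N, ∑ a : Fin r, ∑ b : Fin r,
      star (u k b) * H p b a * Matrix.mulVec (chernCurv H j k p) (u j) a).re

/-- The coordinatewise real part `ℂᴺ → ℝᴺ` as a continuous real-linear map. -/
def rePiCLM (N : ℕ) : (Fin N → ℂ) →L[ℝ] (Fin N → ℝ) :=
  ContinuousLinearMap.pi fun j => Complex.reCLM.comp (ContinuousLinearMap.proj j)

/-- The coordinatewise inclusion `ℝᴺ → ℂᴺ` as a continuous real-linear map. -/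
def ofRealPiCLM (N : ℕ) : (Fin N → ℝ) →L[ℝ] (Fin N → ℂ) :=
  ContinuousLinearMap.pi fun j => Complex.ofRealCLM.comp (ContinuousLinearMap.proj j)

theorem rePiCLM_single {N : ℕ} (j : Fin N) (c : ℂ) :
    rePiCLM N (Pi.single j c) = Pi.single j c.re := by
  ext i
  rcases eq_or_ne i j with rfl | h <;> simp [rePiCLM, *]

theorem rePiCLM_ofRealPiCLM {N : ℕ} (x : Fin N → ℝ) : rePiCLM N (ofRealPiCLM N x) = x := by
  ext i
  simp [rePiCLM, ofRealPiCLM]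

/-- The chain rule for `f ∘ Re`, which holds without differentiability of `f` because `Re` has
affine sections through every point. -/
theorem fderiv_comp_rePiCLM {N : ℕ} (f : (Fin N → ℝ) → ℂ) (z : Fin N → ℂ) :
    fderiv ℝ (fun w => f (rePiCLM N w)) z = (fderiv ℝ f (rePiCLM N z)).comp (rePiCLM N) := by
  by_cases hf : DifferentiableAt ℝ f (rePiCLM N z)
  · exact (hf.hasFDerivAt.comp z (rePiCLM N).hasFDerivAt).fderiv
  · have hfz : ¬ DifferentiableAt ℝ (fun w => f (rePiCLM N w)) z := by
      intro h
      apply hf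
      set s : (Fin N → ℝ) → (Fin N → ℂ) := fun x => z + ofRealPiCLM N (x - rePiCLM N z) with hs
      have hsz : s (rePiCLM N z) = z := by simp [hs]
      have hsd : DifferentiableAt ℝ s (rePiCLM N z) := by
        simp only [hs]
        fun_prop
      have hcomp := DifferentiableAt.comp (rePiCLM N z) (hsz.symm ▸ h) hsd
      have hsec : (fun w => f (rePiCLM N w)) ∘ s = f := by
        funext x
        simp [hs, rePiCLM_ofRealPiCLM]
      rwa [hsec] at hcomp
    rw [fderiv_zero_of_not_differentiableAt hfz, fderiv_zero_of_not_differentiableAt hf,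
      ContinuousLinearMap.zero_comp]

theorem wirtD_comp_rePiCLM {N : ℕ} (j : Fin N) (f : (Fin N → ℝ) → ℂ) (z : Fin N → ℂ) :
    wirtD j (fun w => f (rePiCLM N w)) z = 2⁻¹ * realPD j f (rePiCLM N z) := by
  simp [wirtD, realPD, fderiv_comp_rePiCLM, rePiCLM_single, div_eq_inv_mul]

theorem wirtDbar_comp_rePiCLM {N : ℕ} (j : Fin N) (f : (Fin N → ℝ) → ℂ) (z : Fin N → ℂ) :
    wirtDbar j (fun w => f (rePiCLM N w)) z = 2⁻¹ * realPD j f (rePiCLM N z) := by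
  simp [wirtDbar, realPD, fderiv_comp_rePiCLM, rePiCLM_single, div_eq_inv_mul]

theorem realPD_const_mul {N : ℕ} (j : Fin N) (c : ℂ) (f : (Fin N → ℝ) → ℂ) (x : Fin N → ℝ) :
    realPD j (fun y => c * f y) x = c * realPD j f x := by
  have h : fderiv ℝ (fun y => c * f y) x = c • fderiv ℝ f x :=
    congrFun (fderiv_const_smul_field (𝕜 := ℝ) (f := f) c) x
  simp [realPD, h]

theorem matWirtD_comp_rePiCLM {N r : ℕ} (j : Fin N)
    (G : (Fin N → ℝ) → Matrix (Fin r) (Fin r) ℂ) (z : Fin N → ℂ) :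
    matWirtD j (fun w => G (rePiCLM N w)) z = (2⁻¹ : ℂ) • matRealPD j G (rePiCLM N z) := by
  ext a b
  exact wirtD_comp_rePiCLM j (fun x => G x a b) z

theorem chernCurv_comp_rePiCLM {N r : ℕ} (G : (Fin N → ℝ) → Matrix (Fin r) (Fin r) ℂ)
    (j k : Fin N) (z : Fin N → ℂ) :
    chernCurv (fun w => G (rePiCLM N w)) j k z =
      (4⁻¹ : ℂ) • realChernCurv G j k (rePiCLM N z) := by
  ext a b
  have h := wirtDbar_comp_rePiCLM k
    (fun x => 2⁻¹ * ((G x)⁻¹ * matRealPD j G x) a b) z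
  rw [realPD_const_mul] at h
  simp only [chernCurv, realChernCurv, Matrix.of_apply, Matrix.smul_apply, smul_eq_mul,
    matWirtD_comp_rePiCLM, Matrix.mul_smul]
  rw [h]
  ring

theorem nakanoForm_comp_rePiCLM {N r : ℕ} (G : (Fin N → ℝ) → Matrix (Fin r) (Fin r) ℂ)
    (z : Fin N → ℂ) (u : Fin N → Fin r → ℂ) :
    (∑ j : Fin N, ∑ k : Fin N, ∑ a : Fin r, ∑ b : Fin r,
      star (u k b) * G (rePiCLM N z) b a *
        Matrix.mulVec (chernCurv (fun w => G (rePiCLM N w)) j k z) (u j) a).re =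
    4⁻¹ * (∑ j : Fin N, ∑ k : Fin N, ∑ a : Fin r, ∑ b : Fin r,
      star (u k b) * G (rePiCLM N z) b a *
        Matrix.mulVec (realChernCurv G j k (rePiCLM N z)) (u j) a).re := by
  have h4 : (4⁻¹ : ℂ) = ((4⁻¹ : ℝ) : ℂ) := by push_cast; rfl
  rw [← Complex.re_ofReal_mul, ← h4]
  simp only [chernCurv_comp_rePiCLM, Matrix.smul_mulVec, Pi.smul_apply, smul_eq_mul,
    Finset.mul_sum, mul_left_comm]

/-- **Nakano positivity on tube domains versus real Nakano positivity.** For a metric on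
the trivial bundle over the tube `Ω = U + iℝᴺ` depending only on `Re z`, Nakano
semi-positivity of `(Ω × ℂʳ, h)` is equivalent to Nakano semi-positivity of
`(U × ℂʳ, g)` in the real sense. -/
theorem nakano_tube_iff_real {N r : ℕ}
    (U : Set (Fin N → ℝ)) (hU_open : IsOpen U) (hU_conn : IsConnected U)
    (Ω : Set (Fin N → ℂ))
    (hΩ : Ω = {z : Fin N → ℂ | (fun j => (z j).re) ∈ U})
    (G : (Fin N → ℝ) → Matrix (Fin r) (Fin r) ℂ)
    (hG : IsHermitianMetricReal U G)
    (H : (Fin N → ℂ) → Matrix (Fin r) (Fin r) ℂ)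
    (hH : ∀ z : Fin N → ℂ, H z = G (fun j => (z j).re)) :
    NakanoSemiPositive Ω H ↔ NakanoSemiPositiveReal U G := by
  obtain rfl : H = fun w => G (rePiCLM N w) := funext hH
  subst hΩ
  constructor
  · intro h x hx u
    have hmem : (fun j => (ofRealPiCLM N x j).re) ∈ U := by
      simpa [ofRealPiCLM] using hx
    have hpos := h (ofRealPiCLM N x) hmem u
    rw [nakanoForm_comp_rePiCLM, rePiCLM_ofRealPiCLM] at hpos
    linarith
  · intro h z hz u
    have hpos := h (rePiCLM N z) hz u
    rw [nakanoForm_comp_rePiCLM]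
    positivity

end
end
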